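/- There is an absolute constant c > 0 such that for every prime p, if A and B are subsets of Z_p with |A| = |B| = n ≤ p/3, then there exist subsets A' ⊆ A and B' ⊆ B with |A'| = |B'| ≤ c·√n such that |A' + B'| ≥ 2n − 1. -/

import Mathlib

open Finset Pointwise

def rr {p : ℕ} (A B : Finset (ZMod p)) (x : ZMod p) : ℕ := (A.filter (fun a => x - a ∈ B)).card

lemma rr_shift {p : ℕ} [NeZero p] (A B : Finset (ZMod p)) (e : ZMod p) (t : ℕ) :
    ∑ x, min (rr A (B.image (· + e)) x) t = ∑ x, min (rr A B x) t := by
  refine (Fintype.sum_equiv (Equiv.addRight e) _ _ ?_).symm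
  intro x
  congr 1
  unfold rr
  congr 1
  ext a
  simp only [mem_filter, mem_image, Equiv.coe_addRight]
  refine and_congr_right fun _ => ⟨fun h => ⟨x - a, h, by ring⟩, ?_⟩
  rintro ⟨b, hb, h⟩
  have : b = x - a := by linear_combination h
  rwa [← this]

lemma rr_sum {p : ℕ} [NeZero p] (A B : Finset (ZMod p)) : ∑ x, rr A B x = A.card * B.card := by
  unfold rr
  simp_rw [Finset.card_filter]
  rw [Finset.sum_comm]
  have : ∀ a ∈ A, (∑ x : ZMod p, if x - a ∈ B then 1 else 0) = B.card := by
    intro a _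
    rw [← Finset.card_filter]
    refine Finset.card_bij (fun x _ => x - a) ?_ ?_ ?_
    · intro x hx; simpa using hx
    · intro x _ y _ h; simpa using h
    · intro b hb; exact ⟨b + a, by simpa using hb, by ring⟩
  rw [Finset.sum_congr rfl this]; simp

lemma rr_comm {p : ℕ} (A B : Finset (ZMod p)) (x : ZMod p) : rr A B x = rr B A x := by
  unfold rr
  refine Finset.card_bij (fun a _ => x - a) ?_ ?_ ?_
  · intro a ha; simp only [mem_filter] at ha ⊢; refine ⟨ha.2, by simpa using ha.1⟩
  · intro a _ b _ h; simpa using h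
  · intro b hb; simp only [mem_filter] at hb
    exact ⟨x - b, by simp only [mem_filter]; exact ⟨hb.2, by simpa using hb.1⟩, by ring⟩

lemma rr_le {p : ℕ} (A B : Finset (ZMod p)) (x : ZMod p) : rr A B x ≤ A.card :=
  Finset.card_filter_le _ _

lemma rr_le' {p : ℕ} (A B : Finset (ZMod p)) (x : ZMod p) : rr A B x ≤ B.card := by
  rw [rr_comm]; exact rr_le _ _ _

lemma rr_split_left {p : ℕ} (A A' B : Finset (ZMod p)) (h : Disjoint A A') (x : ZMod p) :
    rr (A ∪ A') B x = rr A B x + rr A' B x := by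
  unfold rr
  rw [Finset.filter_union, Finset.card_union_of_disjoint]
  exact Finset.disjoint_filter_filter h

lemma rr_split_right {p : ℕ} (A B B' : Finset (ZMod p)) (h : Disjoint B B') (x : ZMod p) :
    rr A (B ∪ B') x = rr A B x + rr A B' x := by
  rw [rr_comm, rr_split_left _ _ _ h, rr_comm, rr_comm B']

lemma rr_decomp {p : ℕ} (A B : Finset (ZMod p)) (x : ZMod p) :
    rr A B x = rr (A \ B) (B \ A) x + rr (A ∪ B) (A ∩ B) x := by
  have hA : A = (A \ B) ∪ (A ∩ B) := by ext; simp; tauto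
  have hB : B = (B \ A) ∪ (A ∩ B) := by ext; simp; tauto
  have hAB : A ∪ B = ((A \ B) ∪ (A ∩ B)) ∪ (B \ A) := by ext; simp; tauto
  have d1 : Disjoint (A \ B) (A ∩ B) := by
    rw [Finset.disjoint_left]; simp; tauto
  have d2 : Disjoint (B \ A) (A ∩ B) := by
    rw [Finset.disjoint_left]; simp; tauto
  have d3 : Disjoint ((A \ B) ∪ (A ∩ B)) (B \ A) := by
    rw [Finset.disjoint_left]; simp; tauto
  have e1 : rr A B x = rr ((A \ B) ∪ (A ∩ B)) ((B \ A) ∪ (A ∩ B)) x := by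
    rw [← hA, ← hB]
  rw [e1, hAB, rr_split_left _ _ _ d1, rr_split_right _ _ _ d2, rr_split_right _ _ _ d2,
    rr_split_left _ _ _ d3, rr_split_left _ _ _ d1, rr_comm (B \ A)]
  ring

lemma exists_shift {p : ℕ} [Fact p.Prime] (A B : Finset (ZMod p)) (hA : A.Nonempty)
    (hAp : A.card < p) (hB : 1 < B.card) :
    ∃ e : ZMod p, 1 ≤ (A ∩ B.image (· + e)).card ∧ (A ∩ B.image (· + e)).card < B.card := by
  by_contra hcon
  push Not at hcon
  obtain ⟨b, hb, b', hb', hne⟩ := Finset.one_lt_card.1 hB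
  have key : ∀ a ∈ A, a + (b' - b) ∈ A := by
    intro a ha
    have h1 : 1 ≤ (A ∩ B.image (· + (a - b))).card := by
      rw [Nat.one_le_iff_ne_zero, ← Nat.pos_iff_ne_zero, Finset.card_pos]
      exact ⟨a, by simp only [mem_inter, mem_image]; exact ⟨ha, b, hb, by ring⟩⟩
    have h2 := hcon _ h1
    have h3 : (B.image (· + (a - b))).card = B.card :=
      Finset.card_image_of_injective _ (add_left_injective _)
    have h4 : A ∩ B.image (· + (a - b)) = B.image (· + (a - b)) :=
      Finset.eq_of_subset_of_card_le Finset.inter_subset_right (by omega)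
    have : b' + (a - b) ∈ A ∩ B.image (· + (a - b)) := by
      rw [h4]; exact Finset.mem_image_of_mem _ hb'
    have := (Finset.mem_inter.1 this).1
    convert this using 1; ring
  obtain ⟨a, ha⟩ := hA
  have h2 : ∀ n : ℕ, a + n * (b' - b) ∈ A := by
    intro n
    induction n with
    | zero => simpa using ha
    | succ k ih => have := key _ ih; convert this using 1; push_cast; ring
  have hd : b' - b ≠ 0 := sub_ne_zero.2 (Ne.symm hne)
  have h3 : A = Finset.univ := by
    ext y
    simp only [mem_univ, iff_true]
    have := h2 ((y - a) / (b' - b)).val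
    rw [ZMod.natCast_zmod_val, div_mul_cancel₀ _ hd] at this
    simpa using this
  rw [h3, Finset.card_univ, ZMod.card] at hAp
  exact lt_irrefl _ hAp

theorem pollard {p : ℕ} [Fact p.Prime] : ∀ (l : ℕ) (A B : Finset (ZMod p)) (t : ℕ), B.card = l →
    t ≤ A.card → t ≤ B.card → A.card + B.card ≤ p + t →
    t * (A.card + B.card) ≤ ∑ x, min (rr A B x) t + t * t := by
  intro l
  induction l using Nat.strong_induction_on with
  | _ l ih =>
  intro A B t hl hA hB hp
  rcases Nat.eq_zero_or_pos t with rfl | ht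
  · simp
  rcases hB.eq_or_lt with heq | hlt
  · have : ∑ x, min (rr A B x) t = A.card * B.card := by
      rw [← rr_sum]
      refine Finset.sum_congr rfl fun x _ => min_eq_left ?_
      rw [heq]; exact rr_le' _ _ _
    rw [this, heq]; nlinarith
  obtain ⟨e, he1, he2⟩ := exists_shift A B (Finset.card_pos.1 (by omega)) (by omega) (by omega)
  rw [← rr_shift A B e t]
  have hc : (B.image (· + e)).card = B.card :=
      Finset.card_image_of_injective _ (add_left_injective _)
  rw [← hc] at he2 hB hlt hp hl ⊢
  generalize B.image (· + e) = B at *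
  clear hc
  set u := (A ∩ B).card with hu
  have hun := Finset.card_union_add_card_inter A B
  have hs1 := Finset.card_sdiff_add_card_inter A B
  have hs2 := Finset.card_sdiff_add_card_inter B A
  rw [Finset.inter_comm B A] at hs2
  rcases le_or_gt t u with htu | htu
  · have := ih u (by omega) (A ∪ B) (A ∩ B) t rfl (by omega) (by omega) (by omega)
    rw [hun] at this
    refine this.trans ?_
    gcongr with x
    rw [rr_decomp A B x]; omega
  · have := ih (B \ A).card (by omega) (A \ B) (B \ A) (t - u) rfl (by omega) (by omega) (by omega)
    have h2 : ∑ x, min (rr (A \ B) (B \ A) x) (t - u) + (A ∪ B).card * u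
        ≤ ∑ x, min (rr A B x) t := by
      rw [hu, ← rr_sum, ← Finset.sum_add_distrib]
      refine Finset.sum_le_sum fun x _ => ?_
      rw [rr_decomp A B x]
      have := rr_le' (A ∪ B) (A ∩ B) x
      rw [← hu] at this ⊢
      omega
    have e1 : (A \ B).card = A.card - u := by omega
    have e2 : (B \ A).card = B.card - u := by omega
    have e3 : (A ∪ B).card = A.card + B.card - u := by omega
    rw [e1, e2] at this
    rw [e3] at h2
    obtain ⟨w, rfl⟩ := Nat.exists_eq_add_of_lt htu
    obtain ⟨a, ha⟩ : ∃ a, A.card = u + a := ⟨A.card - u, by omega⟩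
    obtain ⟨b, hb⟩ : ∃ b, B.card = u + b := ⟨B.card - u, by omega⟩
    rw [ha, hb] at this h2 ⊢
    have q1 : u + w + 1 - u = w + 1 := by omega
    have q2 : u + a + (u + b) - u = u + a + b := by omega
    have q3 : u + a - u = a := by omega
    have q4 : u + b - u = b := by omega
    rw [q1, q3, q4] at this
    rw [q1, q2] at h2
    nlinarith


def fl {p : ℕ} (A B S : Finset (ZMod p)) : ℕ := ((A ×ˢ B).filter (fun q => q.1 + q.2 ∉ S)).card

lemma fl_eq_sum {p : ℕ} (A B S : Finset (ZMod p)) :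
    fl A B S = ∑ b ∈ B, (A.filter (fun a => a + b ∉ S)).card := by
  unfold fl
  rw [Finset.card_filter, Finset.sum_product_right]
  simp_rw [Finset.card_filter]

lemma fl_eq_sum' {p : ℕ} (A B S : Finset (ZMod p)) :
    fl A B S = ∑ a ∈ A, (B.filter (fun b => a + b ∉ S)).card := by
  unfold fl
  rw [Finset.card_filter, Finset.sum_product]
  simp_rw [Finset.card_filter]

lemma fl_comm {p : ℕ} (A B S : Finset (ZMod p)) : fl A B S = fl B A S := by
  rw [fl_eq_sum, fl_eq_sum']
  simp_rw [add_comm]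

lemma fl_mono {p : ℕ} {A A' B B' S S' : Finset (ZMod p)} (hA : A ⊆ A') (hB : B ⊆ B') (hS : S' ⊆ S) :
    fl A B S ≤ fl A' B' S' := by
  unfold fl
  refine Finset.card_le_card fun q hq => ?_
  simp only [mem_filter, mem_product] at hq ⊢
  exact ⟨⟨hA hq.1.1, hB hq.1.2⟩, fun h => hq.2 (hS h)⟩

lemma fl_rr {p : ℕ} [NeZero p] (A B S : Finset (ZMod p)) :
    fl A B S = ∑ x ∈ Sᶜ, rr A B x := by
  unfold fl rr
  rw [Finset.card_eq_sum_card_fiberwise (f := fun q => q.1 + q.2) (t := Sᶜ)]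
  · refine Finset.sum_congr rfl fun x hx => ?_
    refine Finset.card_bij (fun q _ => q.1) ?_ ?_ ?_
    · rintro ⟨a, b⟩ h
      simp only [mem_filter, mem_product] at h ⊢
      refine ⟨h.1.1.1, ?_⟩
      rw [← h.2]; simpa using h.1.1.2
    · rintro ⟨a, b⟩ h ⟨a', b'⟩ h' heq
      simp only [mem_filter, mem_product] at h h' heq ⊢
      subst heq
      have : b = b' := by linear_combination h.2 - h'.2
      rw [this]
    · intro a ha
      simp only [mem_filter] at ha
      refine ⟨(a, x - a), ?_, rfl⟩
      simp only [mem_compl] at hx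
      simp only [mem_filter, mem_product]
      refine ⟨⟨ha, ?_⟩, by ring⟩
      simpa using hx
  · intro q hq
    simp only [coe_filter, Set.mem_ofPred_eq] at hq
    simpa using hq.2

lemma rob_nat {p : ℕ} [Fact p.Prime] (A B S : Finset (ZMod p)) (t : ℕ)
    (h1 : t ≤ A.card) (h2 : t ≤ B.card) (h3 : A.card + B.card ≤ p + t) :
    t * (A.card + B.card) ≤ t * S.card + fl A B S + t * t := by
  refine (pollard _ A B t rfl h1 h2 h3).trans ?_
  gcongr
  rw [fl_rr, ← Finset.sum_add_sum_compl S]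
  gcongr with x
  · refine (Finset.sum_le_card_nsmul S _ t fun x _ => min_le_right _ _).trans ?_
    simp [mul_comm]
  · exact min_le_left _ _

/-- robust Cauchy-Davenport -/
lemma rob_cd {p : ℕ} [Fact p.Prime] (A B S : Finset (ZMod p)) (y : ℝ) (hy : 1 ≤ y)
    (hf : (fl A B S : ℝ) ≤ y ^ 2) (h1 : 2 * y ≤ A.card) (h2 : 2 * y ≤ B.card)
    (h3 : A.card + B.card ≤ p) : (A.card : ℝ) + B.card ≤ S.card + 3 * y := by
  set t := ⌈y⌉₊ with ht
  have t1 : y ≤ t := Nat.le_ceil _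
  have t2 : (t : ℝ) < y + 1 := Nat.ceil_lt_add_one (by linarith)
  have k1 : t ≤ A.card := by
    have : (t : ℝ) ≤ A.card := by linarith
    exact_mod_cast this
  have k2 : t ≤ B.card := by
    have : (t : ℝ) ≤ B.card := by linarith
    exact_mod_cast this
  have := rob_nat A B S t k1 k2 (by omega)
  have : (t : ℝ) * (A.card + B.card) ≤ t * S.card + fl A B S + t * t := by exact_mod_cast this
  have h5 : (t : ℝ) * (A.card + B.card) ≤ t * (S.card + y + t) := by nlinarith
  have := le_of_mul_le_mul_left h5 (by linarith)
  linarith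

/-! batches -/

lemma top_k {β : Type*} [DecidableEq β] (f : β → ℕ) (k : ℕ) : ∀ (m : ℕ) (B : Finset β),
    B.card = k + m → ∃ B' ⊆ B, B'.card = k ∧ k * ∑ b ∈ B, f b ≤ B.card * ∑ b ∈ B', f b := by
  intro m
  induction m with
  | zero => intro B hB; exact ⟨B, Subset.rfl, by simpa using hB, by simp [hB]⟩
  | succ m ih =>
    intro B hB
    obtain ⟨b, hb, hmin⟩ := Finset.exists_min_image B f (Finset.card_pos.1 (by omega))
    have hc : (B.erase b).card = k + m := by rw [Finset.card_erase_of_mem hb]; omega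
    obtain ⟨B', h1, h2, h3⟩ := ih (B.erase b) hc
    refine ⟨B', h1.trans (Finset.erase_subset _ _), h2, ?_⟩
    have h4 : f b * (k + m) ≤ ∑ x ∈ B.erase b, f x := by
      rw [← hc, mul_comm, ← smul_eq_mul]
      exact Finset.card_nsmul_le_sum _ _ _ fun x hx => hmin x (Finset.mem_of_mem_erase hx)
    rw [← Finset.add_sum_erase B f hb, hB]
    rw [hc] at h3
    rcases Nat.eq_zero_or_pos (k + m) with h0 | h0
    · have : k = 0 := by omega
      subst this; simp
    · refine le_of_mul_le_mul_left ?_ h0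
      set X := ∑ x ∈ B.erase b, f x
      set Y := ∑ x ∈ B', f x
      calc (k + m) * (k * (f b + X)) = k * (f b * (k + m)) + k * (k + m) * X := by ring
        _ ≤ k * X + k * (k + m) * X := by gcongr
        _ = (k + m + 1) * (k * X) := by ring
        _ ≤ (k + m + 1) * ((k + m) * Y) := by gcongr
        _ = _ := by ring

lemma greedy {p : ℕ} [NeZero p] (A B S : Finset (ZMod p)) (k n : ℕ) (F : ℝ) (hn : 0 < n)
    (hA : A.card ≤ n) (hB : B.card = k) (hk : 0 < k)
    (hF : k * F ≤ n * fl A B S) : ∀ i : ℕ, ∃ A' ⊆ A, A'.card ≤ i ∧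
      (F / (2 * n) ≤ ((A' + B) \ S).card ∨ i * (k * F / (2 * n ^ 2)) ≤ ((A' + B) \ S).card) := by
  intro i
  induction i with
  | zero => exact ⟨∅, by simp, by simp, by simp⟩
  | succ i ih =>
    obtain ⟨A', h1, h2, h3⟩ := ih
    by_cases h4 : F / (2 * n) ≤ ((A' + B) \ S).card
    · exact ⟨A', h1, by omega, Or.inl h4⟩
    have h5 := h3.resolve_left h4
    push Not at h4
    have hn' : (0 : ℝ) < n := by exact_mod_cast hn
    have hk' : (0 : ℝ) < k := by exact_mod_cast hk
    set N := (A' + B) \ S with hN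
    have h6 : fl A B S ≤ fl A B (S ∪ N) + k * N.card := by
      rw [fl_rr, fl_rr, ← Finset.sum_sdiff (s₁ := (S ∪ N)ᶜ) (s₂ := Sᶜ) (by
        intro x; simp; tauto), add_comm]
      gcongr
      calc ∑ x ∈ Sᶜ \ (S ∪ N)ᶜ, rr A B x ≤ (Sᶜ \ (S ∪ N)ᶜ).card • k :=
            Finset.sum_le_card_nsmul _ _ _ fun x _ => by rw [← hB]; exact rr_le' _ _ _
        _ ≤ k * N.card := by
            rw [smul_eq_mul, mul_comm]
            gcongr
            intro x; simp
    have h6' : (fl A B S : ℝ) ≤ fl A B (S ∪ N) + k * N.card := by exact_mod_cast h6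
    have h7 : k * F / (2 * n) ≤ fl A B (S ∪ N) := by
      have e1 : k * F / n ≤ fl A B S := by
        rw [div_le_iff₀ hn']; linarith
      have e2 : (k : ℝ) * N.card ≤ k * (F / (2 * n)) := by gcongr
      have e3 : k * F / (2 * n) + k * (F / (2 * n)) = k * F / n := by field_simp; ring
      linarith
    have hFpos : 0 < F := by
      by_contra hc
      have : F / (2 * n) ≤ 0 := div_nonpos_of_nonpos_of_nonneg (by linarith) (by linarith)
      have : (0 : ℝ) ≤ N.card := by positivity
      linarith
    rw [fl_eq_sum'] at h7
    obtain ⟨a, ha, ha2⟩ : ∃ a ∈ A, k * F / (2 * n ^ 2) ≤ (B.filter (fun b => a + b ∉ S ∪ N)).card := by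
      by_contra hc
      push Not at hc
      have hne : A.Nonempty := by
        rw [Finset.nonempty_iff_ne_empty]; rintro rfl
        simp at h7
        have : 0 < k * F / (2 * n) := by positivity
        linarith
      have := Finset.sum_lt_sum_of_nonempty hne hc
      push_cast at h7
      rw [Finset.sum_const, nsmul_eq_mul] at this
      have q : (A.card : ℝ) * (k * F / (2 * n ^ 2)) ≤ n * (k * F / (2 * n ^ 2)) := by
        gcongr
      have q2 : n * (k * F / (2 * n ^ 2)) = k * F / (2 * n) := by field_simp
      linarith
    refine ⟨insert a A', by
      intro x hx; rcases Finset.mem_insert.1 hx with rfl | hx; exacts [ha, h1 hx], by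
      have := Finset.card_insert_le a A'; omega, Or.inr ?_⟩
    have h8 : N.card + (B.filter (fun b => a + b ∉ S ∪ N)).card ≤ ((insert a A' + B) \ S).card := by
      rw [← Finset.card_image_of_injective (B.filter (fun b => a + b ∉ S ∪ N))
        (add_right_injective a), ← Finset.card_union_of_disjoint]
      · refine Finset.card_le_card fun x hx => ?_
        simp only [hN, mem_union, mem_sdiff, mem_image, mem_filter] at hx ⊢
        rcases hx with hx | ⟨b, hb, rfl⟩
        · exact ⟨Finset.add_subset_add_right (Finset.subset_insert _ _) hx.1, hx.2⟩
        · exact ⟨Finset.add_mem_add (Finset.mem_insert_self _ _) hb.1, fun h => hb.2 (Or.inl h)⟩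
      · rw [Finset.disjoint_left]
        rintro x hx hx'
        simp only [mem_image, mem_filter, mem_union] at hx'
        obtain ⟨b, hb, rfl⟩ := hx'
        exact hb.2 (Or.inr hx)
    have h8' : (N.card : ℝ) + (B.filter (fun b => a + b ∉ S ∪ N)).card ≤ ((insert a A' + B) \ S).card := by
      exact_mod_cast h8
    push_cast
    linarith

lemma batch {p : ℕ} [NeZero p] (A B S : Finset (ZMod p)) (k n : ℕ)
    (hA : A.card = n) (hB : B.card = n) (hk : 0 < k) (hkn : k ≤ n) (hnk : n ≤ k ^ 2) :
    ∃ A' ⊆ A, ∃ B' ⊆ B, A'.card ≤ k ∧ B'.card ≤ k ∧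
      (fl A B S : ℝ) / (2 * n) ≤ ((A' + B') \ S).card := by
  obtain ⟨B', h1, h2, h3⟩ := top_k (fun b => (A.filter (fun a => a + b ∉ S)).card) k (n - k) B
    (by omega)
  rw [← fl_eq_sum, ← fl_eq_sum, hB] at h3
  obtain ⟨A', h4, h5, h6⟩ := greedy A B' S k n (fl A B S) (by omega) hA.le h2 hk
    (by exact_mod_cast h3) k
  refine ⟨A', h4, B', h1, h5, h2.le, ?_⟩
  rcases h6 with h6 | h6
  · exact h6
  refine le_trans ?_ h6
  have hn' : (0 : ℝ) < n := by exact_mod_cast (by omega : 0 < n)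
  have e : (k : ℝ) * (k * fl A B S / (2 * n ^ 2)) = (k ^ 2) * (fl A B S / (2 * n ^ 2)) := by ring
  have e2 : (fl A B S : ℝ) / (2 * n) = n * (fl A B S / (2 * n ^ 2)) := by field_simp
  rw [e, e2]
  gcongr
  exact_mod_cast hnk

lemma batch_iter {p : ℕ} [NeZero p] (A B A0 B0 : Finset (ZMod p)) (k n : ℕ) (F : ℝ)
    (hA : A.card = n) (hB : B.card = n) (hk : 0 < k) (hkn : k ≤ n) (hnk : n ≤ k ^ 2)
    (hA0 : A0 ⊆ A) (hB0 : B0 ⊆ B) : ∀ M : ℕ,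
    ∃ A' ⊆ A, ∃ B' ⊆ B, A0 ⊆ A' ∧ B0 ⊆ B' ∧ A'.card ≤ A0.card + M * k ∧ B'.card ≤ B0.card + M * k ∧
      ((fl A B (A' + B') : ℝ) ≤ F ∨ (A0 + B0).card + M * (F / (2 * n)) ≤ (A' + B').card) := by
  intro M
  induction M with
  | zero => exact ⟨A0, hA0, B0, hB0, Subset.rfl, Subset.rfl, by simp, by simp, Or.inr (by simp)⟩
  | succ M ih =>
    obtain ⟨A1, h1, B1, h2, h3, h4, h5, h6, h7⟩ := ih
    by_cases h8 : (fl A B (A1 + B1) : ℝ) ≤ F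
    · exact ⟨A1, h1, B1, h2, h3, h4, by nlinarith, by nlinarith, Or.inl h8⟩
    have h7 := h7.resolve_left h8
    push Not at h8
    obtain ⟨A2, g1, B2, g2, g3, g4, g5⟩ := batch A B (A1 + B1) k n hA hB hk hkn hnk
    have hn' : (0 : ℝ) < n := by exact_mod_cast (by omega : 0 < n)
    refine ⟨A1 ∪ A2, union_subset h1 g1, B1 ∪ B2, union_subset h2 g2,
      h3.trans subset_union_left, h4.trans subset_union_left, ?_, ?_, Or.inr ?_⟩
    · have := Finset.card_union_le A1 A2; nlinarith
    · have := Finset.card_union_le B1 B2; nlinarith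
    · have e : (A1 + B1).card + ((A2 + B2) \ (A1 + B1)).card ≤ ((A1 ∪ A2) + (B1 ∪ B2)).card := by
        rw [← Finset.card_union_of_disjoint disjoint_sdiff]
        refine Finset.card_le_card (union_subset ?_ (sdiff_subset.trans ?_))
        · exact Finset.add_subset_add subset_union_left subset_union_left
        · exact Finset.add_subset_add subset_union_right subset_union_right
      have e' : ((A1 + B1).card : ℝ) + ((A2 + B2) \ (A1 + B1)).card ≤ ((A1 ∪ A2) + (B1 ∪ B2)).card := by
        exact_mod_cast e
      have : F / (2 * n) ≤ fl A B (A1 + B1) / (2 * n) := by gcongr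
      push_cast
      linarith

lemma cd_iter {p : ℕ} [Fact p.Prime] (A B A0 B0 : Finset (ZMod p)) (n : ℕ)
    (hA : A.card = n) (hB : B.card = n) (hn : 0 < n) (hp : 2 * n ≤ p)
    (hA0 : A0 ⊆ A) (hB0 : B0 ⊆ B) : ∀ M : ℕ,
    ∃ A' ⊆ A, ∃ B' ⊆ B, A'.card ≤ A0.card + M ∧ B'.card ≤ B0.card + M ∧
      (2 * n ≤ (A' + B').card + 1 ∨ (A0 + B0).card + M ≤ (A' + B').card) := by
  intro M
  induction M with
  | zero => exact ⟨A0, hA0, B0, hB0, by simp, by simp, Or.inr (by simp)⟩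
  | succ M ih =>
    obtain ⟨A1, h1, B1, h2, h5, h6, h7⟩ := ih
    by_cases h8 : 2 * n ≤ (A1 + B1).card + 1
    · exact ⟨A1, h1, B1, h2, by omega, by omega, Or.inl h8⟩
    have h7 := h7.resolve_left h8
    push Not at h8
    have hcd := ZMod.cauchy_davenport (Fact.out : p.Prime) (s := A) (t := B)
      (Finset.card_pos.1 (by omega)) (Finset.card_pos.1 (by omega))
    have : ∃ x ∈ A + B, x ∉ A1 + B1 := by
      by_contra hc
      push Not at hc
      have := Finset.card_le_card (show A + B ⊆ A1 + B1 from hc)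
      omega
    obtain ⟨x, hx, hx2⟩ := this
    obtain ⟨a, ha, b, hb, rfl⟩ := Finset.mem_add.1 hx
    refine ⟨insert a A1, ?_, insert b B1, ?_, ?_, ?_, Or.inr ?_⟩
    · intro y hy; rcases Finset.mem_insert.1 hy with rfl | hy; exacts [ha, h1 hy]
    · intro y hy; rcases Finset.mem_insert.1 hy with rfl | hy; exacts [hb, h2 hy]
    · have := Finset.card_insert_le a A1; omega
    · have := Finset.card_insert_le b B1; omega
    · have : insert (a + b) (A1 + B1) ⊆ insert a A1 + insert b B1 := by
        intro y hy
        rcases Finset.mem_insert.1 hy with rfl | hy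
        · exact Finset.add_mem_add (Finset.mem_insert_self _ _) (Finset.mem_insert_self _ _)
        · exact Finset.add_subset_add (Finset.subset_insert _ _) (Finset.subset_insert _ _) hy
      have := Finset.card_le_card this
      rw [Finset.card_insert_of_notMem hx2] at this
      omega


def sh {p : ℕ} (A : Finset (ZMod p)) (x : ZMod p) : Finset (ZMod p) := A.image (· + x)

lemma mem_sh {p : ℕ} {A : Finset (ZMod p)} {x y : ZMod p} : y ∈ sh A x ↔ y - x ∈ A := by
  unfold sh
  simp only [mem_image]
  constructor
  · rintro ⟨a, ha, rfl⟩; simpa using ha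
  · intro h; exact ⟨y - x, h, by ring⟩

lemma card_sh {p : ℕ} (A : Finset (ZMod p)) (x : ZMod p) : (sh A x).card = A.card :=
  Finset.card_image_of_injective _ (add_left_injective _)

lemma fl_sh {p : ℕ} (A B S : Finset (ZMod p)) (x : ZMod p) : fl (sh A x) B (sh S x) = fl A B S := by
  unfold fl
  refine (Finset.card_bij (fun q _ => (q.1 + x, q.2)) ?_ ?_ ?_).symm
  · rintro ⟨a, b⟩ h
    simp only [mem_filter, mem_product, mem_sh] at h ⊢
    refine ⟨⟨by simpa using h.1.1, h.1.2⟩, ?_⟩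
    have : a + x + b - x = a + b := by ring
    rw [this]; exact h.2
  · rintro ⟨a, b⟩ h ⟨a', b'⟩ h' heq
    simpa using heq
  · rintro ⟨a, b⟩ h
    simp only [mem_filter, mem_product, mem_sh] at h
    refine ⟨(a - x, b), ?_, by simp⟩
    simp only [mem_filter, mem_product]
    refine ⟨h.1, ?_⟩
    have : a - x + b = a + b - x := by ring
    rw [this]; exact h.2

lemma fl_inter {p : ℕ} (A A' B S S' : Finset (ZMod p)) :
    fl (A ∩ A') B (S ∩ S') ≤ fl A B S + fl A' B S' := by
  unfold fl
  refine le_trans (Finset.card_le_card ?_) (Finset.card_union_le _ _)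
  rintro ⟨a, b⟩ h
  simp only [mem_filter, mem_product, mem_inter, mem_union] at h ⊢
  tauto

lemma fl_union {p : ℕ} (A A' B S S' : Finset (ZMod p)) :
    fl (A ∪ A') B (S ∪ S') ≤ fl A B S + fl A' B S' := by
  unfold fl
  refine le_trans (Finset.card_le_card ?_) (Finset.card_union_le _ _)
  rintro ⟨a, b⟩ h
  simp only [mem_filter, mem_product, mem_union] at h ⊢
  tauto

def gam {p : ℕ} (A : Finset (ZMod p)) (x : ZMod p) : ℕ := (A ∩ sh A x).card

lemma gam_zero {p : ℕ} (A : Finset (ZMod p)) : gam A 0 = A.card := by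
  unfold gam; congr 1; ext y; simp [mem_sh]

lemma gam_neg {p : ℕ} (A : Finset (ZMod p)) (x : ZMod p) : gam A (-x) = gam A x := by
  unfold gam
  refine Finset.card_bij (fun a _ => a + x) ?_ ?_ ?_
  · intro a h; simp only [mem_inter, mem_sh] at h ⊢; exact ⟨by simpa using h.2, by simpa using h.1⟩
  · intro a _ b _ h; simpa using h
  · intro a h; simp only [mem_inter, mem_sh] at h
    exact ⟨a - x, by simp only [mem_inter, mem_sh]; exact ⟨h.2, by simpa using h.1⟩, by ring⟩

lemma gam_le {p : ℕ} (A : Finset (ZMod p)) (x : ZMod p) : gam A x ≤ A.card :=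
  Finset.card_le_card inter_subset_left

lemma gam_add {p : ℕ} (A : Finset (ZMod p)) (x y : ZMod p) :
    gam A x + gam A y ≤ gam A (x + y) + A.card := by
  have h1 : gam A y = (sh A x ∩ sh A (x + y)).card := by
    unfold gam
    rw [← card_sh _ x]
    congr 1; ext z; simp only [mem_sh, mem_inter]; rw [sub_sub]
  rw [h1]
  have h2 := Finset.card_union_add_card_inter (A ∩ sh A x) (sh A x ∩ sh A (x + y))
  unfold gam
  have h3 : ((A ∩ sh A x) ∪ (sh A x ∩ sh A (x + y))).card ≤ A.card := by
    rw [← card_sh A x]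
    refine Finset.card_le_card ?_
    intro z; simp only [mem_union, mem_inter]; tauto
  have h4 : ((A ∩ sh A x) ∩ (sh A x ∩ sh A (x + y))).card ≤ (A ∩ sh A (x + y)).card := by
    refine Finset.card_le_card ?_
    intro z; simp only [mem_inter]; tauto
  omega

lemma gam_sum {p : ℕ} [NeZero p] (A : Finset (ZMod p)) : ∑ x, gam A x = A.card * A.card := by
  have : ∀ x, gam A x = (A.filter (fun a => a - x ∈ A)).card := by
    intro x; unfold gam; congr 1; ext y; simp [mem_sh]
  simp_rw [this, Finset.card_filter]
  rw [Finset.sum_comm]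
  have : ∀ a ∈ A, (∑ x : ZMod p, if a - x ∈ A then 1 else 0) = A.card := by
    intro a _
    rw [← Finset.card_filter]
    refine Finset.card_bij (fun x _ => a - x) ?_ ?_ ?_
    · intro x hx; simpa using hx
    · intro x _ y _ h; simpa using h
    · intro b hb; exact ⟨a - b, by simpa using hb, by ring⟩
  rw [Finset.sum_congr rfl this]; simp

lemma submod {p : ℕ} [Fact p.Prime] (A B S : Finset (ZMod p)) (n : ℕ) (y : ℝ) (x : ZMod p)
    (hB : B.card = n) (hA : A.card ≤ n) (hp : 3 * n ≤ p) (hy : 1 ≤ y)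
    (hf : (fl A B S : ℝ) ≤ y ^ 2) (hS : (S.card : ℝ) ≤ A.card + n + 6 * y) (hyA : 4 * y ≤ A.card) :
    (fl (A ∩ sh A x) B (S ∩ sh S x) : ℝ) ≤ (3 * y) ^ 2 ∧
    ((S ∩ sh S x).card : ℝ) ≤ (A ∩ sh A x).card + n + 6 * (3 * y) := by
  have f1 : (fl (A ∩ sh A x) B (S ∩ sh S x) : ℝ) ≤ fl A B S + fl A B S := by
    have := fl_inter A (sh A x) B S (sh S x)
    rw [fl_sh] at this; exact_mod_cast this
  have f2 : (fl (A ∪ sh A x) B (S ∪ sh S x) : ℝ) ≤ fl A B S + fl A B S := by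
    have := fl_union A (sh A x) B S (sh S x)
    rw [fl_sh] at this; exact_mod_cast this
  refine ⟨by nlinarith, ?_⟩
  have hAn : (A.card : ℝ) ≤ n := by exact_mod_cast hA
  have g1 : A.card ≤ (A ∪ sh A x).card := Finset.card_le_card subset_union_left
  have g1' : (A.card : ℝ) ≤ (A ∪ sh A x).card := by exact_mod_cast g1
  have g2 := Finset.card_union_add_card_inter A (sh A x)
  have g3 := Finset.card_union_add_card_inter S (sh S x)
  rw [card_sh] at g2 g3
  have := rob_cd (A ∪ sh A x) B (S ∪ sh S x) (2 * y) (by linarith) (by nlinarith) (by linarith)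
    (by rw [hB]; linarith) (by omega)
  rw [hB] at this
  have g2' : ((A ∪ sh A x).card : ℝ) + (A ∩ sh A x).card = A.card + A.card := by exact_mod_cast g2
  have g3' : ((S ∪ sh S x).card : ℝ) + (S ∩ sh S x).card = S.card + S.card := by exact_mod_cast g3
  linarith

lemma energy_le {p : ℕ} [NeZero p] (A B : Finset (ZMod p)) (C : ℝ) (hC : 0 ≤ C)
    (h : ∀ d ≠ 0, (gam A d : ℝ) ≤ C) :
    (Finset.addEnergy A B : ℝ) ≤ B.card * A.card + B.card ^ 2 * C := by
  have h1 : Finset.addEnergy A B ≤ ∑ q ∈ B ×ˢ B, gam A (q.1 - q.2) := by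
    unfold Finset.addEnergy
    rw [Finset.card_eq_sum_card_fiberwise (f := fun q => q.2) (t := B ×ˢ B)]
    · refine Finset.sum_le_sum fun q hq => ?_
      unfold gam
      refine Finset.card_le_card_of_injOn (fun z => z.1.2) ?_ ?_
      · rintro ⟨⟨a, a'⟩, b, b'⟩ hz
        simp only [coe_filter, mem_filter, mem_product, Set.mem_ofPred_eq] at hz
        obtain ⟨⟨⟨⟨h1, h1'⟩, h2, h3⟩, h4⟩, rfl⟩ := hz
        simp only [coe_inter, Set.mem_inter_iff, mem_coe, mem_sh]
        refine ⟨h1', ?_⟩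
        convert h1 using 1; linear_combination - h4
      · rintro ⟨⟨a, a'⟩, b, b'⟩ hz ⟨⟨c, c'⟩, d, d'⟩ hw heq
        simp only [coe_filter, mem_filter, mem_product, Set.mem_ofPred_eq] at hz hw heq
        obtain ⟨⟨_, h4⟩, rfl⟩ := hz
        obtain ⟨⟨_, h5⟩, h6⟩ := hw
        simp only [Prod.mk.injEq] at h6 ⊢
        obtain ⟨rfl, rfl⟩ := h6
        refine ⟨⟨?_, heq⟩, rfl, rfl⟩
        linear_combination h4 - h5 + heq
    · rintro ⟨⟨a, a'⟩, b, b'⟩ hz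
      simp only [coe_filter, mem_product, Set.mem_ofPred_eq] at hz
      simp only [coe_product, Set.mem_prod, mem_coe]; exact hz.1.2
  have h2 : (Finset.addEnergy A B : ℝ) ≤ ∑ q ∈ B ×ˢ B, (gam A (q.1 - q.2) : ℝ) := by exact_mod_cast h1
  refine h2.trans ?_
  calc ∑ q ∈ B ×ˢ B, (gam A (q.1 - q.2) : ℝ)
      ≤ ∑ q ∈ B ×ˢ B, ((if q.1 = q.2 then (A.card : ℝ) else 0) + C) := by
        refine Finset.sum_le_sum fun q _ => ?_
        split_ifs with hq
        · rw [hq, sub_self, gam_zero]; linarith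
        · rw [zero_add]; exact h _ (sub_ne_zero.2 hq)
    _ = _ := by
        rw [Finset.sum_add_distrib, Finset.sum_product]
        simp [Finset.sum_ite_eq]; left; ring

lemma window {p : ℕ} [Fact p.Prime] (A B S : Finset (ZMod p)) (n : ℕ) (y η : ℝ)
    (hη : 0 < η) (hη1 : η ≤ 1) (hn : 24 < η * n)
    (hB : B.card = n) (hA : A.card ≤ n) (hAη : η * n < A.card) (hp : 3 * n ≤ p) (hy : 1 ≤ y)
    (hf : (fl A B S : ℝ) ≤ y ^ 2) (hS : (S.card : ℝ) ≤ A.card + n + 6 * y) (hyA : 6 * y ≤ A.card) :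
    ∃ x, η / 24 * A.card ≤ gam A x ∧ gam A x ≤ (1 - η / 24) * A.card := by
  by_contra hcon
  push Not at hcon
  have hAn : (A.card : ℝ) ≤ n := by exact_mod_cast hA
  have hpn : (3 : ℝ) * n ≤ p := by exact_mod_cast hp
  have hn0 : (0 : ℝ) < n := by nlinarith
  have hm0 : (0 : ℝ) < A.card := by nlinarith
  set m : ℝ := (A.card : ℝ) with hm
  set c : ℝ := η / 24 with hc
  have hc1 : c ≤ 1 / 24 := by linarith
  have hc0 : 0 < c := by positivity
  have hadd : ∀ d e : ZMod p, (1 - c) * m < gam A d → (1 - c) * m < gam A e →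
      (1 - c) * m < gam A (d + e) := by
    intro d e hd he
    apply hcon
    have : (gam A d : ℝ) + gam A e ≤ gam A (d + e) + m := by rw [hm]; exact_mod_cast gam_add A d e
    nlinarith
  by_cases hz : ∃ d ≠ 0, (1 - c) * m < gam A d
  · obtain ⟨d, hd0, hd⟩ := hz
    have hall : ∀ k : ℕ, (1 - c) * m < gam A (k * d) := by
      intro k
      induction k with
      | zero =>
        rw [Nat.cast_zero, zero_mul, gam_zero]; nlinarith
      | succ k ih =>
        have : ((k + 1 : ℕ) : ZMod p) * d = k * d + d := by push_cast; ring
        rw [this]; exact hadd _ _ ih hd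
    have hall' : ∀ x : ZMod p, (1 - c) * m ≤ gam A x := by
      intro x
      have := hall (x / d).val
      rw [ZMod.natCast_zmod_val, div_mul_cancel₀ _ hd0] at this
      exact this.le
    have h1 : ∑ x : ZMod p, (gam A x : ℝ) = m * m := by rw [hm]; exact_mod_cast gam_sum A
    have h2 : (p : ℝ) * ((1 - c) * m) ≤ ∑ x : ZMod p, (gam A x : ℝ) := by
      have := Finset.card_nsmul_le_sum (Finset.univ : Finset (ZMod p)) (fun x => (gam A x : ℝ))
        ((1 - c) * m) (fun x _ => hall' x)
      rw [Finset.card_univ, ZMod.card, nsmul_eq_mul] at this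
      exact this
    rw [h1] at h2
    have : (p : ℝ) * (1 - c) ≤ m := by nlinarith
    nlinarith
  · push Not at hz
    have h1 : ∀ d ≠ 0, (gam A d : ℝ) ≤ c * m := by
      intro d hd
      by_contra hlt
      push Not at hlt
      exact absurd (hcon d hlt.le) (not_lt.2 (hz d hd))
    have h2 := energy_le A B (c * m) (by positivity) h1
    have h3 := Finset.card_sq_le_card_mul_addEnergy A B S
    have h4 : (((A ×ˢ B).filter (fun q => q.1 + q.2 ∈ S)).card : ℝ) + fl A B S = m * n := by
      have := Finset.card_filter_add_card_filter_not (s := A ×ˢ B) (fun q => q.1 + q.2 ∈ S)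
      rw [Finset.card_product, hB] at this
      rw [hm]; unfold fl; exact_mod_cast this
    have h3' : (((A ×ˢ B).filter (fun q => q.1 + q.2 ∈ S)).card : ℝ) ^ 2 ≤ S.card * Finset.addEnergy A B := by
      exact_mod_cast h3
    set g : ℝ := (((A ×ˢ B).filter (fun q => q.1 + q.2 ∈ S)).card : ℝ)
    rw [hB] at h2
    have h5 : m * n / 2 ≤ g := by nlinarith
    have h6 : (S.card : ℝ) ≤ 3 * n := by linarith
    have hE : (0 : ℝ) ≤ Finset.addEnergy A B := by positivity
    have h7 : (m * n / 2) ^ 2 ≤ 3 * n * (n * m + n ^ 2 * (c * m)) := by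
      calc (m * n / 2) ^ 2 ≤ g ^ 2 := by gcongr
        _ ≤ (S.card : ℝ) * (Finset.addEnergy A B : ℝ) := h3'
        _ ≤ 3 * n * (Finset.addEnergy A B : ℝ) := by gcongr
        _ ≤ _ := by gcongr
    have h8 : (m * n ^ 2) * (m / 12) ≤ (m * n ^ 2) * (1 + n * c) := by nlinarith
    have h9 := le_of_mul_le_mul_left h8 (by positivity)
    have : n * c = η * n / 24 := by rw [hc]; ring
    linarith

theorem window_iter {p : ℕ} [Fact p.Prime] (A B S : Finset (ZMod p)) (n : ℕ) (y η : ℝ)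
    (hη : 0 < η) (hη1 : η ≤ 1) (hn : 24 < η * n) (hA : A.card = n)
    (hB : B.card = n) (hp : 3 * n ≤ p) (hy : 1 ≤ y)
    (hf : (fl A B S : ℝ) ≤ y ^ 2) (hS : S.card ≤ 2 * n) : ∀ j : ℕ,
    6 * (3 ^ j * y) ≤ η / 24 * (η * n) → ∃ A' S' : Finset (ZMod p),
      (fl A' B S' : ℝ) ≤ (3 ^ j * y) ^ 2 ∧ (S'.card : ℝ) ≤ A'.card + n + 6 * (3 ^ j * y) ∧
      A'.card ≤ n ∧ η / 24 * (η * n) ≤ A'.card ∧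
      ((A'.card : ℝ) ≤ η * n ∨ (A'.card : ℝ) ≤ (1 - η / 24) ^ j * n) := by
  intro j
  have hn0 : (0 : ℝ) < n := by nlinarith
  induction j with
  | zero =>
    intro _
    refine ⟨A, S, by simpa using hf, ?_, hA.le, ?_, Or.inr (by simp [hA])⟩
    · have : (S.card : ℝ) ≤ 2 * n := by exact_mod_cast hS
      rw [hA]; simp; linarith
    · rw [hA]; nlinarith [mul_le_mul hη1 hη1 hη.le zero_le_one]
  | succ j ih =>
    intro hj
    have hy3 : (3 : ℝ) ^ (j + 1) * y = 3 * (3 ^ j * y) := by ring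
    rw [hy3] at hj ⊢
    have hyy : 1 ≤ (3 : ℝ) ^ j * y := by
      have : (1 : ℝ) ≤ 3 ^ j := one_le_pow₀ (by norm_num)
      nlinarith
    set z : ℝ := 3 ^ j * y
    obtain ⟨A1, S1, h1, h2, h3, h4, h5⟩ := ih (by linarith)
    by_cases h6 : (A1.card : ℝ) ≤ η * n
    · exact ⟨A1, S1, by nlinarith, by linarith, h3, h4, Or.inl h6⟩
    push Not at h6
    have h5 := h5.resolve_left (not_le.2 h6)
    have h7 : 6 * z ≤ A1.card := by linarith
    obtain ⟨x, hx1, hx2⟩ := window A1 B S1 n z η hη hη1 hn hB h3 h6 hp hyy h1 h2 h7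
    obtain ⟨g1, g2⟩ := submod A1 B S1 n z x hB h3 hp hyy h1 h2 (by linarith)
    unfold gam at hx1 hx2
    refine ⟨_, _, g1, g2, (Finset.card_le_card inter_subset_left).trans h3, ?_, Or.inr ?_⟩
    · refine le_trans ?_ hx1
      gcongr
    · refine hx2.trans ?_
      rw [pow_succ, mul_comm _ (1 - η / 24), mul_assoc]
      have : 0 ≤ 1 - η / 24 := by linarith
      gcongr

theorem window_final (η δ : ℝ) (hη : 0 < η) (hη1 : η ≤ 1) (hδ : 0 < δ) :
    ∃ ε : ℝ, 0 < ε ∧ ε ≤ δ ∧ ∀ (p : ℕ) [Fact p.Prime] (A B S : Finset (ZMod p)) (n : ℕ),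
      A.card = n → B.card = n → 3 * n ≤ p → 1 ≤ ε * n → 24 < η * n →
      (fl A B S : ℝ) ≤ (ε * n) ^ 2 → S.card ≤ 2 * n →
      ∃ A' S' : Finset (ZMod p), (fl A' B S' : ℝ) ≤ (δ * n) ^ 2 ∧
        (S'.card : ℝ) ≤ A'.card + n + 6 * (δ * n) ∧ η / 24 * (η * n) ≤ A'.card ∧
        (A'.card : ℝ) ≤ η * n := by
  obtain ⟨J, hJ⟩ := exists_pow_lt_of_lt_one hη (show 1 - η / 24 < 1 by linarith)
  set δ' := min δ (η * η / 144) with hδ'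
  have hd0 : 0 < δ' := lt_min hδ (by positivity)
  have hd1 : δ' ≤ δ := min_le_left _ _
  have hd2 : δ' ≤ η * η / 144 := min_le_right _ _
  have h3 : (1 : ℝ) ≤ 3 ^ J := one_le_pow₀ (by norm_num)
  refine ⟨δ' / 3 ^ J, by positivity, (div_le_self hd0.le h3).trans hd1, ?_⟩
  intro p _ A B S n hA hB hp h1 h2 hf hS
  have e : (3 : ℝ) ^ J * (δ' / 3 ^ J * n) = δ' * n := by field_simp
  have hn0 : (0 : ℝ) ≤ n := by positivity
  obtain ⟨A', S', g1, g2, g3, g4, g5⟩ := window_iter A B S n _ η hη hη1 h2 hA hB hp h1 hf hS J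
    (by rw [e]; nlinarith)
  rw [e] at g1 g2
  have hle : δ' * n ≤ δ * n := by gcongr
  refine ⟨A', S', g1.trans (by gcongr), by linarith, g4, ?_⟩
  rcases g5 with g5 | g5
  · exact g5
  · refine g5.trans ?_
    gcongr


/-- norm -/
def nn {p : ℕ} (B : Finset (ZMod p)) (d : ZMod p) : ℕ := B.card - gam B d

lemma nn_add_gam {p : ℕ} (B : Finset (ZMod p)) (d : ZMod p) : nn B d + gam B d = B.card := by
  unfold nn; have := gam_le B d; omega

lemma nn_zero {p : ℕ} (B : Finset (ZMod p)) : nn B 0 = 0 := by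
  unfold nn; rw [gam_zero]; omega

lemma nn_neg {p : ℕ} (B : Finset (ZMod p)) (d : ZMod p) : nn B (-d) = nn B d := by
  unfold nn; rw [gam_neg]

lemma nn_add {p : ℕ} (B : Finset (ZMod p)) (d e : ZMod p) : nn B (d + e) ≤ nn B d + nn B e := by
  have := nn_add_gam B d
  have := nn_add_gam B e
  have := nn_add_gam B (d + e)
  have := gam_add B d e
  omega

lemma nn_nsmul {p : ℕ} (B : Finset (ZMod p)) (d : ZMod p) (i : ℕ) : nn B (i * d) ≤ i * nn B d := by
  induction i with
  | zero => simp [nn_zero]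
  | succ i ih =>
    have : ((i + 1 : ℕ) : ZMod p) * d = i * d + d := by push_cast; ring
    rw [this]
    refine (nn_add _ _ _).trans ?_
    rw [add_mul, one_mul]; omega

noncomputable def TT {p : ℕ} [NeZero p] (B : Finset (ZMod p)) (ρ : ℝ) : Finset (ZMod p) :=
  Finset.univ.filter (fun d => (nn B d : ℝ) ≤ ρ)

lemma mem_TT {p : ℕ} [NeZero p] {B : Finset (ZMod p)} {ρ : ℝ} {d : ZMod p} :
    d ∈ TT B ρ ↔ (nn B d : ℝ) ≤ ρ := by simp [TT]

lemma TT_add {p : ℕ} [NeZero p] (B : Finset (ZMod p)) (ρ ρ' : ℝ) :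
    TT B ρ + TT B ρ' ⊆ TT B (ρ + ρ') := by
  intro x hx
  obtain ⟨a, ha, b, hb, rfl⟩ := Finset.mem_add.1 hx
  rw [mem_TT] at *
  have : (nn B (a + b) : ℝ) ≤ nn B a + nn B b := by exact_mod_cast nn_add B a b
  linarith

/-- many small differences -/
lemma TT_lower {p : ℕ} [Fact p.Prime] (A B S : Finset (ZMod p)) (n : ℕ) (y : ℝ) (hy : 1 ≤ y)
    (hB : B.card = n) (hA : 2 * A.card ≤ p) (hf : (fl A B S : ℝ) ≤ y ^ 2)
    (hS : (S.card : ℝ) ≤ A.card + n + 6 * y) (hyA : 2 * y ≤ A.card) :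
    2 * (A.card : ℝ) - 3 * y ≤ (TT B (A.card + 8 * y)).card := by
  classical
  set G := A.filter (fun a => ((B.filter (fun b => a + b ∉ S)).card : ℝ) ≤ y) with hG
  have h1 : ((A \ G).card : ℝ) ≤ y := by
    have h2 : ((A \ G).card : ℝ) * y ≤ y ^ 2 := by
      refine le_trans ?_ hf
      rw [fl_eq_sum']
      push_cast
      refine le_trans ?_ (Finset.sum_le_sum_of_subset_of_nonneg (sdiff_subset : A \ G ⊆ A)
        (fun _ _ _ => by positivity))
      rw [← nsmul_eq_mul]
      refine Finset.card_nsmul_le_sum _ _ _ fun a ha => ?_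
      simp only [hG, mem_sdiff, mem_filter, not_and, not_le] at ha
      exact (ha.2 ha.1).le
    nlinarith
  have h2 : (G.card : ℝ) + (A \ G).card = A.card := by
    have := Finset.card_sdiff_add_card_eq_card (Finset.filter_subset _ A : G ⊆ A)
    rw [add_comm]; exact_mod_cast this
  have hGA : G.card ≤ A.card := Finset.card_le_card (Finset.filter_subset _ _)
  have hGne : G.Nonempty := by
    rw [← Finset.card_pos]
    have : (0 : ℝ) < G.card := by linarith
    exact_mod_cast this
  have h3 : G - G ⊆ TT B (A.card + 8 * y) := by
    intro x hx
    obtain ⟨a, ha, a', ha', rfl⟩ := Finset.mem_sub.1 hx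
    rw [mem_TT]
    simp only [hG, mem_filter] at ha ha'
    have key : ∀ c : ZMod p, ((B.filter (fun b => c + b ∉ S)).card : ℝ) ≤ y →
        (n : ℝ) - y ≤ (S ∩ sh B c).card := by
      intro c hc
      have e := Finset.card_filter_add_card_filter_not (s := B) (fun b => c + b ∈ S)
      rw [hB] at e
      have e' : ((B.filter (fun b => c + b ∈ S)).card : ℝ) + (B.filter (fun b => c + b ∉ S)).card = n := by
        exact_mod_cast e
      have e2 : (B.filter (fun b => c + b ∈ S)).card ≤ (S ∩ sh B c).card := by
        refine Finset.card_le_card_of_injOn (fun b => c + b) ?_ ?_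
        · intro b hb
          simp only [coe_filter, Set.mem_ofPred_eq] at hb
          simp only [coe_inter, Set.mem_inter_iff, mem_coe, mem_sh]
          exact ⟨hb.2, by simpa using hb.1⟩
        · intro b _ b' _ h; simpa using h
      have e2' : ((B.filter (fun b => c + b ∈ S)).card : ℝ) ≤ (S ∩ sh B c).card := by exact_mod_cast e2
      linarith
    have k1 := key a ha.2
    have k2 := key a' ha'.2
    have k3 := Finset.card_union_add_card_inter (S ∩ sh B a) (S ∩ sh B a')
    have k4 : ((S ∩ sh B a) ∪ (S ∩ sh B a')).card ≤ S.card :=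
      Finset.card_le_card (by intro z; simp only [mem_union, mem_inter]; tauto)
    have k5 : ((S ∩ sh B a) ∩ (S ∩ sh B a')).card ≤ gam B (a - a') := by
      unfold gam
      refine Finset.card_le_card_of_injOn (fun b => b - a') ?_ ?_
      · intro b hb
        simp only [coe_inter, Set.mem_inter_iff, mem_coe, mem_sh] at hb ⊢
        refine ⟨hb.2.2, ?_⟩
        have : b - a' - (a - a') = b - a := by ring
        rw [this]; exact hb.1.2
      · intro b _ b' _ h; simpa using h
    have k6 := nn_add_gam B (a - a')
    rw [hB] at k6
    have k3' : ((((S ∩ sh B a) ∪ (S ∩ sh B a')).card : ℕ) : ℝ) + ((S ∩ sh B a) ∩ (S ∩ sh B a')).card =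
      (S ∩ sh B a).card + (S ∩ sh B a').card := by exact_mod_cast k3
    have k4' : ((((S ∩ sh B a) ∪ (S ∩ sh B a')).card : ℕ) : ℝ) ≤ S.card := by exact_mod_cast k4
    have k5' : ((((S ∩ sh B a) ∩ (S ∩ sh B a')).card : ℕ) : ℝ) ≤ gam B (a - a') := by exact_mod_cast k5
    have k6' : (nn B (a - a') : ℝ) + gam B (a - a') = n := by exact_mod_cast k6
    linarith
  have h4 := ZMod.cauchy_davenport (Fact.out : p.Prime) hGne hGne.neg
  rw [← sub_eq_add_neg, Finset.card_neg] at h4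
  have h5 := Finset.card_le_card h3
  have h6 : 2 * G.card ≤ (TT B (A.card + 8 * y)).card + 1 := by omega
  have h6' : 2 * (G.card : ℝ) ≤ (TT B (A.card + 8 * y)).card + 1 := by exact_mod_cast h6
  linarith

lemma TT_mul {p : ℕ} [Fact p.Prime] (B : Finset (ZMod p)) (ρ : ℝ) (hρ : 0 ≤ ρ) (Y : ℕ)
    (hY : Y + 1 ≤ (TT B ρ).card) : ∀ j : ℕ, j * Y ≤ p → j * Y ≤ (TT B (j * ρ)).card := by
  have hne : ∀ ρ' : ℝ, 0 ≤ ρ' → (TT B ρ').Nonempty := fun ρ' h => ⟨0, by rw [mem_TT, nn_zero]; simpa⟩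
  have key : ∀ j : ℕ, min p (j * Y + 1) ≤ (TT B (j * ρ)).card := by
    intro j
    induction j with
    | zero =>
      have := Finset.card_pos.2 (hne 0 le_rfl)
      simp only [Nat.cast_zero, zero_mul]; omega
    | succ j ih =>
      have h1 := ZMod.cauchy_davenport (Fact.out : p.Prime) (hne (j * ρ) (by positivity)) (hne ρ hρ)
      have h2 := Finset.card_le_card (TT_add B (j * ρ) ρ)
      have e : (j : ℝ) * ρ + ρ = ((j + 1 : ℕ) : ℝ) * ρ := by push_cast; ring
      rw [e] at h2
      have : (j + 1) * Y = j * Y + Y := by ring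
      rw [this]
      omega
  intro j hj
  have := key j
  omega

/-- upper bound on the number of small-norm elements -/
lemma TT_upper {p : ℕ} [Fact p.Prime] (B : Finset (ZMod p)) (n : ℕ) (hB : B.card = n)
    (hp : 3 * n ≤ p) (r : ℝ) (hr : 2 ≤ r) (hrn : 50 * r ≤ n) :
    ((TT B (2 * r)).card : ℝ) ≤ 4 * r * (1 + 14 * (r / n)) + 2 := by
  by_contra hcon
  push Not at hcon
  have hn0 : (0 : ℝ) < n := by linarith
  set x : ℝ := r / n with hx
  have hx0 : 0 < x := by positivity
  have hx1 : x ≤ 1 / 50 := by rw [hx, div_le_iff₀ hn0]; linarith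
  have hrx : r = x * n := by rw [hx]; field_simp
  set Y : ℕ := ⌈4 * r * (1 + 14 * x)⌉₊ with hYd
  have hY0 : 0 ≤ 4 * r * (1 + 14 * x) := by positivity
  have hY1 : 4 * r * (1 + 14 * x) ≤ Y := Nat.le_ceil _
  have hY2 : (Y : ℝ) < 4 * r * (1 + 14 * x) + 1 := Nat.ceil_lt_add_one hY0
  have hY3 : Y + 1 ≤ (TT B (2 * r)).card := by
    have : ((Y + 1 : ℕ) : ℝ) < (TT B (2 * r)).card := by push_cast; linarith
    exact_mod_cast this.le
  obtain ⟨J, hJ⟩ : ∃ J : ℕ, ⌊(n : ℝ) / (2 * r)⌋₊ = J + 1 := by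
    have : 0 < ⌊(n : ℝ) / (2 * r)⌋₊ := by
      apply Nat.floor_pos.2; rw [le_div_iff₀ (by linarith)]; linarith
    exact ⟨_, (Nat.succ_pred_eq_of_pos this).symm⟩
  have hJ1 : ((J + 1 : ℕ) : ℝ) ≤ n / (2 * r) := by rw [← hJ]; exact Nat.floor_le (by positivity)
  have hJ2 : (n : ℝ) / (2 * r) < ((J + 1 : ℕ) : ℝ) + 1 := by rw [← hJ]; exact Nat.lt_floor_add_one _
  push_cast at hJ1 hJ2
  have hJ3 : (J + 1) * (2 * r) ≤ n := by rwa [le_div_iff₀ (by linarith)] at hJ1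
  have hJ4 : n < (J + 2) * (2 * r) := by
    rw [div_lt_iff₀ (by linarith)] at hJ2; linarith
  have hJY : J * Y ≤ p := by
    have h1 : (J : ℝ) * Y ≤ 3 * n := by
      have : (J : ℝ) * Y ≤ J * (6 * r) := by
        gcongr
        have : 4 * r * (1 + 14 * x) ≤ 4 * r * (1 + 14 * (1 / 50)) := by gcongr
        have : 4 * r * (1 + 14 * (1 / 50)) = 5.12 * r := by ring
        nlinarith
      nlinarith
    have : (J : ℝ) * Y ≤ p := h1.trans (by exact_mod_cast hp)
    exact_mod_cast this
  have h1 : ∀ j ∈ Finset.range J, ((j + 1 : ℕ) : ℝ) * Y ≤ (TT B (((j + 1 : ℕ) : ℝ) * (2 * r))).card := by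
    intro j hj
    have hj' : j + 1 ≤ J := Finset.mem_range.1 hj
    have := TT_mul B (2 * r) (by linarith) Y hY3 (j + 1) ((Nat.mul_le_mul_right _ hj').trans hJY)
    exact_mod_cast this
  have h2 : ∀ d : ZMod p, ∑ j ∈ Finset.range J, (if d ∈ TT B (((j + 1 : ℕ) : ℝ) * (2 * r)) then 2 * r else 0)
      ≤ gam B d := by
    intro d
    have hg : (nn B d : ℝ) + gam B d = n := by rw [← hB]; exact_mod_cast nn_add_gam B d
    simp_rw [mem_TT]
    have : ∀ K : ℕ, ∑ j ∈ Finset.range K, (if (nn B d : ℝ) ≤ ((j + 1 : ℕ) : ℝ) * (2 * r) then 2 * r else 0)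
        ≤ max 0 ((K + 1) * (2 * r) - nn B d) := by
      intro K
      induction K with
      | zero => simp
      | succ K ih =>
        rw [Finset.sum_range_succ]
        push_cast at ih ⊢
        split_ifs with hc
        · refine le_trans (add_le_add_left ih _) (le_trans ?_ (le_max_right _ _))
          rw [max_eq_right (by linarith)]
          linarith
        · rw [add_zero]
          refine ih.trans (max_le_max le_rfl ?_)
          linarith
    refine (this J).trans (max_le (by positivity) ?_)
    linarith
  have h3 : ∑ d : ZMod p, (gam B d : ℝ) = n * n := by rw [← hB]; exact_mod_cast gam_sum B
  have h4 : ∑ d : ZMod p, ∑ j ∈ Finset.range J, (if d ∈ TT B (((j + 1 : ℕ) : ℝ) * (2 * r)) then 2 * r else 0)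
      ≤ n * n := by
    rw [← h3]; exact Finset.sum_le_sum fun d _ => h2 d
  rw [Finset.sum_comm] at h4
  have h5 : ∑ j ∈ Finset.range J, ((j + 1 : ℕ) : ℝ) * Y * (2 * r) ≤ n * n := by
    refine le_trans (Finset.sum_le_sum fun j hj => ?_) h4
    rw [Finset.sum_ite_mem, Finset.univ_inter, Finset.sum_const, nsmul_eq_mul]
    have := h1 j hj
    gcongr
  have h6 : ∑ j ∈ Finset.range J, ((j + 1 : ℕ) : ℝ) * Y * (2 * r) = J * (J + 1) * (Y * r) := by
    clear * -
    induction J with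
    | zero => simp
    | succ J ih => rw [Finset.sum_range_succ, ih]; push_cast; ring
  rw [h6] at h5
  have h7 : n * (1 - 4 * x) ≤ J * (2 * r) := by rw [hrx] at hJ4 ⊢; linarith
  have h8 : n * (1 - 2 * x) ≤ (J + 1) * (2 * r) := by rw [hrx] at hJ4 ⊢; linarith
  have h9 : (n * (1 - 4 * x)) * (n * (1 - 2 * x)) * (1 + 14 * x) ≤ n * n := by
    calc _ ≤ (J * (2 * r)) * ((J + 1) * (2 * r)) * (1 + 14 * x) := by
            have : 0 ≤ n * (1 - 2 * x) := mul_nonneg hn0.le (by linarith)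
            gcongr
      _ = J * (J + 1) * ((4 * r * (1 + 14 * x)) * r) := by ring
      _ ≤ J * (J + 1) * (Y * r) := by gcongr
      _ ≤ _ := h5
  have h10 : (n * n : ℝ) * ((1 - 4 * x) * (1 - 2 * x) * (1 + 14 * x)) ≤ (n * n) * 1 := by linarith
  have h11 := le_of_mul_le_mul_left h10 (by positivity)
  nlinarith [mul_pos hx0 hx0, mul_pos (mul_pos hx0 hx0) hx0]


lemma four_id {p : ℕ} [NeZero p] (B : Finset (ZMod p)) (d : ZMod p) :
    ∑ ξ : ZMod p, Complex.normSq (∑ b ∈ B, ZMod.stdAddChar (ξ * b)) * (ZMod.stdAddChar (ξ * d)).re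
      = p * gam B d := by
  have h1 : ∀ ξ : ZMod p, ((Complex.normSq (∑ b ∈ B, ZMod.stdAddChar (ξ * b)) : ℝ) : ℂ) * ZMod.stdAddChar (ξ * d)
      = ∑ b ∈ B, ∑ b' ∈ B, ZMod.stdAddChar (ξ * (b - b' + d)) := by
    intro ξ
    rw [Complex.normSq_eq_conj_mul_self, mul_comm ((starRingEnd ℂ) _), map_sum, Finset.sum_mul_sum,
      Finset.sum_mul]
    refine Finset.sum_congr rfl fun b _ => ?_
    rw [Finset.sum_mul]
    refine Finset.sum_congr rfl fun b' _ => ?_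
    rw [← AddChar.map_neg_eq_conj, ← AddChar.map_add_eq_mul, ← AddChar.map_add_eq_mul]
    congr 1; ring
  have h2 : ∑ ξ : ZMod p, ((Complex.normSq (∑ b ∈ B, ZMod.stdAddChar (ξ * b)) : ℝ) : ℂ) * ZMod.stdAddChar (ξ * d)
      = p * gam B d := by
    simp_rw [h1]
    rw [Finset.sum_comm]
    have h3 : ∀ b ∈ B, ∑ ξ : ZMod p, ∑ b' ∈ B, (ZMod.stdAddChar (ξ * (b - b' + d)) : ℂ)
        = if b + d ∈ B then (p : ℂ) else 0 := by
      intro b _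
      rw [Finset.sum_comm]
      simp_rw [AddChar.sum_mulShift _ (ZMod.isPrimitive_stdAddChar p), ZMod.card]
      have : ∀ b', (b - b' + d = 0) ↔ b + d = b' := by
        intro b'; constructor
        · intro h; linear_combination h
        · intro h; linear_combination h
      simp_rw [this]
      push_cast
      rw [Finset.sum_ite_eq]
    rw [Finset.sum_congr rfl h3, ← Finset.sum_filter, Finset.sum_const, nsmul_eq_mul, mul_comm]
    congr 2
    rw [← gam_neg]
    unfold gam
    congr 1; ext b; simp [mem_sh]
  have h3 := congrArg Complex.re h2
  rw [Complex.re_sum] at h3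
  simp only [Complex.re_ofReal_mul] at h3
  rw [h3]
  norm_cast

lemma four_exists {p : ℕ} [Fact p.Prime] (B T : Finset (ZMod p)) (n : ℕ) (hB : B.card = n) (hn : 0 < n)
    (hp : 3 * n ≤ p) (r : ℝ) (hT : ∀ d ∈ T, (nn B d : ℝ) ≤ r) :
    ∃ ξ : ZMod p, ξ ≠ 0 ∧ ∑ d ∈ T, (1 - (ZMod.stdAddChar (ξ * d)).re) ≤ 3 / 2 * (r / n) * T.card := by
  by_contra hcon
  push Not at hcon
  set w : ZMod p → ℝ := fun ξ => Complex.normSq (∑ b ∈ B, ZMod.stdAddChar (ξ * b)) with hw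
  have hw0 : ∀ ξ, 0 ≤ w ξ := fun ξ => Complex.normSq_nonneg _
  have hn' : (0 : ℝ) < n := by exact_mod_cast hn
  have hp' : (3 : ℝ) * n ≤ p := by exact_mod_cast hp
  have s0 : ∑ ξ : ZMod p, w ξ = p * n := by
    have := four_id B 0
    rw [gam_zero, hB] at this
    simpa using this
  have s1 : ∀ d, ∑ ξ : ZMod p, w ξ * (1 - (ZMod.stdAddChar (ξ * d)).re) = p * nn B d := by
    intro d
    have h := four_id B d
    have hg : (nn B d : ℝ) + gam B d = n := by rw [← hB]; exact_mod_cast nn_add_gam B d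
    simp_rw [mul_sub, mul_one]
    rw [Finset.sum_sub_distrib, s0]
    simp only [hw]
    rw [h, ← hg]; ring
  have s2 : ∑ ξ : ZMod p, w ξ * ∑ d ∈ T, (1 - (ZMod.stdAddChar (ξ * d)).re) ≤ p * r * T.card := by
    simp_rw [Finset.mul_sum]
    rw [Finset.sum_comm]
    simp_rw [s1]
    calc ∑ d ∈ T, (p : ℝ) * nn B d ≤ ∑ d ∈ T, (p : ℝ) * r := by
          refine Finset.sum_le_sum fun d hd => ?_
          have := hT d hd
          gcongr
      _ = _ := by rw [Finset.sum_const, nsmul_eq_mul]; ring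
  have w0 : w 0 = n ^ 2 := by simp [hw, hB, sq]
  have s3 : ∑ ξ ∈ Finset.univ.erase (0 : ZMod p), w ξ = p * n - n ^ 2 := by
    rw [← s0, ← w0, ← Finset.add_sum_erase _ _ (Finset.mem_univ (0 : ZMod p))]; ring
  have s4 : ∑ ξ ∈ Finset.univ.erase (0 : ZMod p), w ξ * ∑ d ∈ T, (1 - (ZMod.stdAddChar (ξ * d)).re)
      = ∑ ξ : ZMod p, w ξ * ∑ d ∈ T, (1 - (ZMod.stdAddChar (ξ * d)).re) := by
    rw [← Finset.add_sum_erase _ _ (Finset.mem_univ (0 : ZMod p))]; simp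
  have hpos : 0 < (p : ℝ) * n - n ^ 2 := by nlinarith
  have s5 : ∑ ξ ∈ Finset.univ.erase (0 : ZMod p), w ξ * (3 / 2 * (r / n) * T.card) <
      ∑ ξ ∈ Finset.univ.erase (0 : ZMod p), w ξ * ∑ d ∈ T, (1 - (ZMod.stdAddChar (ξ * d)).re) := by
    obtain ⟨ξ, hξ, hξ2⟩ : ∃ ξ ∈ Finset.univ.erase (0 : ZMod p), 0 < w ξ := by
      by_contra hc
      push Not at hc
      have := Finset.sum_nonpos hc
      linarith
    refine Finset.sum_lt_sum (fun ζ hζ => ?_) ⟨ξ, hξ, ?_⟩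
    · exact mul_le_mul_of_nonneg_left (hcon ζ (Finset.ne_of_mem_erase hζ)).le (hw0 _)
    · exact mul_lt_mul_of_pos_left (hcon ξ (Finset.ne_of_mem_erase hξ)) hξ2
  rw [← Finset.sum_mul, s3, s4] at s5
  have hr0 : 0 ≤ r * T.card := by
    rcases T.eq_empty_or_nonempty with rfl | ⟨d, hd⟩
    · simp
    · have := hT d hd
      have h0 : (0 : ℝ) ≤ nn B d := by positivity
      have : 0 ≤ r := by linarith
      positivity
  have s6 : (p * n - n ^ 2 : ℝ) * (3 / 2 * (r / n) * T.card) = (p - n) * (3 / 2) * (r * T.card) := by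
    field_simp
  rw [s6] at s5
  nlinarith

lemma re_large {p : ℕ} [NeZero p] (x : ZMod p) (hx : (p : ℤ) ≤ 8 * |x.valMinAbs|) :
    1 / 4 ≤ 1 - (ZMod.stdAddChar x : ℂ).re := by
  have hp : (0 : ℝ) < p := by exact_mod_cast NeZero.pos p
  have h1 : (ZMod.stdAddChar x : ℂ).re = Real.cos (|2 * Real.pi * x.valMinAbs / p|) := by
    rw [Real.cos_abs]
    conv_lhs => rw [← ZMod.coe_valMinAbs x, ZMod.stdAddChar_coe]
    have : (2 * Real.pi * Complex.I * (x.valMinAbs : ℂ) / p : ℂ) =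
      ((2 * Real.pi * x.valMinAbs / p : ℝ) : ℂ) * Complex.I := by push_cast; ring
    rw [this, Complex.exp_ofReal_mul_I_re]
  have h2 : |2 * Real.pi * x.valMinAbs / p| = 2 * Real.pi * |(x.valMinAbs : ℝ)| / p := by
    rw [abs_div, abs_mul, abs_of_pos Real.two_pi_pos, abs_of_pos hp]
  have hx' : (p : ℝ) ≤ 8 * |(x.valMinAbs : ℝ)| := by exact_mod_cast hx
  have hm := ZMod.valMinAbs_mem_Ioc x
  have hm' : 2 * |(x.valMinAbs : ℝ)| ≤ p := by
    have : 2 * |x.valMinAbs| ≤ (p : ℤ) := by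
      have := hm.1; have := hm.2
      rcases abs_cases x.valMinAbs with h | h <;> omega
    exact_mod_cast this
  rw [h1, h2]
  have h3 : Real.cos (2 * Real.pi * |(x.valMinAbs : ℝ)| / p) ≤ Real.cos (Real.pi / 4) := by
    apply Real.cos_le_cos_of_nonneg_of_le_pi
    · positivity
    · rw [div_le_iff₀ hp]; nlinarith [Real.pi_pos]
    · rw [div_le_div_iff₀ (by norm_num) hp]; nlinarith [Real.pi_pos]
  rw [Real.cos_pi_div_four] at h3
  have : Real.sqrt 2 ≤ 3 / 2 := by
    rw [Real.sqrt_le_left (by norm_num)]; norm_num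
  linarith

/-- the integer model -/
lemma int_model {p : ℕ} [Fact p.Prime] (B : Finset (ZMod p)) (n : ℕ) (hB : B.card = n) (hn : 0 < n)
    (hp : 3 * n ≤ p) (r : ℝ) (hr : 0 ≤ r) :
    ∃ u : ZMod p, u ≠ 0 ∧ ∃ T : Finset ℤ, (∀ x ∈ T, -x ∈ T) ∧ (0 : ℤ) ∈ T ∧
      (∀ x ∈ T, (nn B (u * x) : ℝ) ≤ r ∧ 8 * |x| < p) ∧
      (1 - 6 * (r / n)) * (TT B r).card ≤ T.card ∧ (T + T).card ≤ (TT B (2 * r)).card := by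
  obtain ⟨ξ, hξ, h1⟩ := four_exists B (TT B r) n hB hn hp r (fun d hd => mem_TT.1 hd)
  have hp0 : 0 < p := (Fact.out : p.Prime).pos
  refine ⟨ξ⁻¹, inv_ne_zero hξ, ?_⟩
  set T : Finset ℤ := (Finset.Ioo (-(p : ℤ)) p).filter
    (fun x => (nn B (ξ⁻¹ * x) : ℝ) ≤ r ∧ 8 * |x| < p) with hT
  have hmem : ∀ x : ℤ, x ∈ T ↔ (nn B (ξ⁻¹ * x) : ℝ) ≤ r ∧ 8 * |x| < p := by
    intro x
    rw [hT, Finset.mem_filter, Finset.mem_Ioo]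
    constructor
    · exact fun h => h.2
    · intro h
      refine ⟨?_, h⟩
      rcases abs_cases x with h' | h' <;> constructor <;> omega
  refine ⟨T, ?_, ?_, fun x hx => (hmem x).1 hx, ?_, ?_⟩
  · intro x hx
    rw [hmem] at hx ⊢
    rw [abs_neg]
    push_cast
    rw [mul_neg, nn_neg]
    exact hx
  · rw [hmem]; simp [nn_zero, hr, hp0]
  · set Bad := (TT B r).filter (fun d => (p : ℤ) ≤ 8 * |(ξ * d).valMinAbs|) with hBad
    have hb : (Bad.card : ℝ) * (1 / 4) ≤ 3 / 2 * (r / n) * (TT B r).card := by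
      refine le_trans ?_ h1
      rw [← nsmul_eq_mul]
      refine le_trans ?_ (Finset.sum_le_sum_of_subset_of_nonneg (Finset.filter_subset _ _ : Bad ⊆ TT B r) ?_)
      · refine Finset.card_nsmul_le_sum _ _ _ fun d hd => ?_
        exact re_large _ (Finset.mem_filter.1 hd).2
      · intro d _ _
        have := Complex.re_le_norm (ZMod.stdAddChar (ξ * d) : ℂ)
        rw [AddChar.norm_apply] at this
        linarith
    have hg : (TT B r \ Bad).card ≤ T.card := by
      refine Finset.card_le_card_of_injOn (fun d => (ξ * d).valMinAbs) ?_ ?_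
      · intro d hd
        simp only [hBad, coe_sdiff, Set.mem_diff, mem_coe, mem_filter, not_and, not_le] at hd
        simp only [mem_coe]
        rw [hmem, ZMod.coe_valMinAbs, inv_mul_cancel_left₀ hξ]
        exact ⟨mem_TT.1 hd.1, hd.2 hd.1⟩
      · intro d _ d' _ h
        exact mul_left_cancel₀ hξ (ZMod.injective_valMinAbs h)
    have hg2 := Finset.card_sdiff_add_card_eq_card (Finset.filter_subset _ _ : Bad ⊆ TT B r)
    have hg2' : ((TT B r \ Bad).card : ℝ) + Bad.card = (TT B r).card := by exact_mod_cast hg2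
    have hg' : ((TT B r \ Bad).card : ℝ) ≤ T.card := by exact_mod_cast hg
    linarith
  · refine Finset.card_le_card_of_injOn (fun x => ξ⁻¹ * x) ?_ ?_
    · intro z hz
      obtain ⟨x, hx, y, hy, rfl⟩ := Finset.mem_add.1 (Finset.mem_coe.1 hz)
      rw [hmem] at hx hy
      rw [Finset.mem_coe, mem_TT]
      push_cast
      rw [mul_add]
      have : (nn B (ξ⁻¹ * x + ξ⁻¹ * y) : ℝ) ≤ nn B (ξ⁻¹ * x) + nn B (ξ⁻¹ * y) := by
        exact_mod_cast nn_add B _ _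
      linarith
    · intro z hz z' hz' heq
      obtain ⟨x, hx, y, hy, rfl⟩ := Finset.mem_add.1 (Finset.mem_coe.1 hz)
      obtain ⟨x', hx', y', hy', rfl⟩ := Finset.mem_add.1 (Finset.mem_coe.1 hz')
      rw [hmem] at hx hy hx' hy'
      have e := mul_left_cancel₀ (inv_ne_zero hξ) heq
      rw [ZMod.intCast_eq_intCast_iff_dvd_sub] at e
      have := Int.eq_zero_of_abs_lt_dvd e (by
        have := hx.2; have := hy.2; have := hx'.2; have := hy'.2
        rw [abs_lt]
        rcases abs_cases x with h | h <;> rcases abs_cases y with h | h <;>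
        rcases abs_cases x' with h | h <;> rcases abs_cases y' with h | h <;>
        constructor <;> omega)
      linarith


lemma sub32_aux {H : Type*} [AddCommGroup H] [DecidableEq H] (G : Finset H)
    (hsym : ∀ x ∈ G, -x ∈ G) (h : 2 * (G + G).card < 3 * G.card) :
    ∀ z ∈ G + G, G.card < 2 * (G.filter (fun g => g + z ∈ G)).card := by
  intro z hz
  obtain ⟨x, hx, y, hy, rfl⟩ := Finset.mem_add.1 hz
  have h1 := Finset.card_union_add_card_inter (G.image (· + x)) (G.image (· + (-y)))
  rw [Finset.card_image_of_injective _ (add_left_injective _),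
    Finset.card_image_of_injective _ (add_left_injective _)] at h1
  have h2 : (G.image (· + x) ∪ G.image (· + (-y))).card ≤ (G + G).card := by
    refine Finset.card_le_card ?_
    intro w hw
    simp only [mem_union, mem_image] at hw
    rcases hw with ⟨g, hg, rfl⟩ | ⟨g, hg, rfl⟩
    · exact Finset.add_mem_add hg hx
    · exact Finset.add_mem_add hg (hsym _ hy)
  have h3 : (G.image (· + x) ∩ G.image (· + (-y))).card ≤ (G.filter (fun g => g + (x + y) ∈ G)).card := by
    refine Finset.card_le_card_of_injOn (fun w => w - x) ?_ ?_
    · intro w hw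
      simp only [coe_inter, coe_image, Set.mem_inter_iff, Set.mem_image, mem_coe] at hw
      obtain ⟨⟨g, hg, rfl⟩, g', hg', h'⟩ := hw
      simp only [coe_filter, Set.mem_ofPred_eq, add_sub_cancel_right]
      refine ⟨hg, ?_⟩
      have : g + (x + y) = g' := by rw [← add_assoc, ← h']; abel
      rwa [this]
    · intro w _ w' _ h; simpa using h
  omega

lemma sub32 {H : Type*} [AddCommGroup H] [DecidableEq H] (G : Finset H)
    (hsym : ∀ x ∈ G, -x ∈ G) (h : 2 * (G + G).card < 3 * G.card) :
    ∀ x ∈ G + G, ∀ y ∈ G + G, x + y ∈ G + G := by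
  intro x hx y hy
  have hy' : -y ∈ G + G := by
    obtain ⟨a, ha, b, hb, rfl⟩ := Finset.mem_add.1 hy
    rw [neg_add]; exact Finset.add_mem_add (hsym _ ha) (hsym _ hb)
  have h1 := sub32_aux G hsym h x hx
  have h2 := sub32_aux G hsym h _ hy'
  have h3 := Finset.card_union_add_card_inter (G.filter (fun g => g + x ∈ G)) (G.filter (fun g => g + -y ∈ G))
  have h4 : (G.filter (fun g => g + x ∈ G) ∪ G.filter (fun g => g + -y ∈ G)).card ≤ G.card :=
    Finset.card_le_card (union_subset (filter_subset _ _) (filter_subset _ _))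
  obtain ⟨g, hg⟩ : (G.filter (fun g => g + x ∈ G) ∩ G.filter (fun g => g + -y ∈ G)).Nonempty := by
    rw [← Finset.card_pos]; omega
  simp only [mem_inter, mem_filter] at hg
  have := Finset.add_mem_add hg.1.2 (hsym _ hg.2.2)
  convert this using 1; abel

lemma int_struct (T : Finset ℤ) (hsym : ∀ x ∈ T, -x ∈ T) (h0 : (0 : ℤ) ∈ T) (e : ℕ)
    (hK : (T + T).card ≤ 2 * T.card + e) (hk : 26 * e + 33 < 3 * T.card) :
    ∃ q m : ℕ, 0 < q ∧ 0 < m ∧ (q * m : ℤ) ∈ T ∧ T.card ≤ 2 * m + 2 * e + 3 ∧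
      ∀ j < m, ∃ g ∈ T, ∃ g' ∈ T, (q * j : ℤ) = g + g' ∨ (q * j : ℤ) = g + g' - q * m := by
  obtain ⟨ℓ, hℓT, hmax⟩ := Finset.exists_max_image T id ⟨0, h0⟩
  simp only [id] at hmax
  have hmin : ∀ x ∈ T, -ℓ ≤ x := fun x hx => by have := hmax _ (hsym x hx); omega
  have hℓ : 0 < ℓ := by
    by_contra hc
    have : T ⊆ {0} := by
      intro x hx
      have := hmax x hx; have := hmin x hx
      rw [Finset.mem_singleton]; omega
    have := Finset.card_le_card this
    rw [Finset.card_singleton] at this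
    omega
  lift ℓ to ℕ using hℓ.le
  have hℓ' : 0 < ℓ := by exact_mod_cast hℓ
  have : NeZero ℓ := ⟨hℓ'.ne'⟩
  set P := T.filter (fun x : ℤ => 0 ≤ x ∧ x < (ℓ : ℤ)) with hP
  set G := P.filter (fun u : ℤ => u - (ℓ : ℤ) ∈ T) with hG
  have h0P : (0 : ℤ) ∈ P := by simp [hP, h0, hℓ']
  have h0G : (0 : ℤ) ∈ G := by simp only [hG, mem_filter, zero_sub]; exact ⟨h0P, hsym _ hℓT⟩
  have hGT : ∀ g ∈ G, g ∈ T ∧ g - ℓ ∈ T ∧ 0 ≤ g ∧ g < ℓ := by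
    intro g hg; simp only [hG, hP, mem_filter] at hg; tauto
  -- card of P
  have cP : T.card ≤ 2 * P.card + 1 := by
    have h1 : T ⊆ (P ∪ (P.erase 0).image (fun x => -x)) ∪ {(ℓ : ℤ), -(ℓ : ℤ)} := by
      intro x hx
      have := hmax x hx; have := hmin x hx
      simp only [mem_union, mem_image, mem_erase, mem_insert, mem_singleton, hP, mem_filter]
      by_cases hxl : x = ℓ
      · right; left; exact hxl
      by_cases hxl' : x = -ℓ
      · right; right; exact hxl'
      left
      by_cases hx0 : 0 ≤ x
      · left; exact ⟨hx, hx0, by omega⟩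
      · right; exact ⟨-x, ⟨by omega, hsym x hx, by omega, by omega⟩, by omega⟩
    have h2 := Finset.card_le_card h1
    have h3 := Finset.card_union_le (P ∪ (P.erase 0).image (fun x => -x)) {(ℓ : ℤ), -(ℓ : ℤ)}
    have h4 := Finset.card_union_le P ((P.erase 0).image (fun x => -x))
    have h5 : ((P.erase 0).image (fun x => -x)).card ≤ P.card - 1 := by
      refine Finset.card_image_le.trans ?_
      rw [Finset.card_erase_of_mem h0P]
    have h6 : ({(ℓ : ℤ), -(ℓ : ℤ)} : Finset ℤ).card ≤ 2 := Finset.card_le_two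
    have h7 := Finset.card_pos.2 ⟨_, h0P⟩
    omega
  -- claim 1
  have c1 : 2 * T.card + (P \ G).card ≤ (T + T).card + 1 := by
    have h1 := Finset.card_union_add_card_inter (T.image (· + (ℓ : ℤ))) (T.image (· + (-(ℓ : ℤ))))
    rw [Finset.card_image_of_injective _ (add_left_injective _),
      Finset.card_image_of_injective _ (add_left_injective _)] at h1
    have h2 : (T.image (· + (ℓ : ℤ)) ∩ T.image (· + (-(ℓ : ℤ)))).card ≤ 1 := by
      rw [← Finset.card_singleton (0 : ℤ)]
      refine Finset.card_le_card ?_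
      intro x hx
      simp only [mem_inter, mem_image] at hx
      obtain ⟨⟨a, ha, rfl⟩, b, hb, hab⟩ := hx
      have := hmin a ha; have := hmax b hb
      rw [Finset.mem_singleton]; omega
    have h3 : Disjoint (T.image (· + (ℓ : ℤ)) ∪ T.image (· + (-(ℓ : ℤ)))) (P \ G) := by
      rw [Finset.disjoint_right]
      intro x hx hx'
      simp only [mem_sdiff, hG, mem_filter, not_and] at hx
      have hxP := hx.1
      have hxG := hx.2 hxP
      simp only [hP, mem_filter] at hxP
      simp only [mem_union, mem_image] at hx'
      rcases hx' with ⟨a, ha, rfl⟩ | ⟨a, ha, hax⟩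
      · apply hxG; simpa using ha
      · have := hmax a ha
        have : x = 0 := by omega
        subst this
        apply hxG; rw [zero_sub]; exact hsym _ hℓT
    have h4 : (T.image (· + (ℓ : ℤ)) ∪ T.image (· + (-(ℓ : ℤ)))) ∪ (P \ G) ⊆ T + T := by
      intro x hx
      simp only [mem_union, mem_image, mem_sdiff] at hx
      rcases hx with (⟨a, ha, rfl⟩ | ⟨a, ha, rfl⟩) | hx
      · exact Finset.add_mem_add ha hℓT
      · exact Finset.add_mem_add ha (hsym _ hℓT)
      · rw [← add_zero x]
        exact Finset.add_mem_add (Finset.mem_filter.1 hx.1).1 h0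
    have h5 := Finset.card_le_card h4
    rw [Finset.card_union_of_disjoint h3] at h5
    omega
  have cG : (P \ G).card + G.card = P.card :=
    Finset.card_sdiff_add_card_eq_card (Finset.filter_subset _ _ : G ⊆ P)
  -- claim 2
  set Q : Finset (ZMod ℓ) := G.image (fun x : ℤ => (x : ZMod ℓ)) with hQ
  have hinj : ∀ x : ℤ, ∀ y : ℤ, 0 ≤ x → x < ℓ → 0 ≤ y → y < ℓ → (x : ZMod ℓ) = y → x = y := by
    intro x y h1 h2 h3 h4 h
    rw [ZMod.intCast_eq_intCast_iff] at h
    rw [← Int.emod_eq_of_lt h1 h2, ← Int.emod_eq_of_lt h3 h4]; exact h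
  have cQ : Q.card = G.card := by
    refine Finset.card_image_of_injOn ?_
    intro x hx y hy h
    have h1 := hGT x hx; have h2 := hGT y hy
    exact hinj x y h1.2.2.1 h1.2.2.2 h2.2.2.1 h2.2.2.2 h
  have h0Q : (0 : ZMod ℓ) ∈ Q := Finset.mem_image.2 ⟨0, h0G, by simp⟩
  have hQE : Q ⊆ Q + Q := fun x hx => by rw [← add_zero x]; exact Finset.add_mem_add hx h0Q
  have c2 : 3 * (Q + Q).card + Q.card ≤ (T + T).card := by
    have h1 : ∑ z ∈ Q + Q, (3 + if z ∈ Q then 1 else 0) ≤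
        ∑ z ∈ Q + Q, ((T + T).filter (fun x : ℤ => (x : ZMod ℓ) = z)).card := by
      refine Finset.sum_le_sum fun z hz => ?_
      split_ifs with hzQ
      · obtain ⟨g, hg, rfl⟩ := Finset.mem_image.1 hzQ
        obtain ⟨g1, g2, -, -⟩ := hGT g hg
        have : ({g + ℓ, g, g - ℓ, g - 2 * ℓ} : Finset ℤ) ⊆ (T + T).filter (fun x : ℤ => (x : ZMod ℓ) = g) := by
          intro x hx
          simp only [mem_insert, mem_singleton] at hx
          rw [Finset.mem_filter]
          rcases hx with rfl | rfl | rfl | rfl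
          · exact ⟨Finset.add_mem_add g1 hℓT, by simp⟩
          · refine ⟨?_, by simp⟩
            have := Finset.add_mem_add g1 h0
            rwa [add_zero] at this
          · refine ⟨?_, by simp⟩
            have := Finset.add_mem_add g2 h0
            rwa [add_zero] at this
          · refine ⟨?_, by simp⟩
            have := Finset.add_mem_add g2 (hsym _ hℓT)
            convert this using 1; ring
        refine le_trans ?_ (Finset.card_le_card this)
        rw [Finset.card_insert_of_notMem, Finset.card_insert_of_notMem, Finset.card_insert_of_notMem,
          Finset.card_singleton]
        all_goals (simp only [mem_insert, mem_singleton]; omega)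
      · obtain ⟨z1, hz1, z2, hz2, rfl⟩ := Finset.mem_add.1 hz
        obtain ⟨g, hg, rfl⟩ := Finset.mem_image.1 hz1
        obtain ⟨g', hg', rfl⟩ := Finset.mem_image.1 hz2
        obtain ⟨g1, g2, -, -⟩ := hGT g hg
        obtain ⟨g3, g4, -, -⟩ := hGT g' hg'
        have : ({g + g', g + g' - ℓ, g + g' - 2 * ℓ} : Finset ℤ) ⊆
            (T + T).filter (fun x : ℤ => (x : ZMod ℓ) = (g : ZMod ℓ) + g') := by
          intro x hx
          simp only [mem_insert, mem_singleton] at hx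
          rw [Finset.mem_filter]
          rcases hx with rfl | rfl | rfl
          · exact ⟨Finset.add_mem_add g1 g3, by simp⟩
          · refine ⟨?_, by simp⟩
            have := Finset.add_mem_add g1 g4
            convert this using 1; ring
          · refine ⟨?_, by simp⟩
            have := Finset.add_mem_add g2 g4
            convert this using 1; ring
        refine le_trans ?_ (Finset.card_le_card this)
        rw [Finset.card_insert_of_notMem, Finset.card_insert_of_notMem,
          Finset.card_singleton]
        all_goals (simp only [mem_insert, mem_singleton]; omega)
    have h2 : ∑ z ∈ Q + Q, (3 + if z ∈ Q then 1 else 0) = 3 * (Q + Q).card + Q.card := by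
      rw [Finset.sum_add_distrib, Finset.sum_const, smul_eq_mul, mul_comm, ← Finset.card_filter,
        Finset.filter_mem_eq_inter, Finset.inter_eq_right.2 hQE]
    have h3 : ∑ z ∈ Q + Q, ((T + T).filter (fun x : ℤ => (x : ZMod ℓ) = z)).card ≤ (T + T).card := by
      have := Finset.card_eq_sum_card_fiberwise (s := T + T) (f := fun x : ℤ => (x : ZMod ℓ))
        (t := Finset.univ) (by intro x _; simp)
      rw [this]
      exact Finset.sum_le_sum_of_subset (Finset.subset_univ _)
    omega
  have hQsym : ∀ x ∈ Q, -x ∈ Q := by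
    intro x hx
    obtain ⟨g, hg, rfl⟩ := Finset.mem_image.1 hx
    obtain ⟨g1, g2, g3, g4⟩ := hGT g hg
    by_cases hg0 : g = 0
    · subst hg0; simpa using h0Q
    · refine Finset.mem_image.2 ⟨ℓ - g, ?_, by simp⟩
      simp only [hG, hP, mem_filter]
      have := hsym _ g2
      have h' := hsym _ g1
      refine ⟨⟨by convert this using 1; ring, by omega, by omega⟩, by convert h' using 1; ring⟩
  have hclosed := sub32 Q hQsym (by omega)
  -- subgroup
  let H : AddSubgroup ℤ :=
    { carrier := {z | (z : ZMod ℓ) ∈ Q + Q}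
      add_mem' := by
        intro a b ha hb
        have := hclosed _ ha _ hb
        show ((a + b : ℤ) : ZMod ℓ) ∈ Q + Q
        push_cast; exact this
      zero_mem' := by
        show ((0 : ℤ) : ZMod ℓ) ∈ Q + Q
        push_cast; exact hQE h0Q
      neg_mem' := by
        intro a ha
        show ((-a : ℤ) : ZMod ℓ) ∈ Q + Q
        obtain ⟨x, hx, y, hy, hxy⟩ := Finset.mem_add.1 (show (a : ZMod ℓ) ∈ Q + Q from ha)
        push_cast; rw [← hxy, neg_add]; exact Finset.add_mem_add (hQsym _ hx) (hQsym _ hy) }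
  have hH : ∀ z : ℤ, z ∈ H ↔ (z : ZMod ℓ) ∈ Q + Q := fun z => Iff.rfl
  obtain ⟨a, ha⟩ := Int.subgroup_cyclic H
  have hdiv : ∀ z : ℤ, z ∈ H ↔ (a.natAbs : ℤ) ∣ z := by
    intro z
    rw [ha, ← AddSubgroup.zmultiples_eq_closure, Int.mem_zmultiples_iff, Int.natAbs_dvd]
  have hℓH : (a.natAbs : ℤ) ∣ ℓ := by
    rw [← hdiv, hH]; simp; exact hQE h0Q
  set q := a.natAbs with hq
  obtain ⟨m, hm⟩ := Int.natCast_dvd_natCast.1 hℓH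
  have hq0 : 0 < q := by
    rcases Nat.eq_zero_or_pos q with h | h
    · rw [h] at hm; omega
    · exact h
  have hm0 : 0 < m := by
    rcases Nat.eq_zero_or_pos m with h | h
    · rw [h] at hm; omega
    · exact h
  have hmz : (ℓ : ℤ) = q * m := by exact_mod_cast hm
  refine ⟨q, m, hq0, hm0, by rw [← hmz]; exact hℓT, ?_, ?_⟩
  · have : G.card ≤ m := by
      rw [← Finset.card_range m]
      refine Finset.card_le_card_of_injOn (fun g => (g / q).toNat) ?_ ?_
      · intro g hg
        obtain ⟨g1, g2, g3, g4⟩ := hGT g hg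
        simp only [coe_range, Set.mem_Iio]
        have : g / q < m := by
          apply Int.ediv_lt_of_lt_mul (by exact_mod_cast hq0)
          rw [mul_comm, ← hmz]; exact g4
        omega
      · intro g hg g' hg' h
        obtain ⟨g1, g2, g3, g4⟩ := hGT g hg
        obtain ⟨g1', g2', g3', g4'⟩ := hGT g' hg'
        have d1 : (q : ℤ) ∣ g := by rw [← hdiv, hH]; exact hQE (Finset.mem_image_of_mem _ hg)
        have d2 : (q : ℤ) ∣ g' := by rw [← hdiv, hH]; exact hQE (Finset.mem_image_of_mem _ hg')
        have p1 : 0 ≤ g / q := Int.ediv_nonneg g3 (by positivity)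
        have p2 : 0 ≤ g' / q := Int.ediv_nonneg g3' (by positivity)
        have : g / q = g' / q := by
          have h : (g / q).toNat = (g' / q).toNat := h
          omega
        rw [← Int.ediv_mul_cancel d1, ← Int.ediv_mul_cancel d2, this]
    omega
  · intro j hj
    have : (q * j : ℤ) ∈ H := by rw [hdiv]; exact Dvd.intro _ rfl
    rw [hH] at this
    obtain ⟨x, hx, y, hy, hxy⟩ := Finset.mem_add.1 this
    obtain ⟨g, hg, rfl⟩ := Finset.mem_image.1 hx
    obtain ⟨g', hg', rfl⟩ := Finset.mem_image.1 hy
    obtain ⟨g1, g2, g3, g4⟩ := hGT g hg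
    obtain ⟨g1', g2', g3', g4'⟩ := hGT g' hg'
    refine ⟨g, g1, g', g1', ?_⟩
    have hb : (q * j : ℤ) < ℓ := by rw [hmz]; exact_mod_cast Nat.mul_lt_mul_of_pos_left hj hq0
    have hb0 : (0 : ℤ) ≤ q * j := by positivity
    rw [← hmz]
    by_cases hlt : g + g' < ℓ
    · left
      symm
      exact hinj _ _ (by omega) hlt hb0 hb (by push_cast at hxy ⊢; exact hxy)
    · right
      symm
      exact hinj _ _ (by omega) (by omega) hb0 hb (by push_cast at hxy ⊢; simpa using hxy)


lemma nn_transfer {p : ℕ} [Fact p.Prime] (A B S : Finset (ZMod p)) (n : ℕ) (y : ℝ) (hy : 1 ≤ y)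
    (hA : A.card = n) (hB : B.card = n) (hp : 3 * n ≤ p) (hf : (fl A B S : ℝ) ≤ y ^ 2)
    (hS : S.card ≤ 2 * n) (hyn : 4 * y ≤ n) (d : ZMod p) :
    (nn A d : ℝ) ≤ nn B d + 12 * y := by
  have ga : (nn A d : ℝ) + gam A d = n := by rw [← hA]; exact_mod_cast nn_add_gam A d
  have gb : (nn B d : ℝ) + gam B d = n := by rw [← hB]; exact_mod_cast nn_add_gam B d
  by_cases hg : (gam B d : ℝ) < 4 * y
  · have : (0 : ℝ) ≤ gam A d := by positivity
    linarith
  push Not at hg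
  have f1 : (fl A (B ∩ sh B d) (S ∩ sh S d) : ℝ) ≤ fl A B S + fl A B S := by
    have := fl_inter B (sh B d) A S (sh S d)
    rw [fl_sh, fl_comm _ A, fl_comm B A] at this; exact_mod_cast this
  have f2 : (fl (A ∪ sh A d) B (S ∪ sh S d) : ℝ) ≤ fl A B S + fl A B S := by
    have := fl_union A (sh A d) B S (sh S d)
    rw [fl_sh] at this; exact_mod_cast this
  have g1 : A.card ≤ (A ∪ sh A d).card := Finset.card_le_card subset_union_left
  have g1' : (n : ℝ) ≤ (A ∪ sh A d).card := by rw [← hA]; exact_mod_cast g1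
  have g2 := Finset.card_union_add_card_inter A (sh A d)
  have g3 := Finset.card_union_add_card_inter S (sh S d)
  have g4 := gam_le B d
  rw [card_sh] at g2 g3
  rw [hA] at g2
  have r1 := rob_cd A (B ∩ sh B d) (S ∩ sh S d) (2 * y) (by linarith) (by nlinarith)
    (by rw [hA]; linarith) (by unfold gam at hg; linarith) (by unfold gam at g4; omega)
  have r2 := rob_cd (A ∪ sh A d) B (S ∪ sh S d) (2 * y) (by linarith) (by nlinarith) (by linarith)
    (by rw [hB]; linarith) (by omega)
  rw [hB] at r2
  rw [hA] at r1
  have g2' : ((A ∪ sh A d).card : ℝ) + gam A d = n + n := by unfold gam; exact_mod_cast g2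
  have g3' : ((S ∪ sh S d).card : ℝ) + (S ∩ sh S d).card = S.card + S.card := by exact_mod_cast g3
  have hS' : (S.card : ℝ) ≤ 2 * n := by exact_mod_cast hS
  have r1' : (n : ℝ) + gam B d ≤ (S ∩ sh S d).card + 3 * (2 * y) := r1
  linarith

lemma norm_fin {p : ℕ} (B : Finset (ZMod p)) (T : Finset ℤ) (u : ZMod p) (n : ℕ) (r ω : ℝ) (q m : ℕ)
    (hω : 0 < ω) (hr0 : 0 < r) (hm : 0 < m) (h2 : r ≤ ω * n)
    (hT : ∀ x ∈ T, (nn B (u * (x : ZMod p)) : ℝ) ≤ r) (hqm : (q * m : ℤ) ∈ T)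
    (hjj : ∀ j < m, ∃ g ∈ T, ∃ g' ∈ T, (q * j : ℤ) = g + g' ∨ (q * j : ℤ) = g + g' - q * m)
    (hrm : r ≤ m * (1 + 200 * ω)) (j : ℕ) (hj : j ≤ n) :
    (nn B (u * q * j) : ℝ) ≤ j + 203 * ω * n := by
  set i := j / m with hi
  set j0 := j % m with hj0
  have hdm : m * i + j0 = j := Nat.div_add_mod j m
  have hj0m : j0 < m := Nat.mod_lt _ hm
  obtain ⟨g, hg, g', hg', hgg⟩ := hjj j0 hj0m
  have hℓ := hT _ hqm
  push_cast at hℓ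
  have b1 : (nn B (u * (q * j0)) : ℝ) ≤ 3 * r := by
    have a1 := hT _ hg
    have a2 := hT _ hg'
    have c1 : (nn B (u * g + u * g') : ℝ) ≤ nn B (u * g) + nn B (u * g') := by
      exact_mod_cast nn_add B _ _
    rcases hgg with hgg | hgg
    · have : u * ((q : ZMod p) * j0) = u * g + u * g' := by
        have := congrArg (fun z : ℤ => (z : ZMod p)) hgg
        push_cast at this
        rw [this]; ring
      rw [this]; linarith
    · have : u * ((q : ZMod p) * j0) = (u * g + u * g') + -(u * (q * m)) := by
        have := congrArg (fun z : ℤ => (z : ZMod p)) hgg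
        push_cast at this
        rw [this]; ring
      rw [this]
      have c2 : (nn B ((u * g + u * g') + -(u * (q * m))) : ℝ) ≤
        nn B (u * g + u * g') + nn B (-(u * (q * m))) := by exact_mod_cast nn_add B _ _
      rw [nn_neg] at c2
      linarith
  have b2 : (nn B (i * (u * (q * m))) : ℝ) ≤ i * r := by
    have : (nn B (i * (u * (q * m))) : ℝ) ≤ i * nn B (u * (q * m)) := by
      exact_mod_cast nn_nsmul B _ _
    have h3 : (i : ℝ) * nn B (u * (q * m)) ≤ i * r := by gcongr
    linarith
  have b3 : u * q * (j : ZMod p) = i * (u * (q * m)) + u * (q * j0) := by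
    rw [← hdm]; push_cast; ring
  have b4 : (nn B (u * q * j) : ℝ) ≤ nn B (i * (u * (q * m))) + nn B (u * (q * j0)) := by
    rw [b3]; exact_mod_cast nn_add B _ _
  have b5 : (i : ℝ) * r ≤ j * (1 + 200 * ω) := by
    have e1 : (i : ℝ) * r ≤ i * (m * (1 + 200 * ω)) := by gcongr
    have e2 : (m : ℝ) * i ≤ j := by
      have : m * i ≤ j := by omega
      exact_mod_cast this
    have e3 : (m : ℝ) * i * (1 + 200 * ω) ≤ j * (1 + 200 * ω) := by gcongr
    linarith
  have hjn : (j : ℝ) ≤ n := by exact_mod_cast hj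
  have e4 : ω * j ≤ ω * n := by gcongr
  linarith

lemma norm_ar (m r ω z : ℝ) (hz : z = ω * r) (hω : 0 < ω) (hω1 : ω ≤ 1 / 1000) (hz0 : 0 < z)
    (h : r - 136 * z ≤ m) : r ≤ m * (1 + 200 * ω) := by
  have h1 : ω * (r - 136 * z) ≤ ω * m := by gcongr
  have h2 : ω * z ≤ 1 / 1000 * z := by gcongr
  linarith

/-- near-linear norm along a progression -/
lemma norm_lin1 {p : ℕ} [Fact p.Prime] (A B S : Finset (ZMod p)) (n : ℕ) (ω y : ℝ)
    (hω : 0 < ω) (hω1 : ω ≤ 1 / 1000) (hy : 2 ≤ y) (hB : B.card = n) (hp : 3 * n ≤ p)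
    (hf : (fl A B S : ℝ) ≤ y ^ 2) (hS : (S.card : ℝ) ≤ A.card + n + 6 * y)
    (h1 : y ≤ ω * A.card) (h2 : A.card + 8 * y ≤ ω * n) :
    ∃ u : ZMod p, u ≠ 0 ∧ ∀ j : ℕ, j ≤ n → (nn B (u * j) : ℝ) ≤ j + 203 * ω * n := by
  obtain ⟨r, hr⟩ : ∃ r : ℝ, r = A.card + 8 * y := ⟨_, rfl⟩
  obtain ⟨z, hz⟩ : ∃ z : ℝ, z = ω * r := ⟨_, rfl⟩
  have hm0 : (0 : ℝ) ≤ A.card := by positivity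
  have hr0 : 0 < r := by linarith
  have hyr : y ≤ z := by
    have : ω * A.card ≤ ω * r := by gcongr; linarith
    linarith
  have hzr : z ≤ 1 / 1000 * r := by rw [hz]; gcongr
  have hrn : r ≤ 1 / 1000 * n := by
    have : ω * n ≤ 1 / 1000 * n := by gcongr
    linarith
  have hyA : 1000 * y ≤ A.card := by
    have : ω * (A.card : ℝ) ≤ 1 / 1000 * A.card := by gcongr
    linarith
  have hn0 : (0 : ℝ) < n := by linarith
  have hx : r / n ≤ ω := by rw [div_le_iff₀ hn0, hr]; exact h2
  have hx0 : 0 ≤ r / n := by positivity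
  have hAn : (A.card : ℝ) ≤ n := by linarith
  have hAn' : A.card ≤ n := by exact_mod_cast hAn
  have lo := TT_lower A B S n y (by linarith) hB (by omega) hf hS (by linarith)
  have up := TT_upper B n hB hp r (by linarith) (by linarith)
  rw [← hr] at lo
  obtain ⟨u, hu, T, hsym, h0, hT, hTc, hTT⟩ := int_model B n hB (by exact_mod_cast hn0) hp r hr0.le
  have up' : ((T + T).card : ℝ) ≤ 4 * r + 56 * z + 2 := by
    have e1 : ((T + T).card : ℝ) ≤ (TT B (2 * r)).card := by exact_mod_cast hTT
    have e2 : 4 * r * (1 + 14 * (r / n)) ≤ 4 * r * (1 + 14 * ω) := by gcongr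
    rw [hz]; linarith
  have lo2 : 2 * r - 19 * y ≤ (TT B r).card := by linarith
  have lo3 : 2 * r - 31 * z ≤ T.card := by
    have e1 : (1 - 6 * ω) * (2 * r - 19 * y) ≤ (1 - 6 * (r / n)) * (TT B r).card := by
      have : 0 ≤ 2 * r - 19 * y := by linarith
      have : 0 ≤ 1 - 6 * ω := by linarith
      gcongr
      linarith
    have e3 : 0 ≤ ω * y := by positivity
    have e2 : 2 * r - 31 * z ≤ (1 - 6 * ω) * (2 * r - 19 * y) := by linarith
    linarith
  obtain ⟨e, he⟩ : ∃ e : ℕ, e = (T + T).card - 2 * T.card := ⟨_, rfl⟩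
  have he' : (e : ℝ) ≤ 119 * z := by
    rcases le_total (T + T).card (2 * T.card) with h | h
    · rw [he, Nat.sub_eq_zero_of_le h]; push_cast; linarith
    · rw [he, Nat.cast_sub h]; push_cast; linarith
  have hk : 26 * e + 33 < 3 * T.card := by
    have : 26 * (e : ℝ) + 33 < 3 * T.card := by linarith
    exact_mod_cast this
  obtain ⟨q, m, hq, hm, hqm, hTm, hjj⟩ := int_struct T hsym h0 e (by omega) hk
  have hTm' : (T.card : ℝ) ≤ 2 * m + 2 * e + 3 := by exact_mod_cast hTm
  have hrm : r ≤ m * (1 + 200 * ω) := norm_ar m r ω z hz hω hω1 (by linarith) (by linarith)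
  refine ⟨u * q, mul_ne_zero hu ?_, fun j hj => norm_fin B T u n r ω q m hω hr0 hm (by linarith)
    (fun x hx => (hT x hx).1) hqm hjj hrm j hj⟩
  intro h
  rw [ZMod.natCast_eq_zero_iff] at h
  have h3 := Nat.le_of_dvd hq h
  have h4 := (hT _ hqm).2
  rw [abs_of_nonneg (by positivity)] at h4
  have : (q : ℤ) * 1 ≤ q * m := by gcongr; exact_mod_cast hm
  omega

lemma norm_lin (ω : ℝ) (hω : 0 < ω) (hω1 : ω ≤ 1 / 1000) :
    ∃ ε : ℝ, 0 < ε ∧ ∃ n0 : ℕ, ∀ (p : ℕ) [Fact p.Prime] (A B S : Finset (ZMod p)) (n : ℕ),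
      A.card = n → B.card = n → 3 * n ≤ p → n0 ≤ n →
      (fl A B S : ℝ) ≤ (ε * n) ^ 2 → S.card ≤ 2 * n →
      ∃ u : ZMod p, u ≠ 0 ∧ ∀ j : ℕ, j ≤ n → (nn B (u * j) : ℝ) ≤ j + 215 * ω * n ∧
        (nn A (u * j) : ℝ) ≤ j + 215 * ω * n := by
  set η : ℝ := ω / 2 with hη
  set δ : ℝ := ω * (η / 24 * η) with hδ
  have hη0 : 0 < η := by positivity
  have hδ0 : 0 < δ := by positivity
  have hδω : δ ≤ ω / 1000 := by
    rw [hδ]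
    have : η / 24 * η ≤ 1 / 1000 := by
      have : η ≤ 1 / 2000 := by linarith
      nlinarith
    nlinarith
  obtain ⟨ε, hε, hεδ, hw⟩ := window_final η δ hη0 (by linarith) hδ0
  refine ⟨ε, hε, ⌈max (2 / ε) (25 / η)⌉₊, ?_⟩
  intro p _ A B S n hA hB hp hn hf hS
  have hn1 : max (2 / ε) (25 / η) ≤ n := (Nat.le_ceil _).trans (by exact_mod_cast hn)
  have hn2 : 2 ≤ ε * n := by
    have := (le_max_left _ _).trans hn1
    rw [div_le_iff₀ hε] at this; linarith
  have hn3 : 25 ≤ η * n := by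
    have := (le_max_right _ _).trans hn1
    rw [div_le_iff₀ hη0] at this; linarith
  have hn0 : (0 : ℝ) < n := by nlinarith
  obtain ⟨A', S', g1, g2, g3, g4⟩ := hw p A B S n hA hB hp (by linarith) (by linarith) hf hS
  have hδn : ε * n ≤ δ * n := by gcongr
  obtain ⟨u, hu, hj⟩ := norm_lin1 A' B S' n ω (δ * n) hω hω1 (by linarith) hB hp g1 g2
    (by
      have : δ * n = ω * (η / 24 * (η * n)) := by rw [hδ]; ring
      rw [this]; gcongr)
    (by nlinarith)
  refine ⟨u, hu, fun j hjn => ?_⟩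
  have e1 := hj j hjn
  have e2 := nn_transfer A B S n (ε * n) (by linarith) hA hB hp hf hS (by nlinarith) (u * j)
  have e3 : 12 * (ε * n) ≤ 12 * ω * n := by nlinarith
  have : 0 < ω * n := by positivity
  constructor
  · linarith
  · linarith


def nL {p : ℕ} (C : Finset (ZMod p)) (n : ℕ) (c : ZMod p) : Finset (ZMod p) :=
  C.filter fun x => (c - x).val < n
def nR {p : ℕ} (C : Finset (ZMod p)) (n : ℕ) (c : ZMod p) : Finset (ZMod p) :=
  C.filter fun x => (x - c).val < n

lemma nLR_inter {p : ℕ} [NeZero p] (C : Finset (ZMod p)) (n : ℕ) (hp : 3 * n ≤ p) (c : ZMod p) :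
    (nL C n c ∩ nR C n c).card ≤ 1 := by
  rw [Finset.card_le_one]
  have key : ∀ x ∈ nL C n c ∩ nR C n c, x = c := by
    intro x hx
    simp only [nL, nR, mem_inter, mem_filter] at hx
    by_contra hne
    have h1 : x - c ≠ 0 := sub_ne_zero.mpr hne
    have h2 : (c - x).val = p - (x - c).val := by
      rw [← neg_sub x c, ZMod.neg_val, if_neg h1]
    have h3 := ZMod.val_lt (x - c)
    omega
  intro a ha b hb
  rw [key a ha, key b hb]

lemma nR_sum {p : ℕ} [NeZero p] (C : Finset (ZMod p)) (n : ℕ) (hp : 3 * n ≤ p) :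
    ∑ c ∈ C, (nR C n c).card = ∑ j ∈ range n, gam C (j : ZMod p) := by
  have e1 : ∀ c, (nR C n c).card = ∑ j ∈ range n, if c + (j : ZMod p) ∈ C then 1 else 0 := by
    intro c
    rw [Finset.sum_boole]
    simp only [Nat.cast_id]
    symm
    apply Finset.card_bij (fun (j : ℕ) _ => c + (j : ZMod p))
    · intro j hj
      simp only [mem_filter, mem_range] at hj
      simp only [nR, mem_filter, add_sub_cancel_left]
      refine ⟨hj.2, ?_⟩
      rw [ZMod.val_natCast, Nat.mod_eq_of_lt (by omega)]; exact hj.1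
    · intro a ha b hb h
      simp only [mem_filter, mem_range] at ha hb
      have h' : (a : ZMod p) = b := add_left_cancel h
      have := congrArg ZMod.val h'
      rwa [ZMod.val_natCast, ZMod.val_natCast, Nat.mod_eq_of_lt (by omega), Nat.mod_eq_of_lt (by omega)] at this
    · intro x hx
      simp only [nR, mem_filter] at hx
      refine ⟨(x - c).val, ?_, ?_⟩
      · simp only [mem_filter, mem_range, ZMod.natCast_val, ZMod.cast_id', id]
        refine ⟨hx.2, ?_⟩
        rw [add_sub_cancel]; exact hx.1
      · simp
  rw [Finset.sum_congr rfl (fun c _ => e1 c), Finset.sum_comm]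
  apply Finset.sum_congr rfl
  intro j _
  rw [Finset.sum_boole]
  simp only [Nat.cast_id, gam]
  apply Finset.card_bij (fun c _ => c + (j : ZMod p))
  · intro a ha
    simp only [mem_filter] at ha
    simp only [mem_inter, mem_sh, add_sub_cancel_right]
    exact ⟨ha.2, ha.1⟩
  · intro a _ b _ h
    exact add_right_cancel h
  · intro x hx
    simp only [mem_inter, mem_sh] at hx
    exact ⟨x - j, by simp [hx.1, hx.2], by simp⟩

lemma nL_sum {p : ℕ} [NeZero p] (C : Finset (ZMod p)) (n : ℕ) :
    ∑ c ∈ C, (nL C n c).card = ∑ c ∈ C, (nR C n c).card := by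
  simp only [nL, nR, Finset.card_filter]
  rw [Finset.sum_comm]

lemma gam_sum_lower {p : ℕ} [NeZero p] (C : Finset (ZMod p)) (n : ℕ) (θ : ℝ)
    (hC : C.card = n) (h : ∀ j : ℕ, j ≤ n → (nn C (j : ZMod p) : ℝ) ≤ j + θ * n) :
    (n : ℝ) ^ 2 / 2 - θ * n ^ 2 ≤ ∑ j ∈ range n, (gam C (j : ZMod p) : ℝ) := by
  have e1 : ∀ j ∈ range n, (n : ℝ) - j - θ * n ≤ gam C (j : ZMod p) := by
    intro j hj
    have h1 := h j (mem_range.mp hj).le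
    have h2 : (nn C (j : ZMod p) : ℝ) + gam C (j : ZMod p) = n := by
      rw [← hC]; exact_mod_cast nn_add_gam C _
    linarith
  have e2 : ∀ m : ℕ, ∑ j ∈ range m, ((n : ℝ) - j - θ * n) = m * n - m * (m - 1) / 2 - θ * n * m := by
    intro m
    induction m with
    | zero => simp
    | succ m ih => rw [Finset.sum_range_succ, ih]; push_cast; ring
  have e3 := Finset.sum_le_sum e1
  rw [e2] at e3
  have : (0 : ℝ) ≤ n := by positivity
  nlinarith

lemma interval_lem {p : ℕ} [Fact p.Prime] (C : Finset (ZMod p)) (n : ℕ) (θ ε : ℝ)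
    (hC : C.card = n) (hn : 0 < n) (hp : 3 * n ≤ p)
    (h : ∀ j : ℕ, j ≤ n → (nn C (j : ZMod p) : ℝ) ≤ j + θ * n)
    (hε : 0 < ε) (hε1 : ε < 1) (hθ : 1 + 2 * θ * n ≤ ε ^ 2 * n) :
    ∃ α : ZMod p, (1 - 3 * ε) * n - 2 ≤ (nR C n α).card := by
  have hn' : (0 : ℝ) < n := by exact_mod_cast hn
  set f : ZMod p → ℝ := fun c => ((nL C n c).card : ℝ) + (nR C n c).card with hf
  have hsum : (n : ℝ) ^ 2 - 2 * θ * n ^ 2 ≤ ∑ c ∈ C, f c := by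
    have e1 := gam_sum_lower C n θ hC h
    have e2 : ∑ c ∈ C, ((nR C n c).card : ℝ) = ∑ j ∈ range n, (gam C (j : ZMod p) : ℝ) := by
      exact_mod_cast nR_sum C n hp
    have e3 : ∑ c ∈ C, ((nL C n c).card : ℝ) = ∑ c ∈ C, ((nR C n c).card : ℝ) := by
      exact_mod_cast nL_sum C n
    simp only [hf]
    rw [Finset.sum_add_distrib, e3, e2]
    linarith
  have hun : ∀ c, f c ≤ (nL C n c ∪ nR C n c).card + 1 := by
    intro c
    have e1 := Finset.card_union_add_card_inter (nL C n c) (nR C n c)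
    have e2 := nLR_inter C n hp c
    have : (nL C n c).card + (nR C n c).card ≤ (nL C n c ∪ nR C n c).card + 1 := by omega
    simp only [hf]; exact_mod_cast this
  have hsub : ∀ c, nL C n c ∪ nR C n c ⊆ C := fun c =>
    Finset.union_subset (Finset.filter_subset _ _) (Finset.filter_subset _ _)
  have hf1 : ∀ c, f c ≤ n + 1 := by
    intro c
    have e1 : ((nL C n c ∪ nR C n c).card : ℝ) ≤ n := by
      have := Finset.card_le_card (hsub c)
      rw [hC] at this; exact_mod_cast this
    linarith [hun c]
  set bad := C.filter (fun c => f c < (1 - ε) * n) with hbad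
  have hbc : (bad.card : ℝ) ≤ ε * n := by
    have e1 : ∑ c ∈ C, (n + 1 - f c) ≤ n + 2 * θ * n ^ 2 := by
      rw [Finset.sum_sub_distrib, Finset.sum_const, hC, nsmul_eq_mul]; linarith
    have e2 : ∑ c ∈ bad, (n + 1 - f c) ≤ ∑ c ∈ C, (n + 1 - f c) := by
      apply Finset.sum_le_sum_of_subset_of_nonneg (Finset.filter_subset _ _)
      intro c _ _
      linarith [hf1 c]
    have e3 : ∑ _c ∈ bad, (ε * n) ≤ ∑ c ∈ bad, (n + 1 - f c) := by
      apply Finset.sum_le_sum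
      intro c hc
      have := (Finset.mem_filter.mp hc).2
      linarith
    rw [Finset.sum_const, nsmul_eq_mul] at e3
    have e4 : (bad.card : ℝ) * (ε * n) ≤ (ε * n) * (ε * n) := by nlinarith
    exact le_of_mul_le_mul_right e4 (by positivity)
  have hgood : ∃ b ∈ C, b ∉ bad := by
    by_contra hcon
    push Not at hcon
    have := Finset.card_le_card hcon
    have h3 : (n : ℝ) ≤ bad.card := by rw [← hC]; exact_mod_cast this
    nlinarith
  obtain ⟨b0, hb0, hb0g⟩ := hgood
  set I := (range n).filter (fun i : ℕ => b0 - (i : ZMod p) ∈ C ∧ b0 - (i : ZMod p) ∉ bad) with hI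
  have hIne : I.Nonempty := ⟨0, by simp [hI, hn, hb0, hb0g]⟩
  obtain ⟨i, hi, himax⟩ := Finset.exists_max_image I id hIne
  simp only [hI, mem_filter, mem_range] at hi
  set b1 := b0 - (i : ZMod p) with hb1
  have hb0' : (1 - ε) * n ≤ f b0 := by
    by_contra hh; push Not at hh
    exact hb0g (Finset.mem_filter.mpr ⟨hb0, hh⟩)
  have hb1' : (1 - ε) * n ≤ f b1 := by
    by_contra hh; push Not at hh
    exact hi.2.2 (Finset.mem_filter.mpr ⟨hi.2.1, hh⟩)
  have hLsub : nL C n b1 ⊆ {b1} ∪ bad ∪ (C \ (nL C n b0 ∪ nR C n b0)) := by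
    intro x hx
    simp only [nL, mem_filter] at hx
    obtain ⟨hxC, hxn⟩ := hx
    set j := (b1 - x).val with hj
    have hxj : x = b0 - ((i + j : ℕ) : ZMod p) := by
      push_cast
      rw [hj, ZMod.natCast_zmod_val, hb1]; ring
    rcases Nat.eq_zero_or_pos j with h0 | h0
    · have : x = b1 := by rw [hxj, h0, hb1]; simp
      simp [this]
    by_cases hij : i + j < n
    · have : x ∈ bad := by
        by_contra hxb
        have : i + j ∈ I := by
          simp only [hI, mem_filter, mem_range]
          rw [← hxj]; exact ⟨hij, hxC, hxb⟩
        have := himax _ this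
        simp only [id] at this
        omega
      simp [this]
    · have h1 : b0 - x = ((i + j : ℕ) : ZMod p) := by rw [hxj]; ring
      have h2 : (b0 - x).val = i + j := by
        rw [h1, ZMod.val_natCast, Nat.mod_eq_of_lt (by omega)]
      have h3 : (x - b0).val = p - (i + j) := by
        rw [← h2, ← neg_sub b0 x, ZMod.neg_val, if_neg]
        intro h4; rw [h4] at h2; simp at h2; omega
      simp only [mem_union, mem_sdiff]
      right
      refine ⟨hxC, ?_⟩
      simp only [nL, nR, mem_filter, not_or]
      constructor
      · rintro ⟨_, h5⟩; omega
      · rintro ⟨_, h5⟩; omega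
  have hLc : ((nL C n b1).card : ℝ) ≤ 1 + bad.card + (C \ (nL C n b0 ∪ nR C n b0)).card := by
    have e1 := Finset.card_le_card hLsub
    have e2 := Finset.card_union_le ({b1} ∪ bad) (C \ (nL C n b0 ∪ nR C n b0))
    have e3 := Finset.card_union_le {b1} bad
    rw [Finset.card_singleton] at e3
    have : (nL C n b1).card ≤ 1 + bad.card + (C \ (nL C n b0 ∪ nR C n b0)).card := by omega
    exact_mod_cast this
  have hD : ((C \ (nL C n b0 ∪ nR C n b0)).card : ℝ) + (nL C n b0 ∪ nR C n b0).card = n := by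
    have := Finset.card_sdiff_add_card_eq_card (hsub b0)
    rw [hC] at this; exact_mod_cast this
  refine ⟨b1, ?_⟩
  have := hun b0
  simp only [hf] at hb1'
  linarith

lemma nn_dilate {p : ℕ} [Fact p.Prime] (C : Finset (ZMod p)) (u : ZMod p) (hu : u ≠ 0) (x : ZMod p) :
    nn (C.image (u⁻¹ * ·)) x = nn C (u * x) := by
  have hinj : Function.Injective (fun y : ZMod p => u⁻¹ * y) :=
    mul_right_injective₀ (inv_ne_zero hu)
  unfold nn
  rw [Finset.card_image_of_injective _ hinj]
  congr 1
  unfold gam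
  rw [← Finset.card_image_of_injective (C ∩ sh C (u * x)) hinj]
  congr 1
  ext y
  simp only [mem_inter, mem_image, mem_sh]
  constructor
  · rintro ⟨⟨a, ha, rfl⟩, b, hb, hab⟩
    refine ⟨a, ⟨ha, ?_⟩, rfl⟩
    have : a - u * x = b := by
      have h1 : u * (u⁻¹ * b) = u * (u⁻¹ * a - x) := by rw [hab]
      rw [mul_sub, mul_inv_cancel_left₀ hu, mul_inv_cancel_left₀ hu] at h1
      exact h1.symm
    rw [this]; exact hb
  · rintro ⟨a, ⟨ha, hb⟩, rfl⟩
    refine ⟨⟨a, ha, rfl⟩, _, hb, ?_⟩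
    rw [mul_sub, inv_mul_cancel_left₀ hu]

/-- structure theorem -/
theorem structure_thm (ε : ℝ) (hε : 0 < ε) (hε1 : ε ≤ 1) :
    ∃ ε₁ : ℝ, 0 < ε₁ ∧ ∃ n0 : ℕ, ∀ (p : ℕ) [Fact p.Prime] (A B S : Finset (ZMod p)) (n : ℕ),
      A.card = n → B.card = n → 3 * n ≤ p → n0 ≤ n →
      (fl A B S : ℝ) ≤ (ε₁ * n) ^ 2 → S.card ≤ 2 * n →
      ∃ u : ZMod p, u ≠ 0 ∧ ∃ α β : ZMod p,
        (1 - ε) * n ≤ ((A.image (u * ·)).filter (fun x => (x - α).val < n)).card ∧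
        (1 - ε) * n ≤ ((B.image (u * ·)).filter (fun x => (x - β).val < n)).card := by
  set ε' : ℝ := ε / 4 with hε'
  set ω : ℝ := ε' ^ 2 / 1000 with hω
  have h0 : 0 < ε' := by positivity
  have hω0 : 0 < ω := by positivity
  obtain ⟨ε₁, h1, n0, hn0⟩ := norm_lin ω hω0 (by rw [hω]; nlinarith)
  refine ⟨ε₁, h1, max n0 (⌈2 / ε' ^ 2⌉₊ + ⌈2 / ε'⌉₊ + 1), ?_⟩
  intro p _ A B S n hA hB hp hn hf hS
  obtain ⟨u, hu, hj⟩ := hn0 p A B S n hA hB hp (by omega) hf hS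
  have hn1 : 2 / ε' ^ 2 ≤ n := (Nat.le_ceil _).trans (by exact_mod_cast (by omega))
  have hn2 : 2 / ε' ≤ n := (Nat.le_ceil _).trans (by exact_mod_cast (by omega))
  rw [div_le_iff₀ (by positivity)] at hn1 hn2
  have hpos : 0 < n := by omega
  have hinj : Function.Injective (fun y : ZMod p => u⁻¹ * y) :=
    mul_right_injective₀ (inv_ne_zero hu)
  have cond : 1 + 2 * (215 * ω) * n ≤ ε' ^ 2 * n := by
    have : ω * n = ε' ^ 2 * n / 1000 := by rw [hω]; ring
    linarith
  obtain ⟨α, hα⟩ := interval_lem (A.image (u⁻¹ * ·)) n (215 * ω) ε'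
    (by rw [Finset.card_image_of_injective _ hinj, hA]) hpos hp
    (fun j hjn => by rw [nn_dilate A u hu]; exact (hj j hjn).2) h0 (by linarith) cond
  obtain ⟨β, hβ⟩ := interval_lem (B.image (u⁻¹ * ·)) n (215 * ω) ε'
    (by rw [Finset.card_image_of_injective _ hinj, hB]) hpos hp
    (fun j hjn => by rw [nn_dilate B u hu]; exact (hj j hjn).1) h0 (by linarith) cond
  refine ⟨u⁻¹, inv_ne_zero hu, α, β, ?_, ?_⟩
  · refine le_trans ?_ hα
    have : ε = 4 * ε' := by rw [hε']; ring
    rw [this]; linarith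
  · refine le_trans ?_ hβ
    have : ε = 4 * ε' := by rw [hε']; ring
    rw [this]; linarith


noncomputable def hh (A B : Finset ℤ) (W : ℕ) : ℕ := (Icc (0 : ℤ) W \ A).card + (Icc (0 : ℤ) W \ B).card

lemma cover_fix (A B : Finset ℤ) (x : ℤ) (W k V : ℕ) (hk : 0 < k)
    (hx : (2 * V + k : ℤ) ≤ x ∧ x ≤ W + V) (hW : 2 * V + k ≤ W + 1) :
    ((range k ×ˢ Ico V (2 * V)).filter (fun q : ℕ × ℕ =>
      x ∉ (A.filter (fun a => a ∈ Icc (0 : ℤ) W ∧ a % k = q.1)) +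
        (B.filter (fun b => b ∈ Ico (q.2 : ℤ) (q.2 + k))))).card ≤ hh A B W * k := by
  classical
  set Bad : Finset ℤ := (Icc (0 : ℤ) W \ A).image (fun a => x - a) ∪ (Icc (0 : ℤ) W \ B) with hBad
  have hBc : Bad.card ≤ hh A B W :=
    (Finset.card_union_le _ _).trans (Nat.add_le_add_right Finset.card_image_le _)
  have hk' : (0 : ℤ) < k := by exact_mod_cast hk
  set j : ℕ × ℕ → ℤ := fun q => q.2 + (x - q.1 - q.2) % k with hj
  have hj1 : ∀ q, (q.2 : ℤ) ≤ j q ∧ j q < q.2 + k ∧ (x - j q) % k = (q.1 : ℤ) % k := by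
    intro q
    have h1 := Int.emod_nonneg (x - q.1 - q.2) hk'.ne'
    have h2 := Int.emod_lt_of_pos (x - q.1 - q.2) hk'
    refine ⟨by simp only [hj]; omega, by simp only [hj]; omega, ?_⟩
    have h3 := Int.emod_add_mul_ediv (x - q.1 - q.2) k
    have : x - j q = q.1 + k * ((x - q.1 - q.2) / k) := by simp only [hj]; linarith
    rw [this, Int.add_mul_emod_self_left]
  have : ((range k ×ˢ Ico V (2 * V)).filter (fun q : ℕ × ℕ =>
      x ∉ (A.filter (fun a => a ∈ Icc (0 : ℤ) W ∧ a % k = q.1)) +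
        (B.filter (fun b => b ∈ Ico (q.2 : ℤ) (q.2 + k))))).card ≤ (Bad ×ˢ Ico (0 : ℤ) k).card := by
    apply Finset.card_le_card_of_injOn (fun q => (j q, j q - q.2))
    · intro q hq
      simp only [coe_filter, mem_product, mem_range, mem_Ico, Set.mem_ofPred_eq] at hq
      obtain ⟨⟨hq1, hq2, hq3⟩, hq4⟩ := hq
      obtain ⟨h1, h2, h3⟩ := hj1 q
      simp only [coe_product, Set.mem_prod, mem_coe, mem_Ico]
      refine ⟨?_, by omega, by omega⟩
      by_contra hb
      simp only [hBad, mem_union, mem_image, mem_sdiff, not_or, mem_Icc, not_exists, not_and, not_not] at hb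
      apply hq4
      rw [Finset.mem_add]
      have h4 : x - j q ∈ A := by
        by_contra h5
        exact hb.1 (x - j q) ⟨by omega, h5⟩ (by omega)
      have h6 : j q ∈ B := hb.2 ⟨by omega, by omega⟩
      refine ⟨x - j q, ?_, j q, ?_, by omega⟩
      · rw [mem_filter, mem_Icc]
        refine ⟨h4, by omega, ?_⟩
        rw [h3]
        exact Int.emod_eq_of_lt (by omega) (by exact_mod_cast hq1)
      · rw [mem_filter]; exact ⟨h6, h1, h2⟩
    · intro q hq q' hq' h
      simp only [coe_filter, mem_product, mem_range, mem_Ico, Set.mem_ofPred_eq] at hq hq'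
      simp only [Prod.mk.injEq] at h
      obtain ⟨h1, h2⟩ := h
      have e3 := (hj1 q).2.2
      have e3' := (hj1 q').2.2
      rw [h1, e3'] at e3
      rw [Int.emod_eq_of_lt (by omega) (by exact_mod_cast hq'.1.1),
        Int.emod_eq_of_lt (by omega) (by exact_mod_cast hq.1.1)] at e3
      ext
      · exact_mod_cast e3.symm
      · have : (q.2 : ℤ) = q'.2 := by omega
        exact_mod_cast this
  rw [Finset.card_product] at this
  simp only [Int.card_Ico, sub_zero, Int.toNat_natCast] at this
  exact this.trans (Nat.mul_le_mul_right _ hBc)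

lemma cover1 (A B X : Finset ℤ) (W k V : ℕ) (hk : 0 < k) (hkW : W < k ^ 2) (hV : 0 < V)
    (hX : ∀ x ∈ X, (2 * V + k : ℤ) ≤ x ∧ x ≤ W + V) (hW : 2 * V + k ≤ W + 1) :
    ∃ A' ⊆ A, ∃ B' ⊆ B, A'.card ≤ k ∧ B'.card ≤ k ∧
      (X \ (A' + B')).card * V ≤ hh A B W * X.card := by
  classical
  set Aq : ℕ × ℕ → Finset ℤ := fun q => A.filter (fun a => a ∈ Icc (0 : ℤ) W ∧ a % k = q.1) with hAq
  set Bq : ℕ × ℕ → Finset ℤ := fun q => B.filter (fun b => b ∈ Ico (q.2 : ℤ) (q.2 + k)) with hBq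
  set Q := range k ×ˢ Ico V (2 * V) with hQ
  have hQc : Q.card = k * V := by
    rw [hQ, Finset.card_product, Finset.card_range, Nat.card_Ico]; congr 1; omega
  have hsum : ∑ q ∈ Q, (X \ (Aq q + Bq q)).card ≤ X.card * (hh A B W * k) := by
    have : ∀ q, (X \ (Aq q + Bq q)).card = ∑ x ∈ X, if x ∉ Aq q + Bq q then 1 else 0 := by
      intro q
      rw [← Finset.card_filter]
      congr 1
      ext x; simp [mem_sdiff]
    rw [Finset.sum_congr rfl (fun q _ => this q), Finset.sum_comm]
    rw [← smul_eq_mul]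
    apply Finset.sum_le_card_nsmul
    intro x hx
    rw [← Finset.card_filter]
    exact cover_fix A B x W k V hk (hX x hx) hW
  have hQne : Q.Nonempty := by
    rw [← Finset.card_pos, hQc]; positivity
  obtain ⟨q, hq, hmin⟩ := Finset.exists_min_image Q (fun q => (X \ (Aq q + Bq q)).card) hQne
  have h1 : Q.card • (X \ (Aq q + Bq q)).card ≤ ∑ q ∈ Q, (X \ (Aq q + Bq q)).card :=
    Finset.card_nsmul_le_sum _ _ _ hmin
  rw [hQc, smul_eq_mul] at h1
  refine ⟨Aq q, Finset.filter_subset _ _, Bq q, Finset.filter_subset _ _, ?_, ?_, ?_⟩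
  · have : (Aq q).card ≤ (Ico (0 : ℤ) k).card := by
      apply Finset.card_le_card_of_injOn (fun a : ℤ => a / (k : ℤ))
      · intro a ha
        simp only [hAq, coe_filter, mem_Icc, Set.mem_ofPred_eq] at ha
        rw [mem_coe, mem_Ico]
        constructor
        · exact Int.ediv_nonneg ha.2.1.1 (by positivity)
        · rw [Int.ediv_lt_iff_lt_mul (by exact_mod_cast hk)]
          have : (W : ℤ) < k * k := by rw [← sq]; exact_mod_cast hkW
          omega
      · intro a ha b hb h
        simp only [hAq, coe_filter, mem_Icc, Set.mem_ofPred_eq] at ha hb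
        simp only at h
        rw [← Int.emod_add_mul_ediv a k, ← Int.emod_add_mul_ediv b k, h, ha.2.2, hb.2.2]
    simpa using this
  · have : (Bq q).card ≤ (Ico (q.2 : ℤ) (q.2 + k)).card := by
      apply Finset.card_le_card
      intro b hb
      exact (Finset.mem_filter.mp hb).2
    simpa using this
  · have : k * ((X \ (Aq q + Bq q)).card * V) ≤ k * (hh A B W * X.card) := by
      calc _ = k * V * (X \ (Aq q + Bq q)).card := by ring
        _ ≤ _ := h1.trans hsum
        _ = _ := by ring
    exact Nat.le_of_mul_le_mul_left this hk

lemma cover2 (A B X : Finset ℤ) (W k V : ℕ) (hk : 0 < k) (hkW : W < k ^ 2) (hV : 0 < V)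
    (hX : ∀ x ∈ X, (2 * V + k : ℤ) ≤ x ∧ x ≤ W + V) (hW : 2 * V + k ≤ W + 1) :
    ∃ A' ⊆ A, ∃ B' ⊆ B, A'.card ≤ 2 * k ∧ B'.card ≤ 2 * k ∧
      (X \ (A' + B')).card * V ^ 2 ≤ hh A B W ^ 2 * X.card := by
  classical
  obtain ⟨A1, hA1, B1, hB1, c1, c2, c3⟩ := cover1 A B X W k V hk hkW hV hX hW
  obtain ⟨A2, hA2, B2, hB2, d1, d2, d3⟩ := cover1 A B (X \ (A1 + B1)) W k V hk hkW hV
    (fun x hx => hX x (Finset.mem_sdiff.mp hx).1) hW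
  refine ⟨A1 ∪ A2, union_subset hA1 hA2, B1 ∪ B2, union_subset hB1 hB2,
    (card_union_le _ _).trans (by omega), (card_union_le _ _).trans (by omega), ?_⟩
  have hsub : X \ ((A1 ∪ A2) + (B1 ∪ B2)) ⊆ (X \ (A1 + B1)) \ (A2 + B2) := by
    intro x hx
    simp only [mem_sdiff] at hx ⊢
    exact ⟨⟨hx.1, fun h => hx.2 (Finset.add_subset_add subset_union_left subset_union_left h)⟩,
      fun h => hx.2 (Finset.add_subset_add subset_union_right subset_union_right h)⟩
  calc _ ≤ ((X \ (A1 + B1)) \ (A2 + B2)).card * V ^ 2 := Nat.mul_le_mul_right _ (card_le_card hsub)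
    _ = (((X \ (A1 + B1)) \ (A2 + B2)).card * V) * V := by ring
    _ ≤ (hh A B W * (X \ (A1 + B1)).card) * V := Nat.mul_le_mul_right _ d3
    _ = hh A B W * ((X \ (A1 + B1)).card * V) := by ring
    _ ≤ hh A B W * (hh A B W * X.card) := Nat.mul_le_mul_left _ c3
    _ = _ := by ring

lemma hh_mono (A B : Finset ℤ) {W W' : ℕ} (h : W' ≤ W) : hh A B W' ≤ hh A B W := by
  unfold hh
  have : Icc (0 : ℤ) W' ⊆ Icc (0 : ℤ) W := Finset.Icc_subset_Icc le_rfl (by exact_mod_cast h)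
  exact Nat.add_le_add (card_le_card (sdiff_subset_sdiff this subset_rfl))
    (card_le_card (sdiff_subset_sdiff this subset_rfl))

lemma pot_step (h h' W : ℝ) (hW : 0 < W) (h1 : 1024 * h ≤ W) (h2 : h' ≤ h) :
    h' / 4 - 128 * h' ^ 2 / W + 64 * h ^ 2 / W ≤ h / 4 - 64 * h ^ 2 / W := by
  have : 128 * (h ^ 2 - h' ^ 2) / W ≤ (h - h') / 4 := by
    rw [div_le_iff₀ hW]
    have e1 : 512 * (h + h') ≤ W := by linarith
    have e2 : (h - h') * (512 * (h + h')) ≤ (h - h') * W := by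
      apply mul_le_mul_of_nonneg_left e1; linarith
    nlinarith
  have e : 128 * (h ^ 2 - h' ^ 2) / W = 64 * h ^ 2 / W + 64 * h ^ 2 / W - 128 * h' ^ 2 / W := by ring
  linarith

lemma multi (A B : Finset ℤ) (L : ℕ) (hκ : ∀ W ≤ L, 1024 * hh A B W ≤ W) :
    ∀ W ≤ L, ∃ A' ⊆ A, ∃ B' ⊆ B, (A'.card : ℝ) ≤ 16 * Real.sqrt W ∧ (B'.card : ℝ) ≤ 16 * Real.sqrt W ∧
      ((Icc (0 : ℤ) (9 * W / 8 : ℕ) \ (A' + B')).card : ℝ) ≤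
        (hh A B W : ℝ) / 4 - 64 * (hh A B W : ℝ) ^ 2 / W + 300 := by
  intro W
  induction W using Nat.strong_induction_on with
  | _ W ih =>
  intro hWL
  have hκW : 1024 * (hh A B W : ℝ) ≤ W := by exact_mod_cast hκ W hWL
  by_cases hW : W < 256
  · refine ⟨∅, empty_subset _, ∅, empty_subset _, by simp, by simp, ?_⟩
    simp only [empty_add, sdiff_empty, Int.card_Icc]
    have h0 : hh A B W = 0 := by have := hκ W hWL; omega
    rw [h0]
    have : ((9 * W / 8 : ℕ) + 1 - 0 : ℤ).toNat ≤ 300 := by omega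
    have : ((((9 * W / 8 : ℕ) : ℤ) + 1 - 0).toNat : ℝ) ≤ 300 := by exact_mod_cast this
    simpa using this
  push Not at hW
  obtain ⟨A1, hA1, B1, hB1, c1, c2, c3⟩ := ih (W / 2) (by omega) (by omega)
  set k := Nat.sqrt W + 1 with hk
  set V := (W + 7) / 8 with hV
  have hs1 : Nat.sqrt W * Nat.sqrt W ≤ W := Nat.sqrt_le W
  have hs2 : 16 ≤ Nat.sqrt W := by rw [Nat.le_sqrt]; omega
  have hs3 : 16 * Nat.sqrt W ≤ W := by nlinarith
  set X := Icc ((9 * (W / 2) / 8 : ℕ) + 1 : ℤ) (9 * W / 8 : ℕ) with hX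
  have hXc : X.card ≤ W := by
    rw [hX, Int.card_Icc]; omega
  obtain ⟨A2, hA2, B2, hB2, d1, d2, d3⟩ := cover2 A B X W k V (by omega)
    (by rw [hk, sq]; exact Nat.lt_succ_sqrt W) (by omega)
    (by
      intro x hx
      rw [hX, mem_Icc] at hx
      constructor
      · omega
      · omega)
    (by omega)
  have hWr : (256 : ℝ) ≤ W := by exact_mod_cast hW
  have hsq1 : (Nat.sqrt W : ℝ) ≤ Real.sqrt W := Real.nat_sqrt_le_real_sqrt
  have hsq2 : (16 : ℝ) ≤ Real.sqrt W := by
    apply Real.le_sqrt_of_sq_le; linarith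
  have hkr : 2 * (k : ℝ) ≤ 17 / 8 * Real.sqrt W := by
    rw [hk]; push_cast; linarith
  have hhalf : Real.sqrt ((W / 2 : ℕ) : ℝ) ≤ 3 / 4 * Real.sqrt W := by
    rw [Real.sqrt_le_left (by positivity)]
    rw [mul_pow, Real.sq_sqrt (by positivity)]
    have : ((W / 2 : ℕ) : ℝ) ≤ W / 2 := Nat.cast_div_le
    linarith
  have d1' : (A2.card : ℝ) ≤ 2 * k := by exact_mod_cast d1
  have d2' : (B2.card : ℝ) ≤ 2 * k := by exact_mod_cast d2
  have u1 : ((A1 ∪ A2).card : ℝ) ≤ A1.card + A2.card := by exact_mod_cast card_union_le _ _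
  have u2 : ((B1 ∪ B2).card : ℝ) ≤ B1.card + B2.card := by exact_mod_cast card_union_le _ _
  refine ⟨A1 ∪ A2, union_subset hA1 hA2, B1 ∪ B2, union_subset hB1 hB2, by linarith, by linarith, ?_⟩
  have hsub : Icc (0 : ℤ) (9 * W / 8 : ℕ) \ ((A1 ∪ A2) + (B1 ∪ B2)) ⊆
      (Icc (0 : ℤ) (9 * (W / 2) / 8 : ℕ) \ (A1 + B1)) ∪ (X \ (A2 + B2)) := by
    intro x hx
    simp only [mem_sdiff, mem_Icc] at hx
    have n1 : x ∉ A1 + B1 := fun h => hx.2 (Finset.add_subset_add subset_union_left subset_union_left h)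
    have n2 : x ∉ A2 + B2 := fun h => hx.2 (Finset.add_subset_add subset_union_right subset_union_right h)
    simp only [mem_union, mem_sdiff, hX, mem_Icc]
    by_cases hh : x ≤ (9 * (W / 2) / 8 : ℕ)
    · left; exact ⟨⟨hx.1.1, hh⟩, n1⟩
    · right; exact ⟨⟨by omega, hx.1.2⟩, n2⟩
  have hc : ((Icc (0 : ℤ) (9 * W / 8 : ℕ) \ ((A1 ∪ A2) + (B1 ∪ B2))).card : ℝ) ≤
      (Icc (0 : ℤ) (9 * (W / 2) / 8 : ℕ) \ (A1 + B1)).card + (X \ (A2 + B2)).card := by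
    exact_mod_cast (card_le_card hsub).trans (card_union_le _ _)
  have hloss : ((X \ (A2 + B2)).card : ℝ) ≤ 64 * (hh A B W : ℝ) ^ 2 / W := by
    rw [le_div_iff₀ (by linarith)]
    have e1 : ((X \ (A2 + B2)).card : ℝ) * V ^ 2 ≤ (hh A B W : ℝ) ^ 2 * X.card := by exact_mod_cast d3
    have e2 : (X.card : ℝ) ≤ W := by exact_mod_cast hXc
    have e3 : (W : ℝ) ≤ 8 * V := by
      have : W ≤ 8 * V := by omega
      exact_mod_cast this
    have e4 : (W : ℝ) ^ 2 ≤ 64 * V ^ 2 := by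
      calc (W : ℝ) ^ 2 ≤ (8 * V) ^ 2 := by gcongr
        _ = _ := by ring
    have e5 : ((X \ (A2 + B2)).card : ℝ) * W ^ 2 ≤ 64 * (hh A B W : ℝ) ^ 2 * W := by
      calc ((X \ (A2 + B2)).card : ℝ) * W ^ 2 ≤ ((X \ (A2 + B2)).card : ℝ) * (64 * (V : ℝ) ^ 2) := by gcongr
        _ = 64 * (((X \ (A2 + B2)).card : ℝ) * (V : ℝ) ^ 2) := by ring
        _ ≤ 64 * ((hh A B W : ℝ) ^ 2 * X.card) := by gcongr
        _ ≤ 64 * ((hh A B W : ℝ) ^ 2 * W) := by gcongr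
        _ = _ := by ring
    have : ((X \ (A2 + B2)).card : ℝ) * W * W ≤ 64 * (hh A B W : ℝ) ^ 2 * W := by
      calc _ = ((X \ (A2 + B2)).card : ℝ) * W ^ 2 := by ring
        _ ≤ _ := e5
    exact le_of_mul_le_mul_right this (by linarith)
  have hpot := pot_step (hh A B W) (hh A B (W / 2)) W (by linarith) hκW
    (by exact_mod_cast hh_mono A B (by omega))
  have hdiv : 128 * (hh A B (W / 2) : ℝ) ^ 2 / W ≤ 64 * (hh A B (W / 2) : ℝ) ^ 2 / ((W / 2 : ℕ) : ℝ) := by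
    have e1 : ((W / 2 : ℕ) : ℝ) ≤ W / 2 := Nat.cast_div_le
    have e0 : (0 : ℝ) < ((W / 2 : ℕ) : ℝ) := by
      have : 0 < W / 2 := by omega
      exact_mod_cast this
    calc _ = 64 * (hh A B (W / 2) : ℝ) ^ 2 / (W / 2) := by field_simp; ring
      _ ≤ _ := by gcongr
  linarith


lemma enum_exists (A : Finset ℤ) : ∃ a : ℕ → ℤ, StrictMono a ∧ A = (range A.card).image a := by
  induction A using Finset.induction_on_max with
  | empty => exact ⟨fun i => i, Nat.strictMono_cast, by simp⟩
  | insert M s hM ih =>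
    obtain ⟨a, ha, hs⟩ := ih
    have hMs : M ∉ s := fun h => lt_irrefl _ (hM M h)
    have hval : ∀ i < s.card, a i < M := fun i hi =>
      hM _ (by rw [hs]; exact mem_image_of_mem _ (mem_range.mpr hi))
    refine ⟨fun i => if i < s.card then a i else M + (i - s.card : ℤ), ?_, ?_⟩
    · apply strictMono_nat_of_lt_succ
      intro i
      by_cases h1 : i + 1 < s.card
      · simp only [h1, if_true, show i < s.card by omega]; exact ha (Nat.lt_succ_self i)
      · by_cases h2 : i < s.card
        · simp only [h1, h2, if_true, if_false]
          have := hval i h2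
          push_cast; omega
        · simp only [h1, h2, if_false]; push_cast; omega
    · rw [card_insert_of_notMem hMs, Finset.range_add_one, image_insert]
      simp only [lt_irrefl, if_false, sub_self, add_zero]
      congr 1
      conv_lhs => rw [hs]
      apply Finset.image_congr
      intro i hi
      simp only [coe_range, Set.mem_Iio] at hi
      simp [hi]

lemma smono_sub {a : ℕ → ℤ} (ha : StrictMono a) {i j : ℕ} (h : i ≤ j) : (j : ℤ) - i ≤ a j - a i := by
  induction j, h using Nat.le_induction with
  | base => simp
  | succ j _ ih =>
    have := ha (Nat.lt_succ_self j)
    push_cast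
    simp only [Nat.succ_eq_add_one] at this
    omega

lemma enum_below {a : ℕ → ℤ} (ha : StrictMono a) {A : Finset ℤ} {m : ℕ} (hA : A = (range m).image a)
    {s : ℕ} (hs : s ≤ m) : (A.filter (fun x => x < a s)).card = s := by
  have : A.filter (fun x => x < a s) = (range s).image a := by
    ext x
    simp only [hA, mem_filter, mem_image, mem_range]
    constructor
    · rintro ⟨⟨i, _, rfl⟩, h⟩
      exact ⟨i, ha.lt_iff_lt.mp h, rfl⟩
    · rintro ⟨i, hi, rfl⟩
      exact ⟨⟨i, by omega, rfl⟩, ha hi⟩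
  rw [this, card_image_of_injective _ ha.injective, card_range]

/-- counting in a window -/
lemma enum_window {a : ℕ → ℤ} (ha : StrictMono a) {A : Finset ℤ} {m : ℕ} (hA : A = (range m).image a)
    {s N : ℕ} (hN : N < m) (W : ℕ) (hW : a s + W < a N) :
    ∃ i : ℕ, s + i ≤ N ∧ a s + W < a (s + i) ∧ i ≤ W + 1 ∧
      (Icc (a s) (a s + W) \ A).card + i = W + 1 := by
  set I := Icc (a s) (a s + W) with hI
  have h1 := Finset.card_sdiff_add_card_inter I A
  have h2 : I.card = W + 1 := by rw [hI, Int.card_Icc]; omega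
  have h3 : ∀ j, (∀ i ≤ j, a (s + i) ≤ a s + W) → s + j < m → j + 1 ≤ (I ∩ A).card := by
    intro j hj hjm
    have : ((range (j + 1)).image (fun i => a (s + i))) ⊆ I ∩ A := by
      intro x hx
      simp only [mem_image, mem_range] at hx
      obtain ⟨i, hi, rfl⟩ := hx
      rw [mem_inter, hI, mem_Icc]
      refine ⟨⟨ha.monotone (by omega), hj i (by omega)⟩, ?_⟩
      rw [hA]; exact mem_image_of_mem _ (mem_range.mpr (by omega))
    have := card_le_card this
    rwa [card_image_of_injective _ (fun x y h => by have := ha.injective h; omega), card_range] at this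
  have h4 : I ∩ A ⊆ (Ico s N).image a := by
    intro x hx
    rw [mem_inter, hI, mem_Icc, hA, mem_image] at hx
    obtain ⟨⟨hx1, hx2⟩, i, _, rfl⟩ := hx
    refine mem_image_of_mem _ (mem_Ico.mpr ⟨ha.le_iff_le.mp hx1, ha.lt_iff_lt.mp (by omega)⟩)
  have hsN : s < N := ha.lt_iff_lt.mp (by omega)
  have h5 := card_le_card h4
  rw [card_image_of_injective _ ha.injective, Nat.card_Ico] at h5
  refine ⟨(I ∩ A).card, by omega, ?_, by omega, by omega⟩
  by_contra h6
  push Not at h6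
  have := h3 (I ∩ A).card (fun i hi => (ha.monotone (by omega)).trans h6) (by omega)
  omega

lemma cut (A B : Finset ℤ) (n t : ℕ) (ht : 0 < t) (hn : 100000 * t ≤ n)
    (hA : n ≤ (A.filter (fun x => 0 ≤ x ∧ x < (n : ℤ))).card + t)
    (hB : n ≤ (B.filter (fun x => 0 ≤ x ∧ x < (n : ℤ))).card + t)
    (hA' : A.card ≤ n) (hB' : B.card ≤ n) :
    ∃ (s : ℕ) (a0 b0 : ℤ), s ≤ 9000 * t ∧ (A.filter (fun x => x < a0)).card = s ∧
      (B.filter (fun x => x < b0)).card = s ∧ 0 ≤ a0 ∧ a0 ≤ 9000 * t ∧ 0 ≤ b0 ∧ b0 ≤ 9000 * t ∧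
      ∀ W : ℕ, W + 10000 * t ≤ n →
        1024 * ((Icc a0 (a0 + W) \ A).card + (Icc b0 (b0 + W) \ B).card) ≤ W := by
  obtain ⟨a, ha, hAa⟩ := enum_exists A
  obtain ⟨b, hb, hBb⟩ := enum_exists B
  -- endpoint facts for one set
  have ends : ∀ (A : Finset ℤ) (a : ℕ → ℤ), StrictMono a → A = (range A.card).image a →
      n ≤ (A.filter (fun x => 0 ≤ x ∧ x < (n : ℤ))).card + t → A.card ≤ n →
      n ≤ A.card + t ∧ 0 ≤ a t ∧ a (n - t - 1) < n := by
    intro A a ha hAa hA hA'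
    have hc : n ≤ A.card + t := hA.trans (Nat.add_le_add_right (card_filter_le _ _) _)
    refine ⟨hc, ?_, ?_⟩
    · by_contra h
      push Not at h
      have e1 := enum_below ha hAa (s := t + 1) (by omega)
      have e2 : (A.filter (fun x => x < a (t + 1))).card + 0 ≤ A.card := by
        simpa using card_filter_le _ _
      have e3 : A.filter (fun x => 0 ≤ x ∧ x < (n : ℤ)) ⊆ A \ ((range (t + 1)).image a) := by
        intro x hx
        rw [mem_filter] at hx
        rw [mem_sdiff]
        refine ⟨hx.1, fun hx' => ?_⟩
        rw [mem_image] at hx'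
        obtain ⟨i, hi, rfl⟩ := hx'
        rw [mem_range] at hi
        have := ha.monotone (show i ≤ t by omega)
        omega
      have e4 := card_le_card e3
      have e5 : (range (t + 1)).image a ⊆ A := by
        conv_rhs => rw [hAa]
        exact image_subset_image (range_subset_range.mpr (by omega))
      rw [card_sdiff_of_subset e5, card_image_of_injective _ ha.injective, card_range] at e4
      omega
    · by_contra h
      push Not at h
      have e1 := enum_below ha hAa (s := n - t - 1) (by omega)
      have e2 : A.filter (fun x => 0 ≤ x ∧ x < (n : ℤ)) ⊆ A.filter (fun x => x < a (n - t - 1)) := by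
        intro x hx
        rw [mem_filter] at hx ⊢
        exact ⟨hx.1, by omega⟩
      have := card_le_card e2
      omega
  obtain ⟨cA, aA, bA⟩ := ends A a ha hAa hA hA'
  obtain ⟨cB, aB, bB⟩ := ends B b hb hBb hB hB'
  obtain ⟨N, hN⟩ : ∃ N, N = n - t - 1 := ⟨_, rfl⟩
  rw [← hN] at bA bB
  obtain ⟨s, hs, hmax⟩ := Finset.exists_max_image (Icc t N)
    (fun i => 2048 * (a i + b i - 2 * i) - (i : ℤ)) ⟨t, mem_Icc.mpr ⟨le_rfl, by omega⟩⟩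
  rw [mem_Icc] at hs
  have m1 := hmax t (mem_Icc.mpr ⟨le_rfl, by omega⟩)
  have d1 := smono_sub ha hs.2
  have d2 := smono_sub hb hs.2
  have d3 := smono_sub ha hs.1
  have d4 := smono_sub hb hs.1
  have d5 := smono_sub ha (show t ≤ N by omega)
  have d6 := smono_sub hb (show t ≤ N by omega)
  have hs9 : s ≤ 8200 * t := by omega
  refine ⟨s, a s, b s, by omega, enum_below ha hAa (by omega), enum_below hb hBb (by omega),
    by omega, by omega, by omega, by omega, ?_⟩
  intro W hW
  obtain ⟨i, i1, i2, i3, i4⟩ := enum_window ha hAa (s := s) (N := N) (by omega) W (by omega)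
  obtain ⟨j, j1, j2, j3, j4⟩ := enum_window hb hBb (s := s) (N := N) (by omega) W (by omega)
  rcases le_total i j with hij | hij
  · have m2 := hmax (s + i) (mem_Icc.mpr ⟨by omega, i1⟩)
    have d7 := smono_sub hb (show s ≤ s + i by omega)
    push_cast at m2 d7
    omega
  · have m2 := hmax (s + j) (mem_Icc.mpr ⟨by omega, j1⟩)
    have d7 := smono_sub ha (show s ≤ s + j by omega)
    push_cast at m2 d7
    omega

lemma hole_shift (A : Finset ℤ) (a0 : ℤ) (W : ℕ) :
    (Icc (0 : ℤ) W \ A.image (· - a0)).card = (Icc a0 (a0 + W) \ A).card := by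
  rw [← card_image_of_injective (Icc a0 (a0 + W) \ A) (sub_left_injective (b := a0))]
  congr 1
  ext x
  simp only [mem_sdiff, mem_Icc, mem_image]
  constructor
  · rintro ⟨h, h2⟩
    exact ⟨x + a0, ⟨by omega, fun h3 => h2 ⟨_, h3, by omega⟩⟩, by omega⟩
  · rintro ⟨y, ⟨h1, h2⟩, rfl⟩
    exact ⟨by omega, fun ⟨z, hz, hz2⟩ => h2 (by rwa [show y = z by omega])⟩

lemma multi_shift (A B : Finset ℤ) (a0 b0 : ℤ) (L : ℕ)
    (hκ : ∀ W ≤ L, 1024 * ((Icc a0 (a0 + W) \ A).card + (Icc b0 (b0 + W) \ B).card) ≤ W) :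
    ∃ A' ⊆ A, ∃ B' ⊆ B, (A'.card : ℝ) ≤ 16 * Real.sqrt L ∧ (B'.card : ℝ) ≤ 16 * Real.sqrt L ∧
      ((Icc (a0 + b0) (a0 + b0 + (9 * L / 8 : ℕ)) \ (A' + B')).card : ℝ) ≤
        (((Icc a0 (a0 + L) \ A).card + (Icc b0 (b0 + L) \ B).card : ℕ) : ℝ) / 4 + 300 := by
  have e : ∀ W, hh (A.image (· - a0)) (B.image (· - b0)) W =
    (Icc a0 (a0 + W) \ A).card + (Icc b0 (b0 + W) \ B).card := by
    intro W; unfold hh; rw [hole_shift, hole_shift]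
  obtain ⟨A1, hA1, B1, hB1, c1, c2, c3⟩ := multi (A.image (· - a0)) (B.image (· - b0)) L
    (fun W hW => by rw [e]; exact hκ W hW) L le_rfl
  rw [e] at c3
  refine ⟨A1.image (· + a0), ?_, B1.image (· + b0), ?_, ?_, ?_, ?_⟩
  · intro x hx
    rw [mem_image] at hx
    obtain ⟨y, hy, rfl⟩ := hx
    obtain ⟨z, hz, rfl⟩ := mem_image.mp (hA1 hy)
    simpa using hz
  · intro x hx
    rw [mem_image] at hx
    obtain ⟨y, hy, rfl⟩ := hx
    obtain ⟨z, hz, rfl⟩ := mem_image.mp (hB1 hy)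
    simpa using hz
  · rwa [card_image_of_injective _ (add_left_injective a0)]
  · rwa [card_image_of_injective _ (add_left_injective b0)]
  · have h1 : Icc (a0 + b0) (a0 + b0 + (9 * L / 8 : ℕ)) \ (A1.image (· + a0) + B1.image (· + b0)) ⊆
        (Icc (0 : ℤ) (9 * L / 8 : ℕ) \ (A1 + B1)).image (· + (a0 + b0)) := by
      intro x hx
      simp only [mem_sdiff, mem_Icc] at hx
      rw [mem_image]
      refine ⟨x - (a0 + b0), ?_, by omega⟩
      rw [mem_sdiff, mem_Icc]
      refine ⟨by omega, fun h => hx.2 ?_⟩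
      rw [mem_add] at h ⊢
      obtain ⟨y, hy, z, hz, hyz⟩ := h
      exact ⟨y + a0, mem_image_of_mem _ hy, z + b0, mem_image_of_mem _ hz, by omega⟩
    have h2 : ((Icc (a0 + b0) (a0 + b0 + (9 * L / 8 : ℕ)) \
        (A1.image (· + a0) + B1.image (· + b0))).card : ℝ) ≤
        (Icc (0 : ℤ) (9 * L / 8 : ℕ) \ (A1 + B1)).card := by
      exact_mod_cast (card_le_card h1).trans card_image_le
    have h3 : 0 ≤ 64 * ((((Icc a0 (a0 + L) \ A).card + (Icc b0 (b0 + L) \ B).card : ℕ) : ℝ)) ^ 2 / L := by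
      positivity
    linarith

lemma left_part (A B : Finset ℤ) (n t L : ℕ) (ht : 0 < t) (hn : 100000 * t ≤ n)
    (hA : n ≤ (A.filter (fun x => 0 ≤ x ∧ x < (n : ℤ))).card + t)
    (hB : n ≤ (B.filter (fun x => 0 ≤ x ∧ x < (n : ℤ))).card + t)
    (hA' : A.card ≤ n) (hB' : B.card ≤ n) (hL : L + 20000 * t = n) :
    ∃ (s : ℕ) (a0 b0 : ℤ), s ≤ 9000 * t ∧ (A.filter (fun x => x < a0)).card = s ∧
      (B.filter (fun x => x < b0)).card = s ∧ 0 ≤ a0 ∧ a0 ≤ 9000 * t ∧ 0 ≤ b0 ∧ b0 ≤ 9000 * t ∧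
      ∃ A' ⊆ A, ∃ B' ⊆ B, (A'.card : ℝ) ≤ 16 * Real.sqrt L ∧ (B'.card : ℝ) ≤ 16 * Real.sqrt L ∧
      ((Icc (a0 + b0) (a0 + b0 + (9 * L / 8 : ℕ)) \ (A' + B')).card : ℝ) ≤
        (((Icc a0 (a0 + L) \ A).card + (Icc b0 (b0 + L) \ B).card : ℕ) : ℝ) / 4 + 300 := by
  obtain ⟨s, a0, b0, h1, h2, h3, h4, h5, h6, h7, h8⟩ := cut A B n t ht hn hA hB hA' hB'
  exact ⟨s, a0, b0, h1, h2, h3, h4, h5, h6, h7,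
    multi_shift A B a0 b0 L (fun W hW => h8 W (by omega))⟩


def rfl' (c : ℤ) (A : Finset ℤ) : Finset ℤ := A.image (fun x => c - x)

lemma mem_rfl' {c : ℤ} {A : Finset ℤ} {x : ℤ} : x ∈ rfl' c A ↔ c - x ∈ A := by
  unfold rfl'
  rw [mem_image]
  constructor
  · rintro ⟨y, hy, rfl⟩
    simpa using hy
  · intro h
    exact ⟨_, h, by omega⟩

lemma card_rfl' (c : ℤ) (A : Finset ℤ) : (rfl' c A).card = A.card :=
  card_image_of_injective _ (sub_right_injective)

lemma rfl'_add (c d : ℤ) (A B : Finset ℤ) (x : ℤ) :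
    x ∈ rfl' c A + rfl' d B ↔ c + d - x ∈ A + B := by
  rw [mem_add, mem_add]
  constructor
  · rintro ⟨y, hy, z, hz, rfl⟩
    exact ⟨_, mem_rfl'.mp hy, _, mem_rfl'.mp hz, by omega⟩
  · rintro ⟨y, hy, z, hz, h⟩
    exact ⟨c - y, by rw [mem_rfl']; simpa using hy, d - z, by rw [mem_rfl']; simpa using hz, by omega⟩

lemma right_part (A B : Finset ℤ) (n t L : ℕ) (ht : 0 < t) (hn : 100000 * t ≤ n)
    (hA : n ≤ (A.filter (fun x => 0 ≤ x ∧ x < (n : ℤ))).card + t)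
    (hB : n ≤ (B.filter (fun x => 0 ≤ x ∧ x < (n : ℤ))).card + t)
    (hA' : A.card ≤ n) (hB' : B.card ≤ n) (hL : L + 20000 * t = n) :
    ∃ (s : ℕ) (a0 b0 : ℤ), s ≤ 9000 * t ∧ (A.filter (fun x => a0 < x)).card = s ∧
      (B.filter (fun x => b0 < x)).card = s ∧ a0 ≤ n - 1 ∧ n - 1 ≤ a0 + 9000 * t ∧
      b0 ≤ n - 1 ∧ n - 1 ≤ b0 + 9000 * t ∧
      ∃ A' ⊆ A, ∃ B' ⊆ B, (A'.card : ℝ) ≤ 16 * Real.sqrt L ∧ (B'.card : ℝ) ≤ 16 * Real.sqrt L ∧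
      ((Icc (a0 + b0 - (9 * L / 8 : ℕ)) (a0 + b0) \ (A' + B')).card : ℝ) ≤
        (((Icc (a0 - L) a0 \ A).card + (Icc (b0 - L) b0 \ B).card : ℕ) : ℝ) / 4 + 300 := by
  have k1 : ∀ C : Finset ℤ, (C.filter (fun x => 0 ≤ x ∧ x < (n : ℤ))).card =
      ((rfl' (n - 1) C).filter (fun x => 0 ≤ x ∧ x < (n : ℤ))).card := by
    intro C
    rw [← card_rfl' (n - 1)]
    congr 1
    ext x
    simp only [mem_rfl', mem_filter]
    constructor
    · rintro ⟨h1, h2, h3⟩; exact ⟨h1, by omega, by omega⟩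
    · rintro ⟨h1, h2, h3⟩; exact ⟨h1, by omega, by omega⟩
  have k2 : ∀ (C : Finset ℤ) (a0 : ℤ), (C.filter (fun x => (n - 1 - a0 : ℤ) < x)).card =
      ((rfl' (n - 1) C).filter (fun x => x < a0)).card := by
    intro C a0
    rw [← card_rfl' (n - 1)]
    congr 1
    ext x
    simp only [mem_rfl', mem_filter]
    constructor
    · rintro ⟨h1, h2⟩; exact ⟨h1, by omega⟩
    · rintro ⟨h1, h2⟩; exact ⟨h1, by omega⟩
  have k3 : ∀ (C : Finset ℤ) (a0 : ℤ), (Icc (n - 1 - a0 - L : ℤ) (n - 1 - a0) \ C).card =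
      (Icc a0 (a0 + L) \ rfl' (n - 1) C).card := by
    intro C a0
    rw [← card_rfl' (n - 1)]
    congr 1
    ext x
    simp only [mem_rfl', mem_sdiff, mem_Icc]
    constructor
    · rintro ⟨h1, h2⟩; exact ⟨by omega, h2⟩
    · rintro ⟨h1, h2⟩; exact ⟨by omega, h2⟩
  rw [k1] at hA hB
  obtain ⟨s, a0, b0, h1, h2, h3, h4, h5, h6, h7, A1, hA1, B1, hB1, c1, c2, c3⟩ :=
    left_part (rfl' (n - 1) A) (rfl' (n - 1) B) n t L ht hn hA hB (by rwa [card_rfl'])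
      (by rwa [card_rfl']) hL
  refine ⟨s, n - 1 - a0, n - 1 - b0, h1, by rw [k2, h2], by rw [k2, h3], by omega, by omega,
    by omega, by omega, rfl' (n - 1) A1, ?_, rfl' (n - 1) B1, ?_, by rwa [card_rfl'],
    by rwa [card_rfl'], ?_⟩
  · intro x hx
    have := hA1 (mem_rfl'.mp hx)
    rw [mem_rfl'] at this; simpa using this
  · intro x hx
    have := hB1 (mem_rfl'.mp hx)
    rw [mem_rfl'] at this; simpa using this
  · rw [k3, k3]
    refine le_trans ?_ c3
    refine Nat.cast_le.mpr ?_
    rw [← card_rfl' (n - 1 + (n - 1))]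
    apply card_le_card
    intro x hx
    simp only [mem_rfl', mem_sdiff, mem_Icc, rfl'_add] at hx ⊢
    refine ⟨by omega, fun h => hx.2 ?_⟩
    convert h using 1
    omega

lemma int_main (A B : Finset ℤ) (n t : ℕ) (ht : 0 < t) (hn : 200000 * t ≤ n)
    (hA : n ≤ (A.filter (fun x => 0 ≤ x ∧ x < (n : ℤ))).card + t)
    (hB : n ≤ (B.filter (fun x => 0 ≤ x ∧ x < (n : ℤ))).card + t)
    (hA' : A.card ≤ n) (hB' : B.card ≤ n) :
    ∃ (s s' : ℕ) (a0 b0 a1 b1 : ℤ), s ≤ 9000 * t ∧ s' ≤ 9000 * t ∧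
      (A.filter (fun x => x < a0)).card = s ∧ (B.filter (fun x => x < b0)).card = s ∧
      (A.filter (fun x => a1 < x)).card = s' ∧ (B.filter (fun x => b1 < x)).card = s' ∧
      0 ≤ a0 ∧ 0 ≤ b0 ∧ a1 ≤ n - 1 ∧ b1 ≤ n - 1 ∧ a0 ≤ a1 ∧ b0 ≤ b1 ∧
      ∃ A' ⊆ A, ∃ B' ⊆ B, (A'.card : ℝ) ≤ 32 * Real.sqrt n ∧ (B'.card : ℝ) ≤ 32 * Real.sqrt n ∧
      A.card + B.card ≤ ((A' + B') ∩ Icc (a0 + b0) (a1 + b1)).card + 2 * s + 2 * s' + 601 := by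
  obtain ⟨L, hL⟩ : ∃ L, L + 20000 * t = n := ⟨n - 20000 * t, by omega⟩
  obtain ⟨s, a0, b0, l1, l2, l3, l4, l5, l6, l7, A1, hA1, B1, hB1, c1, c2, c3⟩ :=
    left_part A B n t L ht (by omega) hA hB hA' hB' hL
  obtain ⟨s', a1, b1, r1, r2, r3, r4, r5, r6, r7, A2, hA2, B2, hB2, d1, d2, d3⟩ :=
    right_part A B n t L ht (by omega) hA hB hA' hB' hL
  have hs : Real.sqrt L ≤ Real.sqrt n := Real.sqrt_le_sqrt (by exact_mod_cast (by omega))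
  have u1 : ((A1 ∪ A2).card : ℝ) ≤ A1.card + A2.card := by exact_mod_cast card_union_le _ _
  have u2 : ((B1 ∪ B2).card : ℝ) ≤ B1.card + B2.card := by exact_mod_cast card_union_le _ _
  refine ⟨s, s', a0, b0, a1, b1, l1, r1, l2, l3, r2, r3, l4, l6, r4, r6, by omega, by omega,
    A1 ∪ A2, union_subset hA1 hA2, B1 ∪ B2, union_subset hB1 hB2, by linarith, by linarith, ?_⟩
  set P := (A1 ∪ A2) + (B1 ∪ B2) with hP
  set I := Icc (a0 + b0) (a1 + b1) with hI
  have hsub : I \ P ⊆ (Icc (a0 + b0) (a0 + b0 + (9 * L / 8 : ℕ)) \ (A1 + B1)) ∪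
      (Icc (a1 + b1 - (9 * L / 8 : ℕ)) (a1 + b1) \ (A2 + B2)) := by
    intro x hx
    simp only [mem_sdiff, hI, mem_Icc] at hx
    have n1 : x ∉ A1 + B1 := fun h => hx.2 (Finset.add_subset_add subset_union_left subset_union_left h)
    have n2 : x ∉ A2 + B2 := fun h => hx.2 (Finset.add_subset_add subset_union_right subset_union_right h)
    simp only [mem_union, mem_sdiff, mem_Icc]
    by_cases hh : x ≤ a0 + b0 + (9 * L / 8 : ℕ)
    · left; exact ⟨⟨hx.1.1, hh⟩, n1⟩
    · right; exact ⟨⟨by omega, hx.1.2⟩, n2⟩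
  have hc : ((I \ P).card : ℝ) ≤ (Icc (a0 + b0) (a0 + b0 + (9 * L / 8 : ℕ)) \ (A1 + B1)).card +
      (Icc (a1 + b1 - (9 * L / 8 : ℕ)) (a1 + b1) \ (A2 + B2)).card := by
    exact_mod_cast (card_le_card hsub).trans (card_union_le _ _)
  have hole : ∀ (C : Finset ℤ) (x y : ℤ), x ≤ y →
      (y - x + 1 : ℤ) + (C.filter (fun z => z < x)).card + (C.filter (fun z => y < z)).card =
        C.card + (Icc x y \ C).card := by
    intro C x y hxy
    have e1 := Finset.card_sdiff_add_card_inter (Icc x y) C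
    have e2 : C.card = (C.filter (fun z => z < x)).card + (C.filter (fun z => ¬ z < x)).card :=
      (Finset.card_filter_add_card_filter_not _).symm
    have e3 : (C.filter (fun z => ¬ z < x)).card = ((C.filter (fun z => ¬ z < x)).filter (fun z => y < z)).card +
        ((C.filter (fun z => ¬ z < x)).filter (fun z => ¬ y < z)).card :=
      (Finset.card_filter_add_card_filter_not _).symm
    have e4 : (C.filter (fun z => ¬ z < x)).filter (fun z => y < z) = C.filter (fun z => y < z) := by
      ext z; simp only [mem_filter]
      constructor
      · rintro ⟨⟨h1, _⟩, h2⟩; exact ⟨h1, h2⟩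
      · rintro ⟨h1, h2⟩; exact ⟨⟨h1, by omega⟩, h2⟩
    have e5 : (C.filter (fun z => ¬ z < x)).filter (fun z => ¬ y < z) = Icc x y ∩ C := by
      ext z; simp only [mem_filter, mem_inter, mem_Icc]
      constructor
      · rintro ⟨⟨h1, _⟩, h2⟩; exact ⟨⟨by omega, by omega⟩, h1⟩
      · rintro ⟨h1, h2⟩; exact ⟨⟨h2, by omega⟩, by omega⟩
    have e6 : (Icc x y).card = (y + 1 - x).toNat := Int.card_Icc _ _
    rw [e4, e5] at e3
    omega
  have hoA := hole A a0 a1 (by omega)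
  have hoB := hole B b0 b1 (by omega)
  rw [l2, r2] at hoA
  rw [l3, r3] at hoB
  have g1 : (Icc a0 (a0 + L) \ A).card ≤ (Icc a0 a1 \ A).card :=
    card_le_card (sdiff_subset_sdiff (Icc_subset_Icc le_rfl (by omega)) subset_rfl)
  have g2 : (Icc b0 (b0 + L) \ B).card ≤ (Icc b0 b1 \ B).card :=
    card_le_card (sdiff_subset_sdiff (Icc_subset_Icc le_rfl (by omega)) subset_rfl)
  have g3 : (Icc (a1 - L) a1 \ A).card ≤ (Icc a0 a1 \ A).card :=
    card_le_card (sdiff_subset_sdiff (Icc_subset_Icc (by omega) le_rfl) subset_rfl)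
  have g4 : (Icc (b1 - L) b1 \ B).card ≤ (Icc b0 b1 \ B).card :=
    card_le_card (sdiff_subset_sdiff (Icc_subset_Icc (by omega) le_rfl) subset_rfl)
  have hI1 := Finset.card_sdiff_add_card_inter I P
  have hI2 : I.card = (a1 + b1 + 1 - (a0 + b0)).toNat := Int.card_Icc _ _
  have g1' : ((Icc a0 (a0 + L) \ A).card : ℝ) ≤ (Icc a0 a1 \ A).card := by exact_mod_cast g1
  have g2' : ((Icc b0 (b0 + L) \ B).card : ℝ) ≤ (Icc b0 b1 \ B).card := by exact_mod_cast g2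
  have g3' : ((Icc (a1 - L) a1 \ A).card : ℝ) ≤ (Icc a0 a1 \ A).card := by exact_mod_cast g3
  have g4' : ((Icc (b1 - L) b1 \ B).card : ℝ) ≤ (Icc b0 b1 \ B).card := by exact_mod_cast g4
  rw [Nat.cast_add] at c3 d3
  have hfin : 2 * ((I \ P).card : ℝ) ≤ (Icc a0 a1 \ A).card + (Icc b0 b1 \ B).card + 1200 := by
    linarith
  have hfin' : 2 * (I \ P).card ≤ (Icc a0 a1 \ A).card + (Icc b0 b1 \ B).card + 1200 := by
    exact_mod_cast hfin
  rw [inter_comm] at hI1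
  omega


def Pcl (c : ℝ) (n : ℕ) : Prop := ∀ (p : ℕ) [Fact p.Prime] (A B : Finset (ZMod p)),
  A.card = n → B.card = n → 3 * n ≤ p → ∃ A' ⊆ A, ∃ B' ⊆ B,
    (A'.card : ℝ) ≤ c * Real.sqrt n ∧ (B'.card : ℝ) ≤ c * Real.sqrt n ∧ 2 * n ≤ (A' + B').card + 1

def fL {p : ℕ} (ρ : ℕ) (x : ZMod p) : ℤ := ((x + (ρ : ZMod p)).val : ℤ) - ρ

lemma cast_fL {p : ℕ} [NeZero p] (ρ : ℕ) (x : ZMod p) : ((fL ρ x : ℤ) : ZMod p) = x := by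
  unfold fL
  push_cast
  rw [ZMod.natCast_zmod_val]; ring

lemma fL_inj {p : ℕ} [NeZero p] (ρ : ℕ) : Function.Injective (fL (p := p) ρ) := by
  intro x y h
  rw [← cast_fL ρ x, h, cast_fL]

lemma fL_of_small {p : ℕ} [NeZero p] (ρ n : ℕ) (h : n + ρ ≤ p) (x : ZMod p) (hx : x.val < n) :
    (x + (ρ : ZMod p)).val = x.val + ρ := by
  rw [ZMod.val_add, ZMod.val_natCast, Nat.add_mod_mod, Nat.mod_eq_of_lt (by omega)]

def inl {p : ℕ} (ρ n : ℕ) (C : Finset (ZMod p)) : Finset (ZMod p) :=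
  C.filter (fun x => (x + (ρ : ZMod p)).val < n + 2 * ρ)

def lft {p : ℕ} (ρ n : ℕ) (C : Finset (ZMod p)) : Finset ℤ := (inl ρ n C).image (fL ρ)

lemma card_lft {p : ℕ} [NeZero p] (ρ n : ℕ) (C : Finset (ZMod p)) :
    (lft ρ n C).card = (inl ρ n C).card := card_image_of_injective _ (fL_inj ρ)

lemma mem_lft {p : ℕ} [NeZero p] {ρ n : ℕ} {C : Finset (ZMod p)} {z : ℤ} (hz : z ∈ lft ρ n C) :
    -(ρ : ℤ) ≤ z ∧ z < n + ρ ∧ (z : ZMod p) ∈ C := by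
  unfold lft at hz
  rw [mem_image] at hz
  obtain ⟨x, hx, rfl⟩ := hz
  unfold inl at hx
  rw [mem_filter] at hx
  rw [cast_fL]
  refine ⟨?_, ?_, hx.1⟩
  · unfold fL; omega
  · unfold fL; omega

lemma lft_small {p : ℕ} [NeZero p] (ρ n : ℕ) (h : n + ρ ≤ p) (C : Finset (ZMod p)) :
    (C.filter (fun x => x.val < n)).card ≤
      ((lft ρ n C).filter (fun x => 0 ≤ x ∧ x < (n : ℤ))).card := by
  apply card_le_card_of_injOn (fL ρ)
  · intro x hx
    rw [mem_coe, mem_filter] at hx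
    have e := fL_of_small ρ n h x hx.2
    rw [mem_coe, mem_filter]
    refine ⟨?_, ?_, ?_⟩
    · apply mem_image_of_mem
      unfold inl
      rw [mem_filter, e]
      exact ⟨hx.1, by omega⟩
    · unfold fL; rw [e]; push_cast; omega
    · unfold fL; rw [e]; push_cast; omega
  · exact (fL_inj ρ).injOn

lemma cast_inj_range {p : ℕ} (ρ n : ℕ) (h : 2 * n + 4 * ρ ≤ p) (z w : ℤ)
    (hz : -(2 * ρ : ℤ) ≤ z ∧ z < 2 * n + 2 * ρ) (hw : -(2 * ρ : ℤ) ≤ w ∧ w < 2 * n + 2 * ρ)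
    (he : (z : ZMod p) = w) : z = w := by
  rw [ZMod.intCast_eq_intCast_iff_dvd_sub] at he
  have := Int.eq_zero_of_abs_lt_dvd he (by rw [abs_lt]; constructor <;> omega)
  omega

lemma to_zmod (c : ℝ) (n t : ℕ) (ht : 0 < t) (hn : 200000 * t ≤ n)
    (IH : ∀ m < n, Pcl c m) {p : ℕ} [Fact p.Prime] (A B : Finset (ZMod p))
    (hA : A.card = n) (hB : B.card = n) (hp : 3 * n ≤ p) (ρ : ℕ) (hρ : 4 * ρ ≤ n)
    (hA1 : n ≤ (A.filter (fun x => x.val < n)).card + t)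
    (hB1 : n ≤ (B.filter (fun x => x.val < n)).card + t) (hc : 0 ≤ c) :
    ∃ A0 ⊆ A, ∃ B0 ⊆ B,
      (A0.card : ℝ) ≤ 2 * (c * Real.sqrt (9000 * t)) + 32 * Real.sqrt n ∧
      (B0.card : ℝ) ≤ 2 * (c * Real.sqrt (9000 * t)) + 32 * Real.sqrt n ∧
      (inl ρ n A).card + (inl ρ n B).card ≤ (A0 + B0).card + 603 ∧
      ∃ Mid ⊆ A0 + B0, (inl ρ n A).card + (inl ρ n B).card ≤ Mid.card + 36000 * t + 601 ∧
        ∀ x ∈ Mid, ∃ z : ℤ, 0 ≤ z ∧ z < 2 * n ∧ (z : ZMod p) = x := by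
  classical
  have hpr : 2 * n + 4 * ρ ≤ p := by omega
  have hinlA : (inl ρ n A).card ≤ n := (card_filter_le _ _).trans hA.le
  have hinlB : (inl ρ n B).card ≤ n := (card_filter_le _ _).trans hB.le
  obtain ⟨s, s', a0, b0, a1, b1, s1, s2, f1, f2, f3, f4, o1, o2, o3, o4, o5, o6,
    A', hA', B', hB', c1, c2, hM⟩ := int_main (lft ρ n A) (lft ρ n B) n t ht hn
      (hA1.trans (Nat.add_le_add_right (lft_small ρ n (by omega) A) t))
      (hB1.trans (Nat.add_le_add_right (lft_small ρ n (by omega) B) t))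
      (by rwa [card_lft]) (by rwa [card_lft])
  set φ : ℤ → ZMod p := fun z => (z : ZMod p) with hφ
  have inj := cast_inj_range (p := p) ρ n hpr
  -- image of filters
  have himg : ∀ (C : Finset (ZMod p)) (D : Finset ℤ), D ⊆ lft ρ n C → (D.image φ).card = D.card ∧
      D.image φ ⊆ C := by
    intro C D hD
    constructor
    · apply card_image_of_injOn
      intro z hz w hw h
      have e1 := mem_lft (hD hz)
      have e2 := mem_lft (hD hw)
      exact inj z w (by omega) (by omega) h
    · intro x hx
      rw [mem_image] at hx
      obtain ⟨z, hz, rfl⟩ := hx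
      exact (mem_lft (hD hz)).2.2
  obtain ⟨x1, x2⟩ := himg A _ (filter_subset (fun x => x < a0) _)
  obtain ⟨x3, x4⟩ := himg B _ (filter_subset (fun x => x < b0) _)
  obtain ⟨x5, x6⟩ := himg A _ (filter_subset (fun x => a1 < x) _)
  obtain ⟨x7, x8⟩ := himg B _ (filter_subset (fun x => b1 < x) _)
  obtain ⟨x9, x10⟩ := himg A A' hA'
  obtain ⟨x11, x12⟩ := himg B B' hB'
  obtain ⟨AL, hAL, BL, hBL, l1, l2, l3⟩ := IH s (by omega) p _ _ (x1.trans f1) (x3.trans f2) (by omega)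
  obtain ⟨AR, hAR, BR, hBR, r1, r2, r3⟩ := IH s' (by omega) p _ _ (x5.trans f3) (x7.trans f4) (by omega)
  set SM := ((A' + B') ∩ Icc (a0 + b0) (a1 + b1)).image φ with hSM
  have hSMc : SM.card = ((A' + B') ∩ Icc (a0 + b0) (a1 + b1)).card := by
    apply card_image_of_injOn
    intro z hz w hw h
    rw [mem_coe, mem_inter, mem_Icc] at hz hw
    exact inj z w (by omega) (by omega) h
  have hL : ∀ x ∈ AL + BL, ∃ z : ℤ, -(2 * ρ : ℤ) ≤ z ∧ z < a0 + b0 ∧ φ z = x := by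
    intro x hx
    rw [mem_add] at hx
    obtain ⟨y, hy, w, hw, rfl⟩ := hx
    obtain ⟨y', hy', rfl⟩ := mem_image.mp (hAL hy)
    obtain ⟨w', hw', rfl⟩ := mem_image.mp (hBL hw)
    rw [mem_filter] at hy' hw'
    have e1 := mem_lft hy'.1
    have e2 := mem_lft hw'.1
    exact ⟨y' + w', by omega, by omega, by simp [hφ]⟩
  have hR : ∀ x ∈ AR + BR, ∃ z : ℤ, a1 + b1 < z ∧ z < 2 * n + 2 * ρ ∧ φ z = x := by
    intro x hx
    rw [mem_add] at hx
    obtain ⟨y, hy, w, hw, rfl⟩ := hx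
    obtain ⟨y', hy', rfl⟩ := mem_image.mp (hAR hy)
    obtain ⟨w', hw', rfl⟩ := mem_image.mp (hBR hw)
    rw [mem_filter] at hy' hw'
    have e1 := mem_lft hy'.1
    have e2 := mem_lft hw'.1
    exact ⟨y' + w', by omega, by omega, by simp [hφ]⟩
  have hMz : ∀ x ∈ SM, ∃ z : ℤ, a0 + b0 ≤ z ∧ z ≤ a1 + b1 ∧ φ z = x := by
    intro x hx
    obtain ⟨z, hz, rfl⟩ := mem_image.mp hx
    rw [mem_inter, mem_Icc] at hz
    exact ⟨z, hz.2.1, hz.2.2, rfl⟩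
  have dLM : Disjoint (AL + BL) SM := by
    rw [disjoint_left]
    intro x hx hx'
    obtain ⟨z, z1, z2, z3⟩ := hL x hx
    obtain ⟨w, w1, w2, w3⟩ := hMz x hx'
    have := inj z w (by omega) (by omega) (z3.trans w3.symm)
    omega
  have dLMR : Disjoint ((AL + BL) ∪ SM) (AR + BR) := by
    rw [disjoint_left]
    intro x hx hx'
    obtain ⟨w, w1, w2, w3⟩ := hR x hx'
    rw [mem_union] at hx
    rcases hx with hx | hx
    · obtain ⟨z, z1, z2, z3⟩ := hL x hx
      have := inj z w (by omega) (by omega) (z3.trans w3.symm)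
      omega
    · obtain ⟨z, z1, z2, z3⟩ := hMz x hx
      have := inj z w (by omega) (by omega) (z3.trans w3.symm)
      omega
  have hcard : (((AL + BL) ∪ SM) ∪ (AR + BR)).card = (AL + BL).card + SM.card + (AR + BR).card := by
    rw [card_union_of_disjoint dLMR, card_union_of_disjoint dLM]
  set A0 := (AL ∪ A'.image φ) ∪ AR with hA0
  set B0 := (BL ∪ B'.image φ) ∪ BR with hB0
  have hSMsub : SM ⊆ A0 + B0 := by
    intro x hx
    obtain ⟨z, hz, rfl⟩ := mem_image.mp hx
    have hz1 := (mem_inter.mp hz).1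
    rw [mem_add] at hz1
    obtain ⟨y, hy, w, hw, rfl⟩ := hz1
    have : φ (y + w) = φ y + φ w := by simp [hφ]
    rw [this]
    exact add_mem_add (mem_union_left _ (mem_union_right _ (mem_image_of_mem _ hy)))
      (mem_union_left _ (mem_union_right _ (mem_image_of_mem _ hw)))
  have hLsub : AL + BL ⊆ A0 + B0 :=
    add_subset_add (subset_union_left.trans subset_union_left) (subset_union_left.trans subset_union_left)
  have hRsub : AR + BR ⊆ A0 + B0 := add_subset_add subset_union_right subset_union_right
  have hall := card_le_card (union_subset (union_subset hLsub hSMsub) hRsub)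
  rw [hcard] at hall
  rw [card_lft, card_lft] at hM
  have sq1 : c * Real.sqrt s ≤ c * Real.sqrt (9000 * t) := by
    apply mul_le_mul_of_nonneg_left _ hc
    apply Real.sqrt_le_sqrt; exact_mod_cast s1
  have sq2 : c * Real.sqrt s' ≤ c * Real.sqrt (9000 * t) := by
    apply mul_le_mul_of_nonneg_left _ hc
    apply Real.sqrt_le_sqrt; exact_mod_cast s2
  have cA : (A0.card : ℝ) ≤ AL.card + A'.card + AR.card := by
    rw [← x9]
    have e1 : A0.card ≤ (AL ∪ A'.image φ).card + AR.card := card_union_le _ _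
    have e2 := card_union_le AL (A'.image φ)
    have : A0.card ≤ AL.card + (A'.image φ).card + AR.card := by omega
    exact_mod_cast this
  have cB : (B0.card : ℝ) ≤ BL.card + B'.card + BR.card := by
    rw [← x11]
    have e1 : B0.card ≤ (BL ∪ B'.image φ).card + BR.card := card_union_le _ _
    have e2 := card_union_le BL (B'.image φ)
    have : B0.card ≤ BL.card + (B'.image φ).card + BR.card := by omega
    exact_mod_cast this
  refine ⟨A0, union_subset (union_subset (hAL.trans x2) x10) (hAR.trans x6),
    B0, union_subset (union_subset (hBL.trans x4) x12) (hBR.trans x8), by linarith, by linarith,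
    by omega, SM, hSMsub, by omega, ?_⟩
  intro x hx
  obtain ⟨z, z1, z2, z3⟩ := hMz x hx
  exact ⟨z, by omega, by omega, z3⟩


lemma win_card {p : ℕ} [NeZero p] (B : Finset (ZMod p)) (n t s ρ : ℕ) (hs : s + ρ ≤ n)
    (hB : n ≤ (B.filter (fun x => x.val < n)).card + t) :
    ρ ≤ (B.filter (fun x => s ≤ x.val ∧ x.val < s + ρ)).card + t := by
  have h1 : (B.filter (fun x => x.val < n)).card ≤
      (B.filter (fun x => s ≤ x.val ∧ x.val < s + ρ)).card +
      (B.filter (fun x => x.val < n ∧ ¬ (s ≤ x.val ∧ x.val < s + ρ))).card := by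
    refine le_trans (card_le_card ?_) (card_union_le _ _)
    intro x hx
    simp only [mem_union, mem_filter] at hx ⊢
    tauto
  have h2 : (B.filter (fun x => x.val < n ∧ ¬ (s ≤ x.val ∧ x.val < s + ρ))).card ≤
      (range n \ Ico s (s + ρ)).card := by
    apply card_le_card_of_injOn ZMod.val
    · intro x hx
      rw [mem_coe, mem_filter] at hx
      rw [mem_coe, mem_sdiff, mem_range, mem_Ico]
      exact hx.2
    · exact (ZMod.val_injective p).injOn
  have h3 : (range n \ Ico s (s + ρ)).card = n - ρ := by
    rw [card_sdiff_of_subset]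
    · simp
    · intro x hx
      rw [mem_Ico] at hx
      rw [mem_range]; omega
  omega

lemma out_one {p : ℕ} [NeZero p] (B : Finset (ZMod p)) (n t ρ : ℕ) (hp : 3 * n ≤ p) (hρ : 4 * ρ ≤ n)
    (hB : n ≤ (B.filter (fun x => x.val < n)).card + t) (a : ZMod p)
    (ha : n + 2 * ρ ≤ (a + (ρ : ZMod p)).val) :
    ρ ≤ (B.filter (fun b => 2 * n ≤ (a + b).val)).card + t := by
  have hap := ZMod.val_lt a
  have hp0 : 0 < p := Nat.pos_of_ne_zero (NeZero.ne p)
  rw [ZMod.val_add, ZMod.val_natCast, Nat.add_mod_mod] at ha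
  have hlt : a.val + ρ < p := by
    by_contra hc
    rw [Nat.mod_eq_sub_mod (by omega), Nat.mod_eq_of_lt (by omega)] at ha
    omega
  rw [Nat.mod_eq_of_lt hlt] at ha
  have key : ∀ s, s + ρ ≤ n → 2 * n ≤ a.val + s → a.val + s + ρ ≤ p →
      ρ ≤ (B.filter (fun b => 2 * n ≤ (a + b).val)).card + t := by
    intro s h1 h2 h3
    refine le_trans (win_card B n t s ρ h1 hB) ?_
    apply Nat.add_le_add_right
    apply card_le_card
    intro b hb
    rw [mem_filter] at hb ⊢
    refine ⟨hb.1, ?_⟩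
    rw [ZMod.val_add, Nat.mod_eq_of_lt (by omega)]
    omega
  by_cases h : a.val ≤ p - n
  · exact key (n - ρ) (by omega) (by omega) (by omega)
  · exact key 0 (by omega) (by omega) (by omega)

lemma flow_out {p : ℕ} [NeZero p] (A B S : Finset (ZMod p)) (n t ρ D : ℕ) (hp : 3 * n ≤ p)
    (hρ : 4 * ρ ≤ n) (hA : A.card = n)
    (hB : n ≤ (B.filter (fun x => x.val < n)).card + t)
    (hD : D + t + (S.filter (fun x => 2 * n ≤ x.val)).card ≤ ρ) :
    (n - (inl ρ n A).card) * D ≤ fl A B S := by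
  rw [fl_eq_sum']
  have h1 : n - (inl ρ n A).card = (A \ inl ρ n A).card := by
    rw [card_sdiff_of_subset (show inl ρ n A ⊆ A from filter_subset _ _), hA]
  rw [h1, ← smul_eq_mul]
  refine le_trans ?_ (sum_le_sum_of_subset (sdiff_subset (s := A) (t := inl ρ n A)))
  apply card_nsmul_le_sum
  intro a ha
  rw [mem_sdiff] at ha
  unfold inl at ha
  rw [mem_filter] at ha
  have h2 := out_one B n t ρ hp hρ hB a (by by_contra hc; exact ha.2 ⟨ha.1, by omega⟩)
  have h3 : (B.filter (fun b => 2 * n ≤ (a + b).val)).card ≤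
      (B.filter (fun b => a + b ∉ S)).card + (S.filter (fun x => 2 * n ≤ x.val)).card := by
    have h4 : B.filter (fun b => 2 * n ≤ (a + b).val) ⊆ B.filter (fun b => a + b ∉ S) ∪
        (S.filter (fun x => 2 * n ≤ x.val)).image (fun x => x - a) := by
      intro b hb
      rw [mem_filter] at hb
      by_cases hs : a + b ∈ S
      · apply mem_union_right
        rw [mem_image]
        exact ⟨a + b, mem_filter.mpr ⟨hs, hb.2⟩, by ring⟩
      · apply mem_union_left
        exact mem_filter.mpr ⟨hb.1, hs⟩
    have h5 := (card_le_card h4).trans (card_union_le _ _)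
    exact h5.trans (Nat.add_le_add_left card_image_le _)
  omega

lemma inl_card {p : ℕ} [NeZero p] (A : Finset (ZMod p)) (n t ρ : ℕ) (h : n + ρ ≤ p)
    (hA : n ≤ (A.filter (fun x => x.val < n)).card + t) : n ≤ (inl ρ n A).card + t := by
  refine le_trans hA (Nat.add_le_add_right (card_le_card ?_) _)
  intro x hx
  rw [mem_filter] at hx
  unfold inl
  rw [mem_filter, fL_of_small ρ n h x hx.2]
  exact ⟨hx.1, by omega⟩

lemma out_S {p : ℕ} (S Mid : Finset (ZMod p)) (n : ℕ) (hp : 2 * n ≤ p) (hM : Mid ⊆ S)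
    (hz : ∀ x ∈ Mid, ∃ z : ℤ, 0 ≤ z ∧ z < 2 * n ∧ (z : ZMod p) = x) :
    (S.filter (fun x => 2 * n ≤ x.val)).card + Mid.card ≤ S.card := by
  rw [← card_union_of_disjoint]
  · exact card_le_card (union_subset (filter_subset _ _) hM)
  · rw [disjoint_left]
    intro x hx hx'
    obtain ⟨z, z1, z2, rfl⟩ := hz x hx'
    rw [mem_filter] at hx
    lift z to ℕ using z1
    have := hx.2
    rw [Int.cast_natCast, ZMod.val_natCast, Nat.mod_eq_of_lt (by omega)] at this
    omega

lemma struct_case (c : ℝ) (hc : 2000 ≤ c) (n t : ℕ) (ht : 0 < t) (hn : 10000000 * t ≤ n)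
    (IH : ∀ m < n, Pcl c m) {p : ℕ} [Fact p.Prime] (A B : Finset (ZMod p))
    (hA : A.card = n) (hB : B.card = n) (hp : 3 * n ≤ p)
    (hA1 : n ≤ (A.filter (fun x => x.val < n)).card + t)
    (hB1 : n ≤ (B.filter (fun x => x.val < n)).card + t) :
    ∃ A' ⊆ A, ∃ B' ⊆ B, (A'.card : ℝ) ≤ c * Real.sqrt n ∧ (B'.card : ℝ) ≤ c * Real.sqrt n ∧
      2 * n ≤ (A' + B').card + 1 := by
  obtain ⟨A0, a1, B0, b1, a2, b2, h1, Mid, m1, m2, m3⟩ :=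
    to_zmod c n t ht (by omega) IH A B hA hB hp (n / 8) (by omega) hA1 hB1 (by linarith)
  have iA := inl_card A n t (n / 8) (by omega) hA1
  have iB := inl_card B n t (n / 8) (by omega) hB1
  have iA' : (inl (n / 8) n A).card ≤ n := hA ▸ card_le_card (filter_subset _ _)
  have iB' : (inl (n / 8) n B).card ≤ n := hB ▸ card_le_card (filter_subset _ _)
  set o := (n - (inl (n / 8) n A).card) + (n - (inl (n / 8) n B).card) with ho
  set k := Nat.sqrt n + 1 with hk
  have hk2 : n ≤ k ^ 2 := by
    have := Nat.lt_succ_sqrt n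
    rw [hk, sq]; exact this.le
  have hkn : k ≤ n := by
    have h := Nat.sqrt_lt_self (n := n) (by omega)
    omega
  have hkR : (k : ℝ) ≤ Real.sqrt n + 1 := by
    rw [hk]; push_cast
    have := Real.nat_sqrt_le_real_sqrt (a := n)
    linarith
  have step : ∃ A2 ⊆ A, ∃ B2 ⊆ B, A2.card ≤ A0.card + 128 * k ∧ B2.card ≤ B0.card + 128 * k ∧
      2 * n ≤ (A2 + B2).card + 603 := by
    obtain ⟨A2, x1, B2, y1, x2, y2, x3, y3, hh⟩ := batch_iter A B A0 B0 k n ((o : ℝ) * n / 64)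
      hA hB (by omega) hkn hk2 a1 b1 128
    refine ⟨A2, x1, B2, y1, x3, y3, ?_⟩
    have hsub : A0 + B0 ⊆ A2 + B2 := add_subset_add x2 y2
    have hsc := card_le_card hsub
    rcases hh with hh | hh
    · by_contra hcon
      have hS : (A2 + B2).card ≤ 2 * n := by omega
      have hoS := out_S (A2 + B2) Mid n (by omega) (m1.trans hsub) m3
      have f1 := flow_out A B (A2 + B2) n t (n / 8) (n / 16) (by omega) (by omega) hA hB1 (by omega)
      have f2 := flow_out B A (A2 + B2) n t (n / 8) (n / 16) (by omega) (by omega) hB hA1 (by omega)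
      rw [fl_comm] at f2
      have f3 : o * (n / 16) ≤ 2 * fl A B (A2 + B2) := by
        rw [ho, add_mul]; omega
      have o1 : 0 < o := by omega
      have f4 : (o : ℝ) * ((n / 16 : ℕ) : ℝ) ≤ 2 * fl A B (A2 + B2) := by exact_mod_cast f3
      have f5 : (n : ℝ) ≤ 16 * ((n / 16 : ℕ) : ℝ) + 16 := by
        have : n ≤ 16 * (n / 16) + 16 := by omega
        exact_mod_cast this
      have o2 : (0 : ℝ) < o := by exact_mod_cast o1
      have n2 : (10000000 : ℝ) ≤ n := by
        have : 10000000 ≤ n := by omega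
        exact_mod_cast this
      have g : (0 : ℝ) < o * (2 * ((n / 16 : ℕ) : ℝ) - n / 16) := mul_pos o2 (by linarith)
      linarith
    · have hn0 : (0 : ℝ) < n := by
        have : 0 < n := by omega
        exact_mod_cast this
      have e : ((128 : ℕ) : ℝ) * ((o : ℝ) * n / 64 / (2 * n)) = o := by
        field_simp; push_cast; ring
      rw [e] at hh
      have hh' : (A0 + B0).card + o ≤ (A2 + B2).card := by exact_mod_cast hh
      omega
  obtain ⟨A2, x1, B2, y1, x3, y3, hh⟩ := step
  obtain ⟨A3, u1, B3, v1, u2, v2, hw⟩ := cd_iter A B A2 B2 n hA hB (by omega) (by omega) x1 y1 700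
  have s1 : Real.sqrt (9000 * t) ≤ Real.sqrt n / 32 := by
    rw [show Real.sqrt n / 32 = Real.sqrt (n / 1024) by
      rw [Real.sqrt_div (by positivity)]
      congr 1
      rw [show (1024 : ℝ) = 32 ^ 2 by norm_num, Real.sqrt_sq (by norm_num)]]
    apply Real.sqrt_le_sqrt
    have : (10000000 : ℝ) * t ≤ n := by exact_mod_cast hn
    have t0 : (0 : ℝ) ≤ t := by positivity
    linarith
  have s2 : 1000 ≤ Real.sqrt n := by
    apply Real.le_sqrt_of_sq_le
    have : 10000000 ≤ n := by omega
    have : (10000000 : ℝ) ≤ n := by exact_mod_cast this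
    linarith
  have fin : ∀ a0 a3 : ℕ, (a0 : ℝ) ≤ 2 * (c * Real.sqrt (9000 * t)) + 32 * Real.sqrt n →
      a3 ≤ a0 + 128 * k + 700 → (a3 : ℝ) ≤ c * Real.sqrt n := by
    intro a0 a3 g1 g2
    have g3 : (a3 : ℝ) ≤ a0 + 128 * k + 700 := by exact_mod_cast g2
    have g4 : c * Real.sqrt (9000 * t) ≤ c * (Real.sqrt n / 32) :=
      mul_le_mul_of_nonneg_left s1 (by linarith)
    have g5 : 2000 * Real.sqrt n ≤ c * Real.sqrt n :=
      mul_le_mul_of_nonneg_right hc (Real.sqrt_nonneg _)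
    linarith
  refine ⟨A3, u1, B3, v1, fin _ _ a2 (by omega), fin _ _ b2 (by omega), ?_⟩
  rcases hw with hw | hw <;> omega


lemma transport {p : ℕ} [Fact p.Prime] (A B : Finset (ZMod p)) (u α β : ZMod p) (hu : u ≠ 0)
    (A1 B1 : Finset (ZMod p)) (hA : A1 ⊆ A.image (fun x => u * x - α))
    (hB : B1 ⊆ B.image (fun x => u * x - β)) :
    ∃ A' ⊆ A, ∃ B' ⊆ B, A'.card = A1.card ∧ B'.card = B1.card ∧
      (A1 + B1).card ≤ (A' + B').card := by
  obtain ⟨A', a1, a2⟩ := Finset.subset_image_iff.mp hA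
  obtain ⟨B', b1, b2⟩ := Finset.subset_image_iff.mp hB
  have inj : ∀ γ : ZMod p, Function.Injective (fun x => u * x - γ) := by
    intro γ x y h
    simpa [hu] using h
  refine ⟨A', by exact_mod_cast a1, B', by exact_mod_cast b1, ?_, ?_, ?_⟩
  · rw [← a2, card_image_of_injective _ (inj α)]
  · rw [← b2, card_image_of_injective _ (inj β)]
  · refine le_trans (card_le_card ?_) (card_image_le (f := fun x => u * x - (α + β)))
    intro x hx
    rw [← a2, ← b2, mem_add] at hx
    obtain ⟨y, hy, z, hz, rfl⟩ := hx
    obtain ⟨y', hy', rfl⟩ := mem_image.mp hy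
    obtain ⟨z', hz', rfl⟩ := mem_image.mp hz
    rw [mem_image]
    exact ⟨y' + z', add_mem_add hy' hz', by ring⟩

lemma shift_filter {p : ℕ} (A : Finset (ZMod p)) (u α : ZMod p) (n : ℕ) :
    ((A.image (u * ·)).filter (fun x => (x - α).val < n)).card ≤
      ((A.image (fun x => u * x - α)).filter (fun x => x.val < n)).card := by
  apply card_le_card_of_injOn (fun x => x - α)
  · intro x hx
    rw [mem_coe, mem_filter] at hx
    obtain ⟨h1, h2⟩ := hx
    obtain ⟨y, hy, rfl⟩ := mem_image.mp h1
    rw [mem_coe, mem_filter]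
    exact ⟨mem_image_of_mem (fun x => u * x - α) hy, h2⟩
  · intro x _ y _ h
    simpa using h

lemma small_case (c : ℝ) (n : ℕ) (hc : (n : ℝ) ≤ c) : Pcl c n := by
  intro p _ A B hA hB hp
  have hs : (n : ℝ) ≤ c * Real.sqrt n := by
    rcases Nat.eq_zero_or_pos n with h | h
    · subst h; simp
    · have h1 : 1 ≤ Real.sqrt n := by
        rw [Real.one_le_sqrt]; exact_mod_cast h
      have h2 : (0 : ℝ) ≤ n := by positivity
      nlinarith
  rcases Nat.eq_zero_or_pos n with h | h
  · exact ⟨A, Subset.rfl, B, Subset.rfl, by rwa [hA], by rwa [hB], by omega⟩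
  · refine ⟨A, Subset.rfl, B, Subset.rfl, by rwa [hA], by rwa [hB], ?_⟩
    have := ZMod.cauchy_davenport (Fact.out : p.Prime) (s := A) (t := B)
      (card_pos.mp (by omega)) (card_pos.mp (by omega))
    omega

theorem main_Pcl : ∃ c : ℝ, 0 < c ∧ ∀ n, Pcl c n := by
  obtain ⟨ε₁, hε₁, n0, H⟩ := structure_thm (1 / 20000000) (by norm_num) (by norm_num)
  set N0 := max n0 10000000 with hN0
  set M := ⌈4 / ε₁ ^ 2⌉₊ with hM
  refine ⟨N0 + 2 * M + 2000, by positivity, ?_⟩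
  intro n
  induction n using Nat.strong_induction_on with
  | _ n IH =>
  by_cases hn : n ≤ N0
  · apply small_case
    have : (n : ℝ) ≤ N0 := by exact_mod_cast hn
    have : (0 : ℝ) ≤ M := by positivity
    linarith
  intro p _ A B hA hB hp
  have hn0 : n0 ≤ n := by omega
  have hn1 : 10000000 ≤ n := by omega
  have hnR : (0 : ℝ) < n := by
    have : 0 < n := by omega
    exact_mod_cast this
  set k := Nat.sqrt n + 1 with hk
  have hk2 : n ≤ k ^ 2 := by
    have := Nat.lt_succ_sqrt n
    rw [hk, sq]; exact this.le
  have hkn : k ≤ n := by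
    have h := Nat.sqrt_lt_self (n := n) (by omega)
    omega
  have hs1 : 1 ≤ Real.sqrt n := by
    rw [Real.one_le_sqrt]
    have : 1 ≤ n := by omega
    exact_mod_cast this
  have hkR : (k : ℝ) ≤ 2 * Real.sqrt n := by
    rw [hk]; push_cast
    have := Real.nat_sqrt_le_real_sqrt (a := n)
    linarith
  have hM4 : 4 ≤ M * ε₁ ^ 2 := by
    have := Nat.le_ceil (4 / ε₁ ^ 2)
    rwa [div_le_iff₀ (by positivity)] at this
  obtain ⟨A', a1, B', b1, -, -, a2, b2, hh⟩ := batch_iter A B ∅ ∅ k n ((ε₁ * n) ^ 2) hA hB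
    (by omega) hkn hk2 (empty_subset _) (empty_subset _) M
  have fin : ∀ a : ℕ, a ≤ 0 + M * k → (a : ℝ) ≤ ((N0 : ℝ) + 2 * M + 2000) * Real.sqrt n := by
    intro a ha
    have h1 : (a : ℝ) ≤ M * k := by
      rw [zero_add] at ha
      exact_mod_cast ha
    have h2 : (M : ℝ) * k ≤ M * (2 * Real.sqrt n) := mul_le_mul_of_nonneg_left hkR (by positivity)
    have h3 : 0 ≤ ((N0 : ℝ) + 2000) * Real.sqrt n := by positivity
    linarith
  by_cases hbig : 2 * n ≤ (A' + B').card
  · exact ⟨A', a1, B', b1, fin _ a2, fin _ b2, by omega⟩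
  rcases hh with hh | hh
  swap
  · exfalso
    apply hbig
    have e : (M : ℝ) * ((ε₁ * n) ^ 2 / (2 * n)) = (M * ε₁ ^ 2) * (n / 2) := by
      field_simp
    rw [e] at hh
    have h1 : 4 * ((n : ℝ) / 2) ≤ (M * ε₁ ^ 2) * (n / 2) :=
      mul_le_mul_of_nonneg_right hM4 (by positivity)
    have h2 : ((2 * n : ℕ) : ℝ) ≤ (A' + B').card := by
      push_cast
      have : (0 : ℝ) ≤ ((∅ + ∅ : Finset (ZMod p)).card : ℝ) := by positivity
      linarith
    exact_mod_cast h2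
  obtain ⟨u, hu, α, β, h1, h2⟩ := H p A B (A' + B') n hA hB hp hn0 hh (by omega)
  have inj : ∀ γ : ZMod p, Function.Injective (fun x => u * x - γ) := by
    intro γ x y h
    simpa [hu] using h
  have tr : ∀ m : ℕ, (1 - 1 / 20000000 : ℝ) * n ≤ m → n ≤ m + n / 10000000 := by
    intro m hm
    have : (19999999 * n : ℝ) ≤ 20000000 * m := by linarith
    have : 19999999 * n ≤ 20000000 * m := by exact_mod_cast this
    omega
  have g1 := tr _ h1
  have g2 := tr _ h2
  have i1 := shift_filter A u α n
  have i2 := shift_filter B u β n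
  obtain ⟨A1, x1, B1, y1, x2, y2, z⟩ := struct_case ((N0 : ℝ) + 2 * M + 2000)
    (by have : (0 : ℝ) ≤ (N0 : ℝ) + 2 * M := by positivity
        linarith) n (n / 10000000) (by omega) (by omega) IH
    (A.image (fun x => u * x - α)) (B.image (fun x => u * x - β))
    (by rw [card_image_of_injective _ (inj α), hA]) (by rw [card_image_of_injective _ (inj β), hB])
    hp (by omega) (by omega)
  obtain ⟨A2, w1, B2, w2, w3, w4, w5⟩ := transport A B u α β hu A1 B1 x1 y1
  exact ⟨A2, w1, B2, w2, by rwa [w3], by rwa [w4], by omega⟩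

theorem stmt0 :
    ∃ c : ℝ, 0 < c ∧
      ∀ (p n : ℕ), p.Prime →
        ∀ A B : Finset (ZMod p), A.card = n → B.card = n → (n : ℝ) ≤ (p : ℝ) / 3 →
          ∃ A' ⊆ A, ∃ B' ⊆ B, A'.card = B'.card ∧
            (A'.card : ℝ) ≤ c * Real.sqrt n ∧
            (2 * n - 1 : ℤ) ≤ ((A' + B').card : ℤ) := by
  obtain ⟨c, hc, H⟩ := main_Pcl
  refine ⟨c, hc, ?_⟩
  intro p n hp A B hA hB hn
  haveI : Fact p.Prime := ⟨hp⟩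
  have h3 : 3 * n ≤ p := by
    have : (3 * n : ℝ) ≤ p := by linarith
    exact_mod_cast this
  obtain ⟨A', a1, B', b1, a2, b2, h⟩ := H n p A B hA hB h3
  rcases le_total A'.card B'.card with hle | hle
  · obtain ⟨C, c1, c2, c3⟩ := Finset.exists_subsuperset_card_eq a1 hle
      (by rw [hA, ← hB]; exact card_le_card b1)
    have := card_le_card (add_subset_add c1 (Subset.refl B'))
    exact ⟨C, c2, B', b1, c3, by rwa [c3], by omega⟩
  · obtain ⟨C, c1, c2, c3⟩ := Finset.exists_subsuperset_card_eq b1 hle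
      (by rw [hB, ← hA]; exact card_le_card a1)
    have := card_le_card (add_subset_add (Subset.refl A') c1)
    exact ⟨A', a1, C, c2, c3.symm, a2, by omega⟩
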